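/- arXiv:2008.08539 — 2 statements merged into one kernel-verified Lean document; each statement's English description precedes it below -/
import Mathlib

section
/- Let 0 < p ≤ q. Then the sets S_{p,q} ∩ { z ∈ ℂ : Re(z) < 0 } and C_{p,q} ∩ { z ∈ ℂ : Re(z) < 0 } are bi-Lipschitz equivalent; that is, there exists a bijection g between them and a constant L ≥ 1 such that (1/L)|x − y| ≤ |g(x) − g(y)| ≤ L|x − y| for all x, y in the first set. -/
open Set Metric MeasureTheory

noncomputable def spiral (p q : ℝ) : Set ℂ :=
  {z : ℂ | ∃ t : ℝ, 1 < t ∧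
    z = (t ^ (-p) * Real.cos t : ℝ) + (t ^ (-q) * Real.sin t : ℝ) * Complex.I}

/-- The family of concentric ellipses `C_{p,q} = ⋃_{n ≥ 1} E((2πn)^{-p}, (2πn)^{-q})`. -/
noncomputable def ellipses (p q : ℝ) : Set ℂ :=
  {z : ℂ | ∃ n : ℕ, 1 ≤ n ∧ ∃ t : ℝ, 0 ≤ t ∧ t < 2 * Real.pi ∧
    z = ((2 * Real.pi * n) ^ (-p) * Real.cos t : ℝ) +
        ((2 * Real.pi * n) ^ (-q) * Real.sin t : ℝ) * Complex.I}

noncomputable section SpiralTurns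

open Real Set

/-- The radial parameter of a turn: `l = 1` is a turn of the spiral, `l = 0` is an ellipse. -/
def turnRadius (l N s : ℝ) : ℝ := N + l * (s - π)

def turnX (p l N s : ℝ) : ℝ := turnRadius l N s ^ (-p) * cos s

def turnY (q l N s : ℝ) : ℝ := turnRadius l N s ^ (-q) * sin s

def turnPoint (p q l N s : ℝ) : ℂ :=
  (-turnX p l N s : ℝ) + (-turnY q l N s : ℝ) * Complex.I

/-- The `ℓ¹` distance between two points lying on two turns. -/
def turnDist (p q l N s M t : ℝ) : ℝ :=
  |turnX p l N s - turnX p l M t| + |turnY q l N s - turnY q l M t|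

lemma turnDist_comm (p q l N s M t : ℝ) : turnDist p q l N s M t = turnDist p q l M t N s := by
  simp only [turnDist, abs_sub_comm]

lemma dist_turnPoint_le (p q l N s M t : ℝ) :
    dist (turnPoint p q l N s) (turnPoint p q l M t) ≤ turnDist p q l N s M t := by
  rw [Complex.dist_eq]
  refine (Complex.norm_le_abs_re_add_abs_im _).trans (le_of_eq ?_)
  simp [turnPoint, turnDist, abs_sub_comm, ← sub_eq_neg_add]

lemma turnDist_le (p q l N s M t : ℝ) :
    turnDist p q l N s M t ≤ 2 * dist (turnPoint p q l N s) (turnPoint p q l M t) := by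
  rw [Complex.dist_eq]
  have h1 := Complex.abs_re_le_norm (turnPoint p q l N s - turnPoint p q l M t)
  have h2 := Complex.abs_im_le_norm (turnPoint p q l N s - turnPoint p q l M t)
  have e1 : |(turnPoint p q l N s - turnPoint p q l M t).re|
      = |turnX p l N s - turnX p l M t| := by
    simp [turnPoint, abs_sub_comm, ← sub_eq_neg_add]
  have e2 : |(turnPoint p q l N s - turnPoint p q l M t).im|
      = |turnY q l N s - turnY q l M t| := by
    simp [turnPoint, abs_sub_comm, ← sub_eq_neg_add]
  unfold turnDist
  linarith

section Powers

lemma rpow_neg_sub_le {p a b : ℝ} (hp : 0 < p) (ha : 0 < a) (hab : a ≤ b) :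
    a ^ (-p) - b ^ (-p) ≤ (1 + p) * (a ^ (-p) * ((b - a) / b)) := by
  have hb : 0 < b := ha.trans_le hab
  have hz : 0 < a / b := by positivity
  have hz1 : a / b ≤ 1 := (div_le_one hb).2 hab
  have e : b ^ (-p) = a ^ (-p) * (a / b) ^ p := by
    rw [div_rpow ha.le hb.le, rpow_neg ha.le, rpow_neg hb.le]
    field_simp
  have e2 : (b - a) / b = 1 - a / b := by field_simp
  have key : 1 - (a / b) ^ p ≤ (1 + p) * (1 - a / b) := by
    rcases le_total p 1 with h | h
    · have := rpow_le_rpow_of_exponent_ge hz hz1 h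
      rw [rpow_one] at this
      nlinarith
    · have := one_add_mul_self_le_rpow_one_add (s := a / b - 1) (by linarith) h
      rw [add_sub_cancel] at this
      nlinarith
  rw [e, e2]
  have := mul_le_mul_of_nonneg_left key (rpow_pos_of_pos ha (-p)).le
  linarith

lemma le_rpow_neg_sub {p a b : ℝ} (hp : 0 < p) (ha : 0 < a) (hab : a ≤ b) :
    min 1 p * (a ^ (-p) * ((b - a) / b)) ≤ a ^ (-p) - b ^ (-p) := by
  have hb : 0 < b := ha.trans_le hab
  have hz : 0 < a / b := by positivity
  have hz1 : a / b ≤ 1 := (div_le_one hb).2 hab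
  have e : b ^ (-p) = a ^ (-p) * (a / b) ^ p := by
    rw [div_rpow ha.le hb.le, rpow_neg ha.le, rpow_neg hb.le]
    field_simp
  have e2 : (b - a) / b = 1 - a / b := by field_simp
  have key : min 1 p * (1 - a / b) ≤ 1 - (a / b) ^ p := by
    rcases le_total p 1 with h | h
    · have := rpow_one_add_le_one_add_mul_self (s := a / b - 1) (by linarith) hp.le h
      rw [add_sub_cancel] at this
      rw [min_eq_right h]
      nlinarith
    · have := rpow_le_rpow_of_exponent_ge hz hz1 h
      rw [rpow_one] at this
      rw [min_eq_left h]
      nlinarith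
  rw [e, e2]
  have := mul_le_mul_of_nonneg_left key (rpow_pos_of_pos ha (-p)).le
  linarith

lemma abs_rpow_neg_sub_le {p m a b : ℝ} (hp : 0 < p) (hm : 0 < m) (ha : m ≤ a) (hb : m ≤ b) :
    |a ^ (-p) - b ^ (-p)| ≤ (1 + p) * (m ^ (-p - 1) * |a - b|) := by
  wlog hab : a ≤ b generalizing a b
  · have := this hb ha (le_of_not_ge hab)
    rwa [abs_sub_comm, abs_sub_comm a b]
  have ha0 := hm.trans_le ha
  have hb0 := hm.trans_le hb
  rw [abs_of_nonneg (sub_nonneg.2 (rpow_le_rpow_of_nonpos ha0 hab (by linarith))),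
    abs_sub_comm, abs_of_nonneg (sub_nonneg.2 hab)]
  refine (rpow_neg_sub_le hp ha0 hab).trans ?_
  have h1 : a ^ (-p) ≤ m ^ (-p) := rpow_le_rpow_of_nonpos hm ha (by linarith)
  have h2 : (b - a) / b ≤ (b - a) / m := by
    apply div_le_div_of_nonneg_left (by linarith) hm hb
  rw [rpow_sub_one hm.ne']
  have h3 : a ^ (-p) * ((b - a) / b) ≤ m ^ (-p) * ((b - a) / m) :=
    mul_le_mul h1 h2 (div_nonneg (by linarith) hb0.le) (rpow_pos_of_pos hm _).le
  have : m ^ (-p) / m * (b - a) = m ^ (-p) * ((b - a) / m) := by ring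
  rw [this]
  gcongr

end Powers

section Radius

variable {l N s : ℝ}

lemma turnRadius_le (hl0 : 0 ≤ l) (hs : s ≤ π / 2) : turnRadius l N s ≤ N := by
  unfold turnRadius
  nlinarith [pi_pos]

lemma le_turnRadius (hl1 : l ≤ 1) (hN : 2 * π ≤ N) (hs : s ∈ Icc (-(π / 2)) (π / 2)) :
    N / 4 ≤ turnRadius l N s := by
  unfold turnRadius
  obtain ⟨h1, h2⟩ := hs
  nlinarith [pi_pos]

lemma one_le_turnRadius (hl1 : l ≤ 1) (hN : 2 * π ≤ N) (hs : s ∈ Icc (-(π / 2)) (π / 2)) :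
    1 ≤ turnRadius l N s := by
  have := le_turnRadius hl1 hN hs
  linarith [pi_gt_three]

lemma rpow_le_turnRadius_rpow {p : ℝ} (hp : 0 ≤ p) (hl0 : 0 ≤ l) (hl1 : l ≤ 1) (hN : 2 * π ≤ N)
    (hs : s ∈ Icc (-(π / 2)) (π / 2)) : N ^ (-p) ≤ turnRadius l N s ^ (-p) :=
  rpow_le_rpow_of_nonpos (zero_lt_one.trans_le (one_le_turnRadius hl1 hN hs))
    (turnRadius_le hl0 hs.2) (by linarith)

lemma quarter_rpow {p : ℝ} (hN : 2 * π ≤ N) : (N / 4) ^ (-p) = 4 ^ p * N ^ (-p) := by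
  have : 0 < N := by linarith [pi_pos]
  rw [div_rpow this.le (by norm_num), rpow_neg (by norm_num : (0:ℝ) ≤ 4)]
  field_simp

lemma turnRadius_rpow_le {p : ℝ} (hp : 0 ≤ p) (hl1 : l ≤ 1) (hN : 2 * π ≤ N)
    (hs : s ∈ Icc (-(π / 2)) (π / 2)) : turnRadius l N s ^ (-p) ≤ 4 ^ p * N ^ (-p) := by
  rw [← quarter_rpow hN]
  exact rpow_le_rpow_of_nonpos (by linarith [pi_pos]) (le_turnRadius hl1 hN hs) (by linarith)

end Radius

section LowerBound

lemma abs_sub_le_chord {s t : ℝ} (hs : s ∈ Icc (-(π / 2)) (π / 2))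
    (ht : t ∈ Icc (-(π / 2)) (π / 2)) :
    |s - t| ≤ 2 * (|cos s - cos t| + |sin s - sin t|) := by
  have hd : |(s - t) / 2| ≤ π / 2 := by
    rw [abs_le]
    constructor <;> linarith [hs.1, hs.2, ht.1, ht.2, pi_pos]
  have h1 := mul_abs_le_abs_sin hd
  have h2 : (cos s - cos t) ^ 2 + (sin s - sin t) ^ 2 = 4 * sin ((s - t) / 2) ^ 2 := by
    have e1 := sin_sq_add_cos_sq s
    have e2 := sin_sq_add_cos_sq t
    have e3 := cos_sub s t
    have e4 : cos (s - t) = 1 - 2 * sin ((s - t) / 2) ^ 2 := by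
      have := cos_sq' ((s - t) / 2)
      have h := cos_two_mul ((s - t) / 2)
      rw [mul_div_cancel₀ _ (two_ne_zero)] at h
      linarith
    nlinarith
  have h3 : 1 / 2 * |(s - t) / 2| ≤ |sin ((s - t) / 2)| := by
    refine le_trans (mul_le_mul_of_nonneg_right ?_ (abs_nonneg _)) h1
    rw [div_le_div_iff₀ two_pos pi_pos]
    linarith [pi_le_four]
  have h4 : |(s - t) / 2| = |s - t| / 2 := by rw [abs_div, abs_two]
  rw [h4] at h3
  have h5 : |s - t| ≤ 4 * |sin ((s - t) / 2)| := by linarith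
  have h6 : 2 * |sin ((s - t) / 2)| ≤ |cos s - cos t| + |sin s - sin t| := by
    refine (pow_le_pow_iff_left₀ (by positivity) (by positivity) two_ne_zero).1 ?_
    have a1 := sq_abs (cos s - cos t)
    have a2 := sq_abs (sin s - sin t)
    have a3 := sq_abs (sin ((s - t) / 2))
    have a4 := mul_nonneg (abs_nonneg (cos s - cos t)) (abs_nonneg (sin s - sin t))
    nlinarith
  linarith

lemma polar_lower_bound {p q : ℝ} (hp : 0 < p) (hpq : p ≤ q) :
    ∃ c > 0, ∀ r r' s t : ℝ, 1 ≤ r → r ≤ r' → s ∈ Icc (-(π / 2)) (π / 2) →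
      t ∈ Icc (-(π / 2)) (π / 2) → c * (r ^ (-q) * ((r' - r) / r' + |s - t|)) ≤
        |r ^ (-p) * cos s - r' ^ (-p) * cos t| + |r ^ (-q) * sin s - r' ^ (-q) * sin t| := by
  have hq : 0 < q := hp.trans_le hpq
  set k := min 1 p with hk
  have hk0 : 0 < k := lt_min one_pos hp
  refine ⟨1 / (6 + (3 + 2 * q) * (2 / k)), by positivity, ?_⟩
  intro r r' s t hr hrr hs ht
  have hr0 : 0 < r := by linarith
  have hr'0 : 0 < r' := by linarith
  set α := (r / r') ^ p with hα
  set β := (r / r') ^ q with hβ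
  set ε := (r' - r) / r' with hε
  have hε0 : 0 ≤ ε := div_nonneg (by linarith) hr'0.le
  have ea : r' ^ (-p) = r ^ (-p) * α := by
    rw [hα, div_rpow hr0.le hr'0.le, rpow_neg hr0.le, rpow_neg hr'0.le]
    field_simp
  have eb : r' ^ (-q) = r ^ (-q) * β := by
    rw [hβ, div_rpow hr0.le hr'0.le, rpow_neg hr0.le, rpow_neg hr'0.le]
    field_simp
  have hz0 : 0 < r / r' := by positivity
  have hz1 : r / r' ≤ 1 := (div_le_one hr'0).2 hrr
  have hα0 : 0 < α := rpow_pos_of_pos hz0 _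
  have hβ0 : 0 < β := rpow_pos_of_pos hz0 _
  have hα1 : α ≤ 1 := rpow_le_one hz0.le hz1 hp.le
  have hβ1 : β ≤ 1 := rpow_le_one hz0.le hz1 hq.le
  have hβα : β ≤ α := rpow_le_rpow_of_exponent_ge hz0 hz1 hpq
  have hap : 0 < r ^ (-p) := rpow_pos_of_pos hr0 _
  have hbp : 0 < r ^ (-q) := rpow_pos_of_pos hr0 _
  have hba : r ^ (-q) ≤ r ^ (-p) := rpow_le_rpow_of_exponent_le hr (by linarith)
  have h1 : k * ε ≤ 1 - α := by
    have := le_rpow_neg_sub hp hr0 hrr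
    rw [ea] at this
    refine le_of_mul_le_mul_left ?_ hap
    linarith
  have h2 : 1 - β ≤ (1 + q) * ε := by
    have := rpow_neg_sub_le hq hr0 hrr
    rw [eb] at this
    refine le_of_mul_le_mul_left ?_ hbp
    linarith
  set X := |cos s - α * cos t| with hX
  set Y := |sin s - β * sin t| with hY
  have hX0 : 0 ≤ X := abs_nonneg _
  have hY0 : 0 ≤ Y := abs_nonneg _
  have hD : r ^ (-q) * (X + Y) ≤
      |r ^ (-p) * cos s - r' ^ (-p) * cos t| + |r ^ (-q) * sin s - r' ^ (-q) * sin t| := by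
    rw [ea, eb, mul_assoc, mul_assoc, ← mul_sub, ← mul_sub, abs_mul, abs_mul, abs_of_pos hap,
      abs_of_pos hbp, mul_add]
    gcongr
  have hc2 : |cos s + α * cos t| ≤ 2 := by
    have a1 := abs_cos_le_one s
    have a2 := abs_cos_le_one t
    calc _ ≤ |cos s| + |α * cos t| := abs_add_le _ _
      _ ≤ 1 + 1 := by
        rw [abs_mul, abs_of_pos hα0]
        gcongr
        nlinarith [abs_nonneg (cos t)]
      _ = 2 := by norm_num
  have hs2 : |sin s + β * sin t| ≤ 2 := by
    have a1 := abs_sin_le_one s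
    have a2 := abs_sin_le_one t
    calc _ ≤ |sin s| + |β * sin t| := abs_add_le _ _
      _ ≤ 1 + 1 := by
        rw [abs_mul, abs_of_pos hβ0]
        gcongr
        nlinarith [abs_nonneg (sin t)]
      _ = 2 := by norm_num
  have h3 : 1 - α ≤ 2 * (X + Y) := by
    have b1 : (cos s - α * cos t) * (cos s + α * cos t) ≤ X * 2 := by
      refine (le_abs_self _).trans ?_
      rw [abs_mul]
      gcongr
    have b2 : (sin s - β * sin t) * (sin s + β * sin t) ≤ Y * 2 := by
      refine (le_abs_self _).trans ?_
      rw [abs_mul]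
      gcongr
    have e1 := sin_sq_add_cos_sq s
    have e2 := sin_sq_add_cos_sq t
    have b3 : β ^ 2 * sin t ^ 2 ≤ α ^ 2 * sin t ^ 2 := by gcongr
    have b4 : α ^ 2 * sin t ^ 2 + α ^ 2 * cos t ^ 2 = α ^ 2 := by rw [← mul_add, e2, mul_one]
    nlinarith
  have h4 : |cos s - cos t| ≤ X + (1 - α) := by
    have : cos s - cos t = (cos s - α * cos t) - (1 - α) * cos t := by ring
    rw [this]
    refine (abs_sub _ _).trans ?_
    rw [abs_mul, abs_of_nonneg (sub_nonneg.2 hα1)]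
    have := mul_le_mul_of_nonneg_left (abs_cos_le_one t) (sub_nonneg.2 hα1)
    linarith
  have h5 : |sin s - sin t| ≤ Y + (1 - β) := by
    have : sin s - sin t = (sin s - β * sin t) - (1 - β) * sin t := by ring
    rw [this]
    refine (abs_sub _ _).trans ?_
    rw [abs_mul, abs_of_nonneg (sub_nonneg.2 hβ1)]
    have := mul_le_mul_of_nonneg_left (abs_sin_le_one t) (sub_nonneg.2 hβ1)
    linarith
  have h6 := abs_sub_le_chord hs ht
  have h7 : ε ≤ 2 / k * (X + Y) := by
    rw [div_mul_eq_mul_div, le_div_iff₀ hk0]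
    linarith
  have h8 : ε + |s - t| ≤ (6 + (3 + 2 * q) * (2 / k)) * (X + Y) := by
    have : (3 + 2 * q) * ε ≤ (3 + 2 * q) * (2 / k * (X + Y)) := by gcongr
    linarith
  have hden : 0 < 6 + (3 + 2 * q) * (2 / k) := by positivity
  refine le_trans ?_ hD
  rw [div_mul_eq_mul_div, one_mul, div_le_iff₀ hden]
  calc _ ≤ r ^ (-q) * ((6 + (3 + 2 * q) * (2 / k)) * (X + Y)) := by gcongr
    _ = _ := by ring

lemma turnDist_lower_bound {p q : ℝ} (hp : 0 < p) (hpq : p ≤ q) :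
    ∃ c > 0, ∀ l N M s t : ℝ, 0 ≤ l → l ≤ 1 → 2 * π ≤ N → N ≤ M →
      s ∈ Icc (-(π / 2)) (π / 2) → t ∈ Icc (-(π / 2)) (π / 2) →
      c * (N ^ (-q) * ((M - N) / M + |s - t|)) ≤ turnDist p q l N s M t := by
  have hq : 0 < q := hp.trans_le hpq
  obtain ⟨c, hc, H⟩ := polar_lower_bound hp hpq
  refine ⟨c / 2, by positivity, ?_⟩
  intro l N M s t hl0 hl1 hN hNM hs ht
  have hM : 2 * π ≤ M := hN.trans hNM
  have hN0 : 0 < N := by linarith [pi_pos]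
  have hM1 : 1 ≤ M := by linarith [pi_gt_three]
  have hr1 := one_le_turnRadius hl1 hN hs
  have hr2 := one_le_turnRadius hl1 hM ht
  have hrN := turnRadius_le (N := N) hl0 hs.2
  have hrM := turnRadius_le (N := M) hl0 ht.2
  have hdiff : M - N ≤ |turnRadius l M t - turnRadius l N s| + |s - t| := by
    have e : M - N = (turnRadius l M t - turnRadius l N s) + l * (s - t) := by
      unfold turnRadius; ring
    have a1 := le_abs_self (turnRadius l M t - turnRadius l N s)
    have a2 : l * (s - t) ≤ |s - t| := by
      have := le_abs_self (s - t)
      have := abs_nonneg (s - t)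
      nlinarith
    linarith
  have key : ∀ R : ℝ, 1 ≤ R → R ≤ M → (M - N) / M + |s - t| ≤
      2 * (|turnRadius l M t - turnRadius l N s| / R + |s - t|) := by
    intro R hR hRM
    have hM0 : 0 < M := by linarith
    have a1 : (M - N) / M ≤ (|turnRadius l M t - turnRadius l N s| + |s - t|) / M := by gcongr
    have a2 : |turnRadius l M t - turnRadius l N s| / M
      ≤ |turnRadius l M t - turnRadius l N s| / R := by gcongr
    have a3 : |s - t| / M ≤ |s - t| := div_le_self (abs_nonneg _) hM1
    rw [add_div] at a1
    have a4 : 0 ≤ |turnRadius l M t - turnRadius l N s| / R := by positivity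
    linarith
  unfold turnDist turnX turnY
  rcases le_total (turnRadius l N s) (turnRadius l M t) with h | h
  · refine le_trans ?_ (H _ _ s t hr1 h hs ht)
    have := key _ hr2 hrM
    rw [abs_of_nonneg (sub_nonneg.2 h)] at this
    have h3 : N ^ (-q) ≤ turnRadius l N s ^ (-q) :=
      rpow_le_rpow_of_nonpos (by linarith) hrN (by linarith)
    calc _ = c / 2 * (N ^ (-q) * ((M - N) / M + |s - t|)) := by ring
      _ ≤ c / 2 * (turnRadius l N s ^ (-q) *
          (2 * ((turnRadius l M t - turnRadius l N s) / turnRadius l M t + |s - t|))) := by gcongr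
      _ = _ := by ring
  · rw [abs_sub_comm (turnRadius l N s ^ (-p) * cos s),
      abs_sub_comm (turnRadius l N s ^ (-q) * sin s)]
    refine le_trans ?_ (H _ _ t s hr2 h ht hs)
    have := key _ hr1 (hrN.trans hNM)
    rw [abs_sub_comm (turnRadius l M t), abs_of_nonneg (sub_nonneg.2 h)] at this
    have h3 : N ^ (-q) ≤ turnRadius l M t ^ (-q) :=
      rpow_le_rpow_of_nonpos (by linarith) (h.trans hrN) (by linarith)
    rw [abs_sub_comm t s]
    calc _ = c / 2 * (N ^ (-q) * ((M - N) / M + |s - t|)) := by ring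
      _ ≤ c / 2 * (turnRadius l M t ^ (-q) *
          (2 * ((turnRadius l N s - turnRadius l M t) / turnRadius l N s + |s - t|))) := by gcongr
      _ = _ := by ring

end LowerBound

section Displacement

variable {e : ℝ}

lemma turn_coordinate_lipschitz (he : 0 < e) {f : ℝ → ℝ} (hf : ∀ x, |f x| ≤ 1)
    (hL : ∀ x y, |f x - f y| ≤ |x - y|) :
    ∃ C > 0, ∀ l N s t : ℝ, 0 ≤ l → l ≤ 1 → 2 * π ≤ N → s ∈ Icc (-(π / 2)) (π / 2) →
      t ∈ Icc (-(π / 2)) (π / 2) →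
      |turnRadius l N s ^ (-e) * f s - turnRadius l N t ^ (-e) * f t| ≤
        C * (N ^ (-e) * |s - t|) := by
  refine ⟨4 ^ e + (1 + e) * 4 ^ (e + 1), by positivity, ?_⟩
  intro l N s t hl0 hl1 hN hs ht
  have hN1 : 1 ≤ N := by linarith [pi_gt_three]
  have hN0 : 0 < N := by linarith
  have hr := one_le_turnRadius hl1 hN hs
  have h1 := turnRadius_rpow_le he.le hl1 hN hs
  have h2 := abs_rpow_neg_sub_le he (by linarith : 0 < N / 4) (le_turnRadius hl1 hN hs)
    (le_turnRadius hl1 hN ht)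
  rw [← neg_add', quarter_rpow hN] at h2
  have h3 : |turnRadius l N s - turnRadius l N t| ≤ |s - t| := by
    have : turnRadius l N s - turnRadius l N t = l * (s - t) := by unfold turnRadius; ring
    rw [this, abs_mul, abs_of_nonneg hl0]
    exact mul_le_of_le_one_left (abs_nonneg _) hl1
  have h4 : N ^ (-(e + 1)) ≤ N ^ (-e) := rpow_le_rpow_of_exponent_le hN1 (by linarith)
  have h5 : |turnRadius l N s ^ (-e) - turnRadius l N t ^ (-e)| ≤
      (1 + e) * (4 ^ (e + 1) * N ^ (-e) * |s - t|) := h2.trans (by gcongr)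
  have e1 : turnRadius l N s ^ (-e) * f s - turnRadius l N t ^ (-e) * f t =
      turnRadius l N s ^ (-e) * (f s - f t) +
        (turnRadius l N s ^ (-e) - turnRadius l N t ^ (-e)) * f t := by ring
  rw [e1]
  refine (abs_add_le _ _).trans ?_
  rw [abs_mul, abs_mul, abs_of_pos (rpow_pos_of_pos (by linarith) (-e))]
  calc _ ≤ 4 ^ e * N ^ (-e) * |s - t| + (1 + e) * (4 ^ (e + 1) * N ^ (-e) * |s - t|) * 1 := by
        have f1 := hf t
        have f2 := hL s t
        gcongr
    _ = _ := by ring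

lemma shift_displacement_lipschitz (he : 0 < e) {v : ℝ} (hv0 : 0 ≤ v) (hv : v ≤ 3 * π / 2) :
    ∀ N M : ℝ, 2 * π ≤ N → N ≤ M →
      |((N - v) ^ (-e) - N ^ (-e)) - ((M - v) ^ (-e) - M ^ (-e))| ≤
        e * (2 + e) * 4 ^ (e + 2) * v * (N ^ (-e - 2) * (M - N)) := by
  intro N M hN hNM
  have hder : ∀ z ∈ Icc N M, HasDerivWithinAt (fun z : ℝ => (z - v) ^ (-e) - z ^ (-e))
      (-e * (z - v) ^ (-e - 1) - -e * z ^ (-e - 1)) (Icc N M) z := by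
    intro z hz
    have hz0 : 0 < z - v := by linarith [hz.1, pi_pos]
    have hz1 : 0 < z := by linarith
    have a1 := ((hasDerivAt_id z).sub_const v).rpow_const (p := -e) (Or.inl hz0.ne')
    have a2 := (hasDerivAt_id z).rpow_const (p := -e) (Or.inl hz1.ne')
    simp only [id, one_mul] at a1 a2
    exact (a1.sub a2).hasDerivWithinAt
  have hbound : ∀ z ∈ Icc N M, ‖-e * (z - v) ^ (-e - 1) - -e * z ^ (-e - 1)‖ ≤
      e * (2 + e) * 4 ^ (e + 2) * v * N ^ (-e - 2) := by
    intro z hz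
    have hN4 : N / 4 ≤ z - v := by linarith [hz.1]
    have hN4' : N / 4 ≤ z := by linarith
    have := abs_rpow_neg_sub_le (by linarith : 0 < e + 1) (by linarith [pi_pos] : 0 < N / 4)
      hN4 hN4'
    rw [show -(e + 1) - 1 = -(e + 2) by ring, quarter_rpow hN] at this
    have e1 : -e * (z - v) ^ (-e - 1) - -e * z ^ (-e - 1) =
        -e * ((z - v) ^ (-(e + 1)) - z ^ (-(e + 1))) := by rw [neg_add']; ring
    rw [e1, norm_mul, norm_eq_abs, norm_eq_abs, abs_neg, abs_of_pos he]
    have e2 : |z - v - z| = v := by rw [sub_sub_cancel_left, abs_neg, abs_of_nonneg hv0]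
    rw [e2] at this
    have := mul_le_mul_of_nonneg_left this he.le
    refine this.trans (le_of_eq ?_)
    rw [show -(e + 2) = -e - 2 by ring]
    ring
  have := (convex_Icc N M).norm_image_sub_le_of_norm_hasDerivWithin_le hder hbound
    (right_mem_Icc.2 hNM) (left_mem_Icc.2 hNM)
  rw [norm_eq_abs, norm_eq_abs, abs_sub_comm N M, abs_of_nonneg (sub_nonneg.2 hNM)] at this
  refine this.trans (le_of_eq ?_)
  ring

lemma turn_coordinate_displacement (he : 0 < e) {f : ℝ → ℝ} (hf : ∀ x, |f x| ≤ 1)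
    (hL : ∀ x y, |f x - f y| ≤ |x - y|) :
    ∃ C > 0, ∀ N M s t : ℝ, 2 * π ≤ N → N ≤ M → s ∈ Icc (-(π / 2)) (π / 2) →
      t ∈ Icc (-(π / 2)) (π / 2) →
      |(turnRadius 1 N s ^ (-e) * f s - turnRadius 1 M t ^ (-e) * f t) -
        (turnRadius 0 N s ^ (-e) * f s - turnRadius 0 M t ^ (-e) * f t)| ≤
        C * (N ^ (-e - 1) * ((M - N) / M + |s - t|)) := by
  set B := (1 + e) * 4 ^ (e + 1) with hB
  have hB0 : 0 < B := by positivity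
  set K := e * (2 + e) * 4 ^ (e + 2) with hK
  have hK0 : 0 < K := by positivity
  refine ⟨6 * B + 20 * B + 10 * K, by positivity, ?_⟩
  intro N M s t hN hNM hs ht
  have hπ : π < 3.15 := pi_lt_d2
  have hπ3 := pi_gt_three
  have hN0 : 0 < N := by linarith
  have hN1 : 1 ≤ N := by linarith
  have hM : 2 * π ≤ M := hN.trans hNM
  have hM0 : 0 < M := by linarith
  have hP : 0 < N ^ (-e - 1) := rpow_pos_of_pos hN0 _
  set d : ℝ → ℝ → ℝ := fun N s => turnRadius 1 N s ^ (-e) - N ^ (-e) with hd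
  have hd1 : ∀ N s, 2 * π ≤ N → s ∈ Icc (-(π / 2)) (π / 2) → |d N s| ≤ 5 * B * N ^ (-e - 1) := by
    intro N s hN hs
    have := abs_rpow_neg_sub_le he (by linarith : 0 < N / 4) (le_turnRadius le_rfl hN hs)
      (by linarith : N / 4 ≤ N)
    rw [← neg_add', quarter_rpow hN, neg_add'] at this
    have e1 : |turnRadius 1 N s - N| ≤ 5 := by
      unfold turnRadius
      rw [abs_le]
      constructor <;> linarith [hs.1, hs.2]
    refine this.trans ?_
    have hp : 0 ≤ N ^ (-e - 1) := rpow_nonneg (by linarith) _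
    calc _ ≤ (1 + e) * (4 ^ (e + 1) * N ^ (-e - 1) * 5) := by gcongr
      _ = _ := by rw [hB]; ring
  have hd2 : |d N s - d N t| ≤ B * N ^ (-e - 1) * |s - t| := by
    have := abs_rpow_neg_sub_le he (by linarith : 0 < N / 4) (le_turnRadius le_rfl hN hs)
      (le_turnRadius le_rfl hN ht)
    rw [← neg_add', quarter_rpow hN, neg_add'] at this
    have e1 : turnRadius 1 N s - turnRadius 1 N t = s - t := by unfold turnRadius; ring
    rw [e1] at this
    simp only [hd, sub_sub_sub_cancel_right]
    refine this.trans (le_of_eq ?_)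
    rw [hB]; ring
  have hd3 : |d N t - d M t| ≤ (20 * B + 10 * K) * N ^ (-e - 1) * ((M - N) / M) := by
    rcases le_total M (2 * N) with h | h
    · have := shift_displacement_lipschitz he (v := π - t) (by linarith [ht.2])
        (by linarith [ht.1]) N M hN hNM
      have e1 : ∀ N, turnRadius 1 N t = N - (π - t) := by intro N; unfold turnRadius; ring
      simp only [hd, e1]
      refine this.trans ?_
      rw [← hK]
      have e2 : N ^ (-e - 2) = N ^ (-e - 1) / N := by rw [← rpow_sub_one hN0.ne']; ring_nf
      have e3 : (M - N) / N ≤ 2 * ((M - N) / M) := by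
        rw [← mul_div_assoc, div_le_div_iff₀ hN0 hM0]
        nlinarith
      have hv : π - t ≤ 5 := by linarith [ht.1]
      have hv0 : 0 ≤ π - t := by linarith [ht.2]
      have hq : 0 ≤ (M - N) / N := div_nonneg (by linarith) hN0.le
      calc _ = K * (π - t) * (N ^ (-e - 1) * ((M - N) / N)) := by rw [e2]; ring
        _ ≤ K * 5 * (N ^ (-e - 1) * (2 * ((M - N) / M))) := by gcongr
        _ ≤ _ := by
          have : 0 ≤ 20 * B * (N ^ (-e - 1) * ((M - N) / M)) := by
            have : 0 ≤ (M - N) / M := div_nonneg (by linarith) hM0.le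
            positivity
          linarith
    · have a1 := hd1 N t hN ht
      have a2 := hd1 M t hM ht
      have a3 : M ^ (-e - 1) ≤ N ^ (-e - 1) := rpow_le_rpow_of_nonpos hN0 hNM (by linarith)
      have a4 : 1 / 2 ≤ (M - N) / M := by
        rw [div_le_div_iff₀ two_pos hM0]; linarith
      have a5 : B * M ^ (-e - 1) ≤ B * N ^ (-e - 1) := by gcongr
      calc _ ≤ |d N t| + |d M t| := abs_sub _ _
        _ ≤ 20 * B * N ^ (-e - 1) * (1 / 2) := by linarith
        _ ≤ 20 * B * N ^ (-e - 1) * ((M - N) / M) := by gcongr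
        _ ≤ _ := by
          have : 0 ≤ (M - N) / M := by linarith
          gcongr
          linarith
  have e0 : ∀ N s, turnRadius 0 N s = N := by intro N s; simp [turnRadius]
  rw [e0, e0]
  have e1 : turnRadius 1 N s ^ (-e) * f s - turnRadius 1 M t ^ (-e) * f t -
      (N ^ (-e) * f s - M ^ (-e) * f t) =
      d N s * (f s - f t) + ((d N s - d N t) * f t + (d N t - d M t) * f t) := by
    simp only [hd]; ring
  rw [e1]
  have hR : 0 ≤ (M - N) / M := div_nonneg (by linarith) hM0.le
  calc _ ≤ |d N s| * |f s - f t| + (|d N s - d N t| * |f t| + |d N t - d M t| * |f t|) := by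
        rw [← abs_mul, ← abs_mul, ← abs_mul]
        exact (abs_add_le _ _).trans (add_le_add_right (abs_add_le _ _) _)
    _ ≤ 5 * B * N ^ (-e - 1) * |s - t| + (B * N ^ (-e - 1) * |s - t| * 1 +
          (20 * B + 10 * K) * N ^ (-e - 1) * ((M - N) / M) * 1) := by
        have f1 := hf t
        have f2 := hL s t
        have f3 := hd1 N s hN hs
        gcongr
    _ ≤ _ := by
        have : 0 ≤ (20 * B + 10 * K) * N ^ (-e - 1) * |s - t| := by positivity
        have : 0 ≤ 6 * B * N ^ (-e - 1) * ((M - N) / M) := by positivity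
        linarith

lemma abs_cos_sub_le (x y : ℝ) : |cos x - cos y| ≤ |x - y| := by
  simpa [dist_eq] using lipschitzWith_cos.dist_le_mul x y

lemma abs_sin_sub_le (x y : ℝ) : |sin x - sin y| ≤ |x - y| := by
  simpa [dist_eq] using lipschitzWith_sin.dist_le_mul x y

/-- For close exponents, keeping the angle fixed is bi-Lipschitz. -/
lemma turnDist_bilipschitz_of_le_add_one {p q : ℝ} (hp : 0 < p) (hpq : p ≤ q) (hq : q ≤ p + 1) :
    ∃ L > 0, ∀ N M s t : ℝ, 2 * π ≤ N → N ≤ M → s ∈ Icc (-(π / 2)) (π / 2) →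
      t ∈ Icc (-(π / 2)) (π / 2) →
      turnDist p q 0 N s M t ≤ L * turnDist p q 1 N s M t ∧
      turnDist p q 1 N s M t ≤ L * turnDist p q 0 N s M t := by
  have hq0 := hp.trans_le hpq
  obtain ⟨c, hc, H⟩ := turnDist_lower_bound hp hpq
  obtain ⟨C₁, hC₁, H₁⟩ := turn_coordinate_displacement hp abs_cos_le_one abs_cos_sub_le
  obtain ⟨C₂, hC₂, H₂⟩ := turn_coordinate_displacement hq0 abs_sin_le_one abs_sin_sub_le
  refine ⟨1 + (C₁ + C₂) / c, by positivity, ?_⟩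
  intro N M s t hN hNM hs ht
  have hN1 : 1 ≤ N := by linarith [pi_gt_three]
  have hM0 : 0 < M := by linarith
  have h1 := H₁ N M s t hN hNM hs ht
  have h2 := H₂ N M s t hN hNM hs ht
  have g0 := H 0 N M s t le_rfl zero_le_one hN hNM hs ht
  have g1 := H 1 N M s t zero_le_one le_rfl hN hNM hs ht
  set ω := (M - N) / M + |s - t| with hω
  have hω0 : 0 ≤ ω := add_nonneg (div_nonneg (by linarith) hM0.le) (abs_nonneg _)
  have k1 : N ^ (-p - 1) ≤ N ^ (-q) := rpow_le_rpow_of_exponent_le hN1 (by linarith)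
  have k2 : N ^ (-q - 1) ≤ N ^ (-q) := rpow_le_rpow_of_exponent_le hN1 (by linarith)
  have b1 : C₁ * (N ^ (-p - 1) * ω) ≤ C₁ * (N ^ (-q) * ω) := by gcongr
  have b2 : C₂ * (N ^ (-q - 1) * ω) ≤ C₂ * (N ^ (-q) * ω) := by gcongr
  have d1 : |turnDist p q 1 N s M t - turnDist p q 0 N s M t| ≤ (C₁ + C₂) * (N ^ (-q) * ω) := by
    have a1 := abs_abs_sub_abs_le_abs_sub (turnX p 1 N s - turnX p 1 M t)
      (turnX p 0 N s - turnX p 0 M t)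
    have a2 := abs_abs_sub_abs_le_abs_sub (turnY q 1 N s - turnY q 1 M t)
      (turnY q 0 N s - turnY q 0 M t)
    unfold turnDist
    rw [add_sub_add_comm]
    refine (abs_add_le _ _).trans ?_
    unfold turnX turnY at *
    linarith
  have key : ∀ D, c * (N ^ (-q) * ω) ≤ D → (C₁ + C₂) * (N ^ (-q) * ω) ≤ (C₁ + C₂) / c * D := by
    intro D hD
    rw [div_mul_eq_mul_div, le_div_iff₀ hc]
    calc _ = (C₁ + C₂) * (c * (N ^ (-q) * ω)) := by ring
      _ ≤ _ := by gcongr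
  have f0 := key _ g0
  have f1 := key _ g1
  have := abs_le.1 d1
  constructor <;> linarith

end Displacement

section Tip

/-- `σ` is the parameter at which the abscissa of a turn is extremal, and the abscissa is
quadratic around `σ`, with constants controlled by `K`. -/
structure IsTip (p K l N σ : ℝ) : Prop where
  abs_le_quarter : |σ| ≤ 1 / 4
  abs_le_div : |σ| ≤ K / N
  turnX_le : ∀ s ∈ Icc (-(π / 2)) (π / 2), turnX p l N s ≤ turnX p l N σ
  le_mul_abs_sub : ∀ s ∈ Icc (-(π / 2)) (π / 2), ∀ t ∈ Icc (-(π / 2)) (π / 2),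
    0 ≤ (s - σ) * (t - σ) →
    N ^ (-p) * |(s - σ) ^ 2 - (t - σ) ^ 2| ≤ K * |turnX p l N s - turnX p l N t|
  abs_sub_le_mul : ∀ s ∈ Icc (-(π / 2)) (π / 2), ∀ t ∈ Icc (-(π / 2)) (π / 2),
    0 ≤ (s - σ) * (t - σ) →
    |turnX p l N s - turnX p l N t| ≤ K * (N ^ (-p) * |(s - σ) ^ 2 - (t - σ) ^ 2|)

/-- The abscissa of a turn has derivative `-r ^ (-p) * turnSlope`. -/
def turnSlope (p l N s : ℝ) : ℝ := sin s + l * p / turnRadius l N s * cos s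

variable {p l N s : ℝ}

lemma hasDerivAt_turnRadius : HasDerivAt (turnRadius l N) l s := by
  unfold turnRadius
  simpa using (((hasDerivAt_id s).sub_const π).const_mul l).const_add N

lemma hasDerivAt_turnX (hr : 0 < turnRadius l N s) :
    HasDerivAt (turnX p l N) (-(turnRadius l N s ^ (-p) * turnSlope p l N s)) s := by
  have h := ((hasDerivAt_turnRadius (l := l) (N := N) (s := s)).rpow_const
    (p := -p) (Or.inl hr.ne')).mul (hasDerivAt_cos s)
  refine h.congr_deriv ?_
  rw [rpow_sub_one hr.ne', turnSlope]
  field_simp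
  ring

lemma hasDerivAt_turnSlope (hr : turnRadius l N s ≠ 0) :
    HasDerivAt (turnSlope p l N) (cos s - l * p / turnRadius l N s * sin s -
      l ^ 2 * p / turnRadius l N s ^ 2 * cos s) s := by
  have h := (hasDerivAt_sin s).add
    (((hasDerivAt_const s (l * p)).div (hasDerivAt_turnRadius (l := l) (N := N)) hr).mul
      (hasDerivAt_cos s))
  refine h.congr_deriv ?_
  simp only [Pi.div_apply]
  field_simp
  ring

lemma turnSlope_bounds (hp : 0 < p) (hl0 : 0 ≤ l) (hl1 : l ≤ 1) (hN : 64 * (p + 1) ≤ N) :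
    ∃ σ, |σ| ≤ 1 / 4 ∧ |σ| ≤ 8 * p / N ∧
      (∀ s ∈ Icc (-(π / 2)) (π / 2), σ ≤ s →
        (s - σ) / 4 ≤ turnSlope p l N s ∧ turnSlope p l N s ≤ 2 * (s - σ)) ∧
      (∀ s ∈ Icc (-(π / 2)) (π / 2), s ≤ σ →
        turnSlope p l N s ≤ (s - σ) / 4 ∧ 2 * (s - σ) ≤ turnSlope p l N s) := by
  have hπ4 : π < 3.15 := pi_lt_d2
  have hπ3 := pi_gt_three
  have hN0 : 0 < N := by linarith
  have hN2 : 2 * π ≤ N := by linarith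
  have hr : ∀ s ∈ Icc (-(π / 2)) (π / 2), 1 ≤ turnRadius l N s :=
    fun s hs => one_le_turnRadius hl1 hN2 hs
  have hρ : ∀ s ∈ Icc (-(π / 2)) (π / 2), 0 ≤ l * p / turnRadius l N s ∧
      l * p / turnRadius l N s ≤ 1 / 16 ∧ l * p / turnRadius l N s ≤ 4 * p / N := by
    intro s hs
    have h1 := hr s hs
    have h2 := le_turnRadius hl1 hN2 hs
    have h3 : l * p ≤ p := mul_le_of_le_one_left hp.le hl1
    have h4 : l * p / turnRadius l N s ≤ 4 * p / N := by
      rw [div_le_div_iff₀ (by linarith) hN0]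
      nlinarith [mul_nonneg hl0 hp.le]
    refine ⟨by positivity, h4.trans ?_, h4⟩
    rw [div_le_div_iff₀ hN0 (by norm_num)]
    linarith
  set δ := 8 * p / N with hδ
  have hδ0 : 0 < δ := by positivity
  have hδ1 : δ ≤ 1 / 8 := by
    rw [hδ, div_le_div_iff₀ hN0 (by norm_num)]
    linarith
  have hcont : ContinuousOn (turnSlope p l N) (Icc (-(π / 2)) (π / 2)) := fun s hs =>
    (hasDerivAt_turnSlope (by linarith [hr s hs])).continuousAt.continuousWithinAt
  obtain ⟨σ, hσ, hσ0⟩ : ∃ σ ∈ Icc (-δ) 0, turnSlope p l N σ = 0 := by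
    have hsub : Icc (-δ) 0 ⊆ Icc (-(π / 2)) (π / 2) :=
      Icc_subset_Icc (by linarith) (by linarith)
    refine intermediate_value_Icc (by linarith) (hcont.mono hsub) ⟨?_, ?_⟩
    · have hm : -δ ∈ Icc (-(π / 2)) (π / 2) := hsub ⟨le_rfl, by linarith⟩
      obtain ⟨h1, h2, h3⟩ := hρ _ hm
      have h4 : 2 / π * δ ≤ sin δ := mul_le_sin hδ0.le (by linarith)
      have h5 : 1 / 2 * δ ≤ 2 / π * δ := by
        refine mul_le_mul_of_nonneg_right ?_ hδ0.le
        rw [div_le_div_iff₀ two_pos pi_pos]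
        linarith
      have h6 : 4 * p / N = δ / 2 := by rw [hδ]; ring
      unfold turnSlope
      rw [sin_neg]
      have := mul_le_of_le_one_right h1 (cos_le_one (-δ))
      linarith
    · have hm : (0 : ℝ) ∈ Icc (-(π / 2)) (π / 2) := hsub ⟨by linarith, le_rfl⟩
      simpa [turnSlope] using (hρ _ hm).1
  have hσm : σ ∈ Icc (-(π / 2)) (π / 2) := ⟨by linarith [hσ.1], by linarith [hσ.2]⟩
  have habs : |σ| ≤ δ := abs_le.2 ⟨hσ.1, by linarith [hσ.2]⟩
  have hu : ∀ s ∈ Icc (-(π / 2)) (π / 2), cos s - l * p / turnRadius l N s * sin s -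
      l ^ 2 * p / turnRadius l N s ^ 2 * cos s ∈ Icc (cos s - 1 / 8) 2 := by
    intro s hs
    obtain ⟨h1, h2, h3⟩ := hρ s hs
    have h4 := hr s hs
    have h5 : l ^ 2 * p / turnRadius l N s ^ 2 =
        l * p / turnRadius l N s * (l / turnRadius l N s) := by
      field_simp
    have h6 : l / turnRadius l N s ≤ 1 := (div_le_one (by linarith)).2 (by linarith)
    have h7 : 0 ≤ l / turnRadius l N s := by positivity
    have h8 : l * p / turnRadius l N s * (l / turnRadius l N s) ≤ 1 / 16 := by nlinarith
    have h9 : 0 ≤ l * p / turnRadius l N s * (l / turnRadius l N s) := mul_nonneg h1 h7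
    rw [h5]
    have c0 := cos_nonneg_of_mem_Icc hs
    have c1 := cos_le_one s
    have s1 := sin_le_one s
    have s0 := neg_one_le_sin s
    constructor <;> nlinarith
  have hup : MonotoneOn (fun s => 2 * (s - σ) - turnSlope p l N s) (Icc (-(π / 2)) (π / 2)) := by
    refine monotoneOn_of_hasDerivWithinAt_nonneg (convex_Icc _ _)
      ((by fun_prop : Continuous fun s => 2 * (s - σ)).continuousOn.sub hcont)
      (fun s hs => ((((hasDerivAt_id s).sub_const σ).const_mul 2).sub (hasDerivAt_turnSlope
        (by linarith [hr s (interior_subset hs)]))).hasDerivWithinAt) ?_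
    intro s hs
    have := (hu s (interior_subset hs)).2
    linarith
  have hlow : MonotoneOn (fun s => turnSlope p l N s - (s - σ) / 4) (Icc (-1) 1) := by
    have hsub : Icc (-1 : ℝ) 1 ⊆ Icc (-(π / 2)) (π / 2) :=
      Icc_subset_Icc (by linarith) (by linarith)
    refine monotoneOn_of_hasDerivWithinAt_nonneg (convex_Icc _ _)
      ((hcont.mono hsub).sub (by fun_prop : Continuous fun s => (s - σ) / 4).continuousOn)
      (fun s hs => ((hasDerivAt_turnSlope (by linarith [hr s (hsub (interior_subset hs))])).sub
        (((hasDerivAt_id s).sub_const σ).div_const 4)).hasDerivWithinAt) ?_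
    intro s hs
    have hs' := interior_subset hs
    have := (hu s (hsub hs')).1
    have h1 := one_sub_sq_div_two_le_cos (x := s)
    have h2 : s ^ 2 ≤ 1 := by nlinarith [hs'.1, hs'.2]
    linarith
  have hσ1 : σ ∈ Icc (-1 : ℝ) 1 := ⟨by linarith [hσ.1], by linarith [hσ.2]⟩
  have hsin : ∀ s ∈ Icc 1 (π / 2), 3 / 5 ≤ sin s := by
    intro s hs
    have h4 : 2 / π * s ≤ sin s := mul_le_sin (by linarith [hs.1]) hs.2
    have h5 : 3 / 5 ≤ 2 / π := by
      rw [div_le_div_iff₀ (by norm_num) pi_pos]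
      linarith
    nlinarith [hs.1]
  refine ⟨σ, by linarith, habs, ?_, ?_⟩
  · intro s hs hσs
    constructor
    · rcases le_total s 1 with h | h
      · have := hlow hσ1 ⟨hσ1.1.trans hσs, h⟩ hσs
        simp only [hσ0] at this
        linarith
      · have h1 := hsin s ⟨h, hs.2⟩
        have h2 := mul_nonneg (hρ s hs).1 (cos_nonneg_of_mem_Icc hs)
        unfold turnSlope
        linarith [hσ.1, hs.2]
    · have := hup hσm hs hσs
      simp only [hσ0] at this
      linarith
  · intro s hs hσs
    constructor
    · rcases le_total (-1) s with h | h
      · have := hlow ⟨h, hσs.trans hσ1.2⟩ hσ1 hσs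
        simp only [hσ0] at this
        linarith
      · have h1 := hsin (-s) ⟨by linarith, by linarith [hs.1]⟩
        rw [sin_neg] at h1
        have h2 := mul_le_of_le_one_right (hρ s hs).1 (cos_le_one s)
        have := (hρ s hs).2.1
        unfold turnSlope
        linarith [hσ.2, hs.1]
    · have := hup hs hσm hσs
      simp only [hσ0] at this
      linarith

end Tip

section TipExistence

lemma exists_isTip {p : ℝ} (hp : 0 < p) :
    ∃ K ≥ 1, ∃ N₀ ≥ 2 * π, ∀ l N : ℝ, 0 ≤ l → l ≤ 1 → N₀ ≤ N → ∃ σ, IsTip p K l N σ := by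
  have hπ4 : π < 3.15 := pi_lt_d2
  refine ⟨8 + 8 * p + 4 ^ p, ?_, 64 * (p + 1), by linarith, ?_⟩
  · have : (0 : ℝ) < 4 ^ p := by positivity
    linarith
  intro l N hl0 hl1 hN
  obtain ⟨σ, h1, h2, hR, hL⟩ := turnSlope_bounds hp hl0 hl1 hN
  have h4p : (0 : ℝ) < 4 ^ p := by positivity
  have hN0 : 0 < N := by linarith
  have hN2 : 2 * π ≤ N := by linarith
  have hσ := abs_le.1 h1
  have hNp : 0 < N ^ (-p) := rpow_pos_of_pos hN0 _
  set I := Icc (-(π / 2)) (π / 2) with hI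
  have hπ3 := pi_gt_three
  have hRI : Icc σ (π / 2) ⊆ I := Icc_subset_Icc (by linarith [hσ.1]) le_rfl
  have hLI : Icc (-(π / 2)) σ ⊆ I := Icc_subset_Icc le_rfl (by linarith [hσ.2])
  have hder : ∀ a : ℝ, ∀ s ∈ I, HasDerivAt (fun s => turnX p l N s + a * (s - σ) ^ 2)
      (-(turnRadius l N s ^ (-p) * turnSlope p l N s) + a * (2 * (s - σ))) s := by
    intro a s hs
    have := (hasDerivAt_turnX (p := p)
      (zero_lt_one.trans_le (one_le_turnRadius hl1 hN2 hs))).add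
      ((((hasDerivAt_id s).sub_const σ).pow 2).const_mul a)
    refine this.congr_deriv ?_
    simp
  have hcont : ∀ a : ℝ, ∀ J ⊆ I,
      ContinuousOn (fun s => turnX p l N s + a * (s - σ) ^ 2) J := fun a J hJ s hs =>
    (hder a s (hJ hs)).continuousAt.continuousWithinAt
  have hrb : ∀ s ∈ I, N ^ (-p) ≤ turnRadius l N s ^ (-p) ∧
      turnRadius l N s ^ (-p) ≤ 4 ^ p * N ^ (-p) := fun s hs =>
    ⟨rpow_le_turnRadius_rpow hp.le hl0 hl1 hN2 hs, turnRadius_rpow_le hp.le hl1 hN2 hs⟩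
  have m1 : AntitoneOn (fun s => turnX p l N s + N ^ (-p) / 8 * (s - σ) ^ 2) (Icc σ (π / 2)) := by
    refine antitoneOn_of_hasDerivWithinAt_nonpos (convex_Icc _ _) (hcont _ _ hRI)
      (fun s hs => (hder _ s (hRI (interior_subset hs))).hasDerivWithinAt) ?_
    intro s hs
    have hs' := interior_subset hs
    have a1 := (hR s (hRI hs') hs'.1).1
    have a2 := (hrb s (hRI hs')).1
    have : N ^ (-p) * ((s - σ) / 4) ≤ turnRadius l N s ^ (-p) * turnSlope p l N s :=
      mul_le_mul a2 a1 (by linarith [hs'.1]) (hNp.le.trans a2)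
    linarith
  have m2 : MonotoneOn (fun s => turnX p l N s + 4 ^ p * N ^ (-p) * (s - σ) ^ 2)
      (Icc σ (π / 2)) := by
    refine monotoneOn_of_hasDerivWithinAt_nonneg (convex_Icc _ _) (hcont _ _ hRI)
      (fun s hs => (hder _ s (hRI (interior_subset hs))).hasDerivWithinAt) ?_
    intro s hs
    have hs' := interior_subset hs
    have a1 := hR s (hRI hs') hs'.1
    have a2 := (hrb s (hRI hs'))
    have : turnRadius l N s ^ (-p) * turnSlope p l N s ≤ 4 ^ p * N ^ (-p) * (2 * (s - σ)) :=
      mul_le_mul a2.2 a1.2 (by linarith [hs'.1]) (by positivity)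
    linarith
  have m3 : MonotoneOn (fun s => turnX p l N s + N ^ (-p) / 8 * (s - σ) ^ 2)
      (Icc (-(π / 2)) σ) := by
    refine monotoneOn_of_hasDerivWithinAt_nonneg (convex_Icc _ _) (hcont _ _ hLI)
      (fun s hs => (hder _ s (hLI (interior_subset hs))).hasDerivWithinAt) ?_
    intro s hs
    have hs' := interior_subset hs
    have a1 := (hL s (hLI hs') hs'.2).1
    have a2 := (hrb s (hLI hs')).1
    have : N ^ (-p) * (-((s - σ) / 4)) ≤ turnRadius l N s ^ (-p) * (-turnSlope p l N s) :=
      mul_le_mul a2 (by linarith) (by linarith [hs'.2]) (hNp.le.trans a2)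
    linarith
  have m4 : AntitoneOn (fun s => turnX p l N s + 4 ^ p * N ^ (-p) * (s - σ) ^ 2)
      (Icc (-(π / 2)) σ) := by
    refine antitoneOn_of_hasDerivWithinAt_nonpos (convex_Icc _ _) (hcont _ _ hLI)
      (fun s hs => (hder _ s (hLI (interior_subset hs))).hasDerivWithinAt) ?_
    intro s hs
    have hs' := interior_subset hs
    have a1 := hL s (hLI hs') hs'.2
    have a2 := (hrb s (hLI hs'))
    have : turnRadius l N s ^ (-p) * (-turnSlope p l N s) ≤
        4 ^ p * N ^ (-p) * (-(2 * (s - σ))) :=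
      mul_le_mul a2.2 (by linarith) (by linarith [hs'.2]) (by positivity)
    linarith
  have key : ∀ s ∈ I, ∀ t ∈ I, 0 ≤ (s - σ) * (t - σ) → (t - σ) ^ 2 ≤ (s - σ) ^ 2 →
      N ^ (-p) / 8 * ((s - σ) ^ 2 - (t - σ) ^ 2) ≤ turnX p l N t - turnX p l N s ∧
      turnX p l N t - turnX p l N s ≤ 4 ^ p * N ^ (-p) * ((s - σ) ^ 2 - (t - σ) ^ 2) := by
    intro s hs t ht hst hts
    have hab := sq_le_sq.1 hts
    rcases le_total σ s with h | h
    · have h' : σ ≤ t := by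
        rcases h.eq_or_lt with h0 | h0
        · subst h0
          simp only [sub_self, abs_zero, abs_nonpos_iff] at hab
          linarith
        · have := nonneg_of_mul_nonneg_right hst (sub_pos.2 h0)
          linarith
      rw [abs_of_nonneg (by linarith), abs_of_nonneg (by linarith)] at hab
      have b1 := m1 ⟨h', ht.2⟩ ⟨h, hs.2⟩ (by linarith)
      have b2 := m2 ⟨h', ht.2⟩ ⟨h, hs.2⟩ (by linarith)
      simp only at b1 b2
      constructor <;> linarith
    · have h' : t ≤ σ := by
        rcases h.eq_or_lt with h0 | h0
        · subst h0
          simp only [sub_self, abs_zero, abs_nonpos_iff] at hab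
          linarith
        · by_contra hc
          have := mul_neg_of_neg_of_pos (sub_neg.2 h0) (sub_pos.2 (not_le.1 hc))
          linarith
      rw [abs_of_nonpos (by linarith), abs_of_nonpos (by linarith)] at hab
      have b1 := m3 ⟨hs.1, h⟩ ⟨ht.1, h'⟩ (by linarith)
      have b2 := m4 ⟨hs.1, h⟩ ⟨ht.1, h'⟩ (by linarith)
      simp only at b1 b2
      constructor <;> linarith
  have key2 : ∀ s ∈ I, ∀ t ∈ I, 0 ≤ (s - σ) * (t - σ) →
      N ^ (-p) / 8 * |(s - σ) ^ 2 - (t - σ) ^ 2| ≤ |turnX p l N s - turnX p l N t| ∧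
      |turnX p l N s - turnX p l N t| ≤ 4 ^ p * N ^ (-p) * |(s - σ) ^ 2 - (t - σ) ^ 2| := by
    intro s hs t ht hst
    rcases le_total ((t - σ) ^ 2) ((s - σ) ^ 2) with h | h
    · obtain ⟨b1, b2⟩ := key s hs t ht hst h
      have : 0 ≤ N ^ (-p) / 8 * ((s - σ) ^ 2 - (t - σ) ^ 2) :=
        mul_nonneg (by positivity) (by linarith)
      rw [abs_of_nonneg (sub_nonneg.2 h), abs_sub_comm, abs_of_nonneg (this.trans b1)]
      exact ⟨b1, b2⟩
    · obtain ⟨b1, b2⟩ := key t ht s hs (by rwa [mul_comm]) h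
      have : 0 ≤ N ^ (-p) / 8 * ((t - σ) ^ 2 - (s - σ) ^ 2) :=
        mul_nonneg (by positivity) (by linarith)
      rw [abs_sub_comm, abs_of_nonneg (sub_nonneg.2 h), abs_of_nonneg (this.trans b1)]
      exact ⟨b1, b2⟩
  have hσI : σ ∈ I := ⟨by linarith [hσ.1], by linarith [hσ.2]⟩
  refine ⟨σ, h1, h2.trans ?_, ?_, ?_, ?_⟩
  · gcongr
    linarith
  · intro s hs
    have := (key s hs σ hσI (by simp) (by simpa using sq_nonneg (s - σ))).1
    have h0 : 0 ≤ N ^ (-p) / 8 * ((s - σ) ^ 2 - (σ - σ) ^ 2) := by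
      rw [sub_self, zero_pow two_ne_zero, sub_zero]; positivity
    linarith
  · intro s hs t ht hst
    have := (key2 s hs t ht hst).1
    have h0 : 8 * |turnX p l N s - turnX p l N t| ≤
        (8 + 8 * p + 4 ^ p) * |turnX p l N s - turnX p l N t| := by
      gcongr
      linarith
    linarith
  · intro s hs t ht hst
    have := (key2 s hs t ht hst).2
    have h0 : 4 ^ p * (N ^ (-p) * |(s - σ) ^ 2 - (t - σ) ^ 2|) ≤
        (8 + 8 * p + 4 ^ p) * (N ^ (-p) * |(s - σ) ^ 2 - (t - σ) ^ 2|) := by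
      gcongr
      linarith
    linarith

end TipExistence

section Matching

lemma abs_sub_le_of_sq {k a₁ a₂ b₁ b₂ : ℝ} (hk : 1 ≤ k)
    (ha₁ : a₁ ^ 2 ≤ k * b₁ ^ 2) (ha₂ : a₂ ^ 2 ≤ k * b₂ ^ 2)
    (hb₁ : b₁ ^ 2 ≤ k * a₁ ^ 2) (hb₂ : b₂ ^ 2 ≤ k * a₂ ^ 2)
    (h₁ : 0 ≤ a₁ * b₁) (h₂ : 0 ≤ a₂ * b₂)
    (h : 0 ≤ a₁ * a₂ → |b₁ ^ 2 - b₂ ^ 2| ≤ k * |a₁ ^ 2 - a₂ ^ 2|) :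
    |b₁ - b₂| ≤ k ^ 2 * |a₁ - a₂| := by
  have hroot : ∀ {x y : ℝ}, x ^ 2 ≤ k * y ^ 2 → |x| ≤ k * |y| := by
    intro x y hxy
    refine abs_le_of_sq_le_sq (b := k * |y|) ?_ (by positivity)
    rw [mul_pow, sq_abs]
    nlinarith [sq_nonneg y]
  have ha1 := hroot ha₁
  have ha2 := hroot ha₂
  have hb1 := hroot hb₁
  have hb2 := hroot hb₂
  rcases le_or_gt 0 (a₁ * a₂) with hs | hs
  · have hbb : 0 ≤ b₁ * b₂ := by
      by_contra hc
      have hb10 : b₁ ≠ 0 := by rintro rfl; simp at hc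
      have hb20 : b₂ ≠ 0 := by rintro rfl; simp at hc
      have ha10 : a₁ ≠ 0 := by
        rintro rfl
        simp only [abs_zero, mul_zero, abs_nonpos_iff] at hb1
        exact hb10 hb1
      have ha20 : a₂ ≠ 0 := by
        rintro rfl
        simp only [abs_zero, mul_zero, abs_nonpos_iff] at hb2
        exact hb20 hb2
      have p1 := lt_of_le_of_ne h₁ (mul_ne_zero ha10 hb10).symm
      have p2 := lt_of_le_of_ne h₂ (mul_ne_zero ha20 hb20).symm
      have := mul_pos p1 p2
      have e : a₁ * b₁ * (a₂ * b₂) = (a₁ * a₂) * (b₁ * b₂) := by ring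
      rw [e] at this
      nlinarith
    have hab : ∀ {x y : ℝ}, 0 ≤ x * y → |x ^ 2 - y ^ 2| = |x - y| * (|x| + |y|) := by
      intro x y hxy
      have : |x| + |y| = |x + y| := by
        rw [eq_comm, abs_add_eq_add_abs_iff]
        rcases mul_nonneg_iff.1 hxy with h | h
        · exact Or.inl h
        · exact Or.inr h
      rw [this, ← abs_mul]
      ring_nf
    have h3 := h hs
    rw [hab hbb, hab hs] at h3
    rcases (add_nonneg (abs_nonneg b₁) (abs_nonneg b₂)).eq_or_lt with h0 | h0
    · have z1 : |b₁| = 0 := by linarith [abs_nonneg b₁, abs_nonneg b₂]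
      have z2 : |b₂| = 0 := by linarith [abs_nonneg b₁, abs_nonneg b₂]
      rw [abs_eq_zero.1 z1, abs_eq_zero.1 z2, sub_self, abs_zero]
      positivity
    · refine le_of_mul_le_mul_right (h3.trans ?_) h0
      have : |a₁| + |a₂| ≤ k * (|b₁| + |b₂|) := by linarith
      calc k * (|a₁ - a₂| * (|a₁| + |a₂|)) ≤ k * (|a₁ - a₂| * (k * (|b₁| + |b₂|))) := by gcongr
        _ = k ^ 2 * |a₁ - a₂| * (|b₁| + |b₂|) := by ring
  · have e : |a₁ - a₂| = |a₁| + |a₂| := by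
      have := (abs_add_eq_add_abs_iff a₁ (-a₂)).2 (by
        rcases mul_neg_iff.1 hs with h | h
        · exact Or.inl ⟨h.1.le, by linarith [h.2]⟩
        · exact Or.inr ⟨h.1.le, by linarith [h.2]⟩)
      rwa [abs_neg, ← sub_eq_add_neg] at this
    have h1 := abs_sub b₁ b₂
    rw [e]
    nlinarith [abs_nonneg a₁, abs_nonneg a₂]

/-- `R N s s'` matches points of the turn `N` of two families of turns. The abscissae of matched
points are comparable, and matched points lie on the same side of the tip of the turn. -/
structure TurnMatch (p K l l' N₀ : ℝ) (σ σ' : ℝ → ℝ) (R : ℝ → ℝ → ℝ → Prop) : Prop where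
  one_le : 1 ≤ K
  two_pi_le : 2 * π ≤ N₀
  nonneg : 0 ≤ l
  le_one : l ≤ 1
  nonneg' : 0 ≤ l'
  le_one' : l' ≤ 1
  tip : ∀ N, N₀ ≤ N → IsTip p K l N (σ N)
  tip' : ∀ N, N₀ ≤ N → IsTip p K l' N (σ' N)
  rel_tip : ∀ N, N₀ ≤ N → R N (σ N) (σ' N)
  mem : ∀ N s s', N₀ ≤ N → R N s s' → s ∈ Icc (-(π / 2)) (π / 2)
  mem' : ∀ N s s', N₀ ≤ N → R N s s' → s' ∈ Icc (-(π / 2)) (π / 2)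
  side : ∀ N s s', N₀ ≤ N → R N s s' → 0 ≤ (s - σ N) * (s' - σ' N)
  turnX_le : ∀ N M s s' t t', N₀ ≤ N → N₀ ≤ M → R N s s' → R M t t' →
    |turnX p l N s - turnX p l M t| ≤ K * |turnX p l' N s' - turnX p l' M t'|
  turnX_le' : ∀ N M s s' t t', N₀ ≤ N → N₀ ≤ M → R N s s' → R M t t' →
    |turnX p l' N s' - turnX p l' M t'| ≤ K * |turnX p l N s - turnX p l M t|

namespace TurnMatch

variable {p K l l' N₀ : ℝ} {σ σ' : ℝ → ℝ} {R : ℝ → ℝ → ℝ → Prop}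

lemma symm (h : TurnMatch p K l l' N₀ σ σ' R) :
    TurnMatch p K l' l N₀ σ' σ (fun N s' s => R N s s') where
  one_le := h.one_le
  two_pi_le := h.two_pi_le
  nonneg := h.nonneg'
  le_one := h.le_one'
  nonneg' := h.nonneg
  le_one' := h.le_one
  tip := h.tip'
  tip' := h.tip
  rel_tip := h.rel_tip
  mem N s' s hN hR := h.mem' N s s' hN hR
  mem' N s' s hN hR := h.mem N s s' hN hR
  side N s' s hN hR := by rw [mul_comm]; exact h.side N s s' hN hR
  turnX_le N M s' s t' t hN hM hR hR' := h.turnX_le' N M s s' t t' hN hM hR hR'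
  turnX_le' N M s' s t' t hN hM hR hR' := h.turnX_le N M s s' t t' hN hM hR hR'

lemma sq_sub_le (h : TurnMatch p K l l' N₀ σ σ' R) {N s s' t t' : ℝ} (hN : N₀ ≤ N)
    (hs : R N s s') (ht : R N t t') (hst : 0 ≤ (s - σ N) * (t - σ N))
    (hst' : 0 ≤ (s' - σ' N) * (t' - σ' N)) :
    |(s' - σ' N) ^ 2 - (t' - σ' N) ^ 2| ≤ K ^ 3 * |(s - σ N) ^ 2 - (t - σ N) ^ 2| := by
  have hK := h.one_le
  have hN0 : 0 < N := by linarith [h.two_pi_le, pi_pos]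
  have h1 := (h.tip' N hN).le_mul_abs_sub s' (h.mem' N s s' hN hs) t' (h.mem' N t t' hN ht) hst'
  have h2 := h.turnX_le' N N s s' t t' hN hN hs ht
  have h3 := (h.tip N hN).abs_sub_le_mul s (h.mem N s s' hN hs) t (h.mem N t t' hN ht) hst
  refine le_of_mul_le_mul_left ?_ (rpow_pos_of_pos hN0 (-p))
  calc N ^ (-p) * |(s' - σ' N) ^ 2 - (t' - σ' N) ^ 2|
      ≤ K * (K * (K * (N ^ (-p) * |(s - σ N) ^ 2 - (t - σ N) ^ 2|))) := by
        refine h1.trans ?_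
        gcongr
        refine h2.trans ?_
        gcongr
    _ = N ^ (-p) * (K ^ 3 * |(s - σ N) ^ 2 - (t - σ N) ^ 2|) := by ring

lemma sq_le (h : TurnMatch p K l l' N₀ σ σ' R) {N s s' : ℝ} (hN : N₀ ≤ N) (hs : R N s s') :
    (s' - σ' N) ^ 2 ≤ K ^ 3 * (s - σ N) ^ 2 := by
  have := h.sq_sub_le hN hs (h.rel_tip N hN) (by simp) (by simp)
  simpa using this

lemma abs_sub_le (h : TurnMatch p K l l' N₀ σ σ' R) {N s s' t t' : ℝ} (hN : N₀ ≤ N)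
    (hs : R N s s') (ht : R N t t') : |s' - t'| ≤ (K ^ 3) ^ 2 * |s - t| := by
  have hK : 1 ≤ K ^ 3 := one_le_pow₀ h.one_le
  have key := abs_sub_le_of_sq hK (h.symm.sq_le hN hs) (h.symm.sq_le hN ht) (h.sq_le hN hs)
    (h.sq_le hN ht) (h.side N s s' hN hs) (h.side N t t' hN ht) ?_
  · simpa using key
  · intro h0
    by_cases h1 : 0 ≤ (s' - σ' N) * (t' - σ' N)
    · exact h.sq_sub_le hN hs ht h0 h1
    · exfalso
      have n1 : s' - σ' N ≠ 0 := fun h => h1 (by simp [h])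
      have n2 : t' - σ' N ≠ 0 := fun h => h1 (by simp [h])
      have m1 : s - σ N ≠ 0 := by
        intro h2
        have := h.sq_le hN hs
        rw [h2] at this
        exact n1 (pow_eq_zero_iff two_ne_zero |>.1 (le_antisymm (by simpa using this) (sq_nonneg _)))
      have m2 : t - σ N ≠ 0 := by
        intro h2
        have := h.sq_le hN ht
        rw [h2] at this
        exact n2 (pow_eq_zero_iff two_ne_zero |>.1 (le_antisymm (by simpa using this) (sq_nonneg _)))
      have p1 := lt_of_le_of_ne (h.side N s s' hN hs) (mul_ne_zero m1 n1).symm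
      have p2 := lt_of_le_of_ne (h.side N t t' hN ht) (mul_ne_zero m2 n2).symm
      nlinarith [mul_pos p1 p2]

lemma turnDist_le_same {q : ℝ} (hp : 0 < p) (hpq : p ≤ q) (h : TurnMatch p K l l' N₀ σ σ' R) :
    ∃ L > 0, ∀ N s s' t t', N₀ ≤ N → R N s s' → R N t t' →
      turnDist p q l' N s' N t' ≤ L * turnDist p q l N s N t := by
  obtain ⟨c, hc, hlow⟩ := turnDist_lower_bound hp hpq
  obtain ⟨C, hC, hup⟩ := turn_coordinate_lipschitz (hp.trans_le hpq) (f := sin)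
    abs_sin_le_one abs_sin_sub_le
  have hK : 0 < K := by linarith [h.one_le]
  refine ⟨K + C * ((K ^ 3) ^ 2 * (1 / c)), by positivity, ?_⟩
  intro N s s' t t' hN hs ht
  have hN2 := h.two_pi_le.trans hN
  have hNq : 0 < N ^ (-q) := rpow_pos_of_pos (by linarith [pi_pos]) _
  have h1 := hlow l N N s t h.nonneg h.le_one hN2 le_rfl (h.mem N s s' hN hs) (h.mem N t t' hN ht)
  rw [sub_self, zero_div, zero_add] at h1
  have h2 := hup l' N s' t' h.nonneg' h.le_one' hN2 (h.mem' N s s' hN hs) (h.mem' N t t' hN ht)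
  have h3 := h.abs_sub_le hN hs ht
  have h4 := h.turnX_le' N N s s' t t' hN hN hs ht
  have h5 : |turnX p l N s - turnX p l N t| ≤ turnDist p q l N s N t :=
    le_add_of_nonneg_right (abs_nonneg _)
  have h6 : N ^ (-q) * |s - t| ≤ 1 / c * turnDist p q l N s N t := by
    rw [div_mul_eq_mul_div, one_mul, le_div_iff₀ hc]
    linarith
  have h7 : |turnY q l' N s' - turnY q l' N t'| ≤
      C * ((K ^ 3) ^ 2 * (1 / c * turnDist p q l N s N t)) := by
    refine h2.trans ?_
    calc C * (N ^ (-q) * |s' - t'|) ≤ C * (N ^ (-q) * ((K ^ 3) ^ 2 * |s - t|)) := by gcongr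
      _ = C * ((K ^ 3) ^ 2 * (N ^ (-q) * |s - t|)) := by ring
      _ ≤ _ := by gcongr
  calc turnDist p q l' N s' N t' ≤ K * turnDist p q l N s N t +
        C * ((K ^ 3) ^ 2 * (1 / c * turnDist p q l N s N t)) :=
        add_le_add (h4.trans (by gcongr)) h7
    _ = _ := by ring

end TurnMatch

end Matching

section Vertical

variable {p q K l N M σ τ s t : ℝ}

lemma turnRadius_sub_turnRadius : turnRadius l M t - turnRadius l N s = M - N + l * (t - s) := by
  unfold turnRadius
  ring

lemma tip_gap (hp : 0 < p) (hl0 : 0 ≤ l) (hl1 : l ≤ 1) (hN : 2 * π ≤ N) (hM : N + 2 * π ≤ M)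
    (h : IsTip p K l N σ) (h' : IsTip p K l M τ) :
    min 1 p * (N ^ (-p) / N) ≤ turnX p l N σ - turnX p l M τ := by
  have hπ := pi_gt_three
  have hτ := abs_le.1 h'.abs_le_quarter
  have hτI : τ ∈ Icc (-(π / 2)) (π / 2) := ⟨by linarith [hτ.1], by linarith [hτ.2]⟩
  have hN0 : 0 < N := by linarith
  have hr := one_le_turnRadius hl1 hN hτI
  have hd : turnRadius l M τ - turnRadius l N τ = M - N := by
    rw [turnRadius_sub_turnRadius, sub_self, mul_zero, add_zero]
  have hrM : turnRadius l M τ ≤ M := turnRadius_le hl0 hτI.2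
  have h1 := le_rpow_neg_sub hp (a := turnRadius l N τ) (b := turnRadius l M τ)
    (by linarith) (by linarith)
  rw [hd] at h1
  have hk : 0 < min 1 p := lt_min one_pos hp
  have hNp : 0 < N ^ (-p) := rpow_pos_of_pos hN0 _
  have h2 : 2 / N ≤ (M - N) / turnRadius l M τ := by
    rw [div_le_div_iff₀ hN0 (by linarith)]
    have : 0 ≤ (M - N - 2 * π) * (N - 2) := mul_nonneg (by linarith) (by linarith)
    nlinarith
  have h3 : min 1 p * (N ^ (-p) * (2 / N)) ≤
      turnRadius l N τ ^ (-p) - turnRadius l M τ ^ (-p) := by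
    have h0 := rpow_le_turnRadius_rpow hp.le hl0 hl1 hN hτI
    exact le_trans (by gcongr) h1
  have h4 : 1 / 2 ≤ cos τ := by
    have := one_sub_sq_div_two_le_cos (x := τ)
    nlinarith
  have h5 := h.turnX_le τ hτI
  have h6 : turnX p l N τ - turnX p l M τ =
      (turnRadius l N τ ^ (-p) - turnRadius l M τ ^ (-p)) * cos τ := by
    unfold turnX
    ring
  have h7 : min 1 p * (N ^ (-p) * (2 / N)) * (1 / 2) ≤
      (turnRadius l N τ ^ (-p) - turnRadius l M τ ^ (-p)) * cos τ :=
    mul_le_mul h3 h4 (by norm_num) (le_trans (by positivity) h3)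
  have e : min 1 p * (N ^ (-p) * (2 / N)) * (1 / 2) = min 1 p * (N ^ (-p) / N) := by ring
  linarith

lemma turnY_sq_sub_bounds (hp : 0 < p) (hpq : p ≤ q) (hl0 : 0 ≤ l) (hl1 : l ≤ 1)
    (hN : 2 * π ≤ N) (hM : N + 2 * π ≤ M) (hs : s ∈ Icc (-(π / 2)) (π / 2))
    (ht : t ∈ Icc (-(π / 2)) (π / 2)) (hx : turnX p l N s = turnX p l M t) :
    min 1 (2 * p) / 2 * ((N ^ (-q)) ^ 2 * ((M - N) / M)) ≤
        turnY q l N s ^ 2 - turnY q l M t ^ 2 ∧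
      turnY q l N s ^ 2 - turnY q l M t ^ 2 ≤
        (1 + 2 * q) * 8 * (4 ^ q) ^ 2 * ((N ^ (-q)) ^ 2 * ((M - N) / M)) := by
  have hπ := pi_gt_three
  have hq : 0 < q := by linarith
  have hN0 : 0 < N := by linarith
  have hM2 : 2 * π ≤ M := by linarith
  have hM0 : 0 < M := by linarith
  set r := turnRadius l N s with hr
  set r' := turnRadius l M t with hr'
  have hr1 : 1 ≤ r := one_le_turnRadius hl1 hN hs
  have hr1' : 1 ≤ r' := one_le_turnRadius hl1 hM2 ht
  have hd : r' - r = M - N + l * (t - s) := turnRadius_sub_turnRadius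
  have hts : |t - s| ≤ π := abs_le.2 ⟨by linarith [hs.2, ht.1], by linarith [hs.1, ht.2]⟩
  have hlts : |l * (t - s)| ≤ π := by
    rw [abs_mul, abs_of_nonneg hl0]
    exact (mul_le_of_le_one_left (abs_nonneg _) hl1).trans hts
  have hlts' := abs_le.1 hlts
  have hd1 : (M - N) / 2 ≤ r' - r := by linarith
  have hd2 : r' - r ≤ 2 * (M - N) := by linarith
  have hrr : r ≤ r' := by linarith
  have hrM : r' ≤ M := turnRadius_le hl0 ht.2
  have hMr : M / 4 ≤ r' := le_turnRadius hl1 hM2 ht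
  have hr0 : 0 < r := by linarith
  have hr0' : 0 < r' := by linarith
  have hsq : ∀ {x : ℝ}, 0 < x → ∀ e : ℝ, (x ^ (-e)) ^ 2 = x ^ (-(2 * e)) := by
    intro x hx e
    rw [← rpow_natCast, ← rpow_mul hx.le]
    congr 1
    push_cast
    ring
  have hmul : ∀ {x : ℝ}, 0 < x → x ^ (-(2 * q)) = x ^ (-(2 * p)) * x ^ (-(2 * (q - p))) := by
    intro x hx
    rw [← rpow_add hx]
    congr 1
    ring
  have hcos := sin_sq_add_cos_sq s
  have hcos' := sin_sq_add_cos_sq t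
  have hX : turnX p l N s = r ^ (-p) * cos s := rfl
  have hX' : turnX p l M t = r' ^ (-p) * cos t := rfl
  have hxa : turnX p l N s ^ 2 = r ^ (-(2 * p)) * cos s ^ 2 := by rw [hX, mul_pow, hsq hr0]
  have hxa' : turnX p l N s ^ 2 = r' ^ (-(2 * p)) * cos t ^ 2 := by
    rw [hx, hX', mul_pow, hsq hr0']
  have hY : turnY q l N s ^ 2 = r ^ (-(2 * q)) - r ^ (-(2 * (q - p))) * turnX p l N s ^ 2 := by
    rw [hxa, turnY, mul_pow, ← hr, hsq hr0, hmul hr0]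
    linear_combination r ^ (-(2 * p)) * r ^ (-(2 * (q - p))) * hcos
  have hY' : turnY q l M t ^ 2 =
      r' ^ (-(2 * q)) - r' ^ (-(2 * (q - p))) * turnX p l N s ^ 2 := by
    rw [hxa', turnY, mul_pow, ← hr', hsq hr0', hmul hr0']
    linear_combination r' ^ (-(2 * p)) * r' ^ (-(2 * (q - p))) * hcos'
  have hb : r' ^ (-(2 * (q - p))) ≤ r ^ (-(2 * (q - p))) :=
    rpow_le_rpow_of_nonpos hr0 hrr (by linarith)
  have hx2 : turnX p l N s ^ 2 ≤ r' ^ (-(2 * p)) := by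
    rw [hxa']
    exact mul_le_of_le_one_right (rpow_nonneg hr0'.le _) (cos_sq_le_one t)
  have hb0 : 0 < r ^ (-(2 * (q - p))) := rpow_pos_of_pos hr0 _
  have hNq : 0 < N ^ (-q) := rpow_pos_of_pos hN0 _
  have hε : 0 ≤ (M - N) / M := div_nonneg (by linarith) hM0.le
  constructor
  · have h1 := le_rpow_neg_sub (p := 2 * p) (by linarith) hr0 hrr
    have h2 : turnY q l N s ^ 2 - turnY q l M t ^ 2 ≥
        r ^ (-(2 * (q - p))) * (r ^ (-(2 * p)) - r' ^ (-(2 * p))) := by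
      rw [hY, hY', hmul hr0, hmul hr0']
      linarith [mul_nonneg (sub_nonneg.2 hb) (sub_nonneg.2 hx2)]
    have h3 : (M - N) / M / 2 ≤ (r' - r) / r' := by
      rw [div_div, div_le_div_iff₀ (by linarith) hr0']
      have := mul_le_mul_of_nonneg_left hrM (by linarith : 0 ≤ M - N)
      have := mul_le_mul_of_nonneg_right hd1 hM0.le
      linarith
    have hk : 0 < min 1 (2 * p) := lt_min one_pos (by linarith)
    calc min 1 (2 * p) / 2 * ((N ^ (-q)) ^ 2 * ((M - N) / M))
        = min 1 (2 * p) * ((N ^ (-q)) ^ 2 * ((M - N) / M / 2)) := by ring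
      _ ≤ min 1 (2 * p) * ((r ^ (-q)) ^ 2 * ((r' - r) / r')) := by
          have h0 : N ^ (-q) ≤ r ^ (-q) := rpow_le_turnRadius_rpow hq.le hl0 hl1 hN hs
          gcongr
      _ = r ^ (-(2 * (q - p))) * (min 1 (2 * p) * (r ^ (-(2 * p)) * ((r' - r) / r'))) := by
          rw [hsq hr0, hmul hr0]
          ring
      _ ≤ _ := (mul_le_mul_of_nonneg_left h1 hb0.le).trans h2
  · have h1 := rpow_neg_sub_le (p := 2 * q) (by linarith) hr0 hrr
    have h2 : turnY q l N s ^ 2 - turnY q l M t ^ 2 ≤ r ^ (-(2 * q)) - r' ^ (-(2 * q)) := by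
      rw [hY, hY']
      linarith [mul_le_mul_of_nonneg_right hb (sq_nonneg (turnX p l N s))]
    have h3 : (r' - r) / r' ≤ 8 * ((M - N) / M) := by
      rw [← mul_div_assoc, div_le_div_iff₀ hr0' hM0]
      have := mul_le_mul_of_nonneg_left hMr (by linarith : 0 ≤ M - N)
      have := mul_le_mul_of_nonneg_right hd2 hM0.le
      linarith
    calc _ ≤ (1 + 2 * q) * ((r ^ (-q)) ^ 2 * ((r' - r) / r')) := by
          rw [hsq hr0]
          exact h2.trans h1
      _ ≤ (1 + 2 * q) * ((4 ^ q * N ^ (-q)) ^ 2 * (8 * ((M - N) / M))) := by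
          have h0 : r ^ (-q) ≤ 4 ^ q * N ^ (-q) := turnRadius_rpow_le hq.le hl1 hN hs
          have h4 : 0 ≤ (r' - r) / r' := div_nonneg (by linarith) hr0'.le
          gcongr
      _ = _ := by ring

end Vertical

section DifferentTurns

variable {p q K l N σ s : ℝ}

lemma continuousOn_turnX (hl1 : l ≤ 1) (hN : 2 * π ≤ N) :
    ContinuousOn (turnX p l N) (Icc (-(π / 2)) (π / 2)) := fun _ hs =>
  (hasDerivAt_turnX
    (zero_lt_one.trans_le (one_le_turnRadius hl1 hN hs))).continuousAt.continuousWithinAt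

lemma turnX_nonneg (hl1 : l ≤ 1) (hN : 2 * π ≤ N) (hs : s ∈ Icc (-(π / 2)) (π / 2)) :
    0 ≤ turnX p l N s :=
  mul_nonneg (rpow_nonneg (zero_le_one.trans (one_le_turnRadius hl1 hN hs)) _)
    (cos_nonneg_of_mem_Icc hs)

lemma abs_turnY_le (hq : 0 ≤ q) (hl1 : l ≤ 1) (hN : 2 * π ≤ N)
    (hs : s ∈ Icc (-(π / 2)) (π / 2)) :
    |turnY q l N s| ≤ 4 ^ q * N ^ (-q) * |sin s| := by
  rw [turnY, abs_mul, abs_of_nonneg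
    (rpow_nonneg (zero_le_one.trans (one_le_turnRadius hl1 hN hs)) _)]
  exact mul_le_mul_of_nonneg_right (turnRadius_rpow_le hq hl1 hN hs) (abs_nonneg _)

lemma exists_turnX_eq (hl1 : l ≤ 1) (hN : 2 * π ≤ N) (h : IsTip p K l N σ) (s : ℝ) {x : ℝ}
    (hx0 : 0 ≤ x) (hx : x ≤ turnX p l N σ) :
    ∃ u ∈ Icc (-(π / 2)) (π / 2), 0 ≤ (s - σ) * (u - σ) ∧ turnX p l N u = x := by
  have hπ := pi_gt_three
  have hσ := abs_le.1 h.abs_le_quarter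
  have hc := continuousOn_turnX (p := p) hl1 hN
  rcases le_total σ s with hs | hs
  · have hsub : Icc σ (π / 2) ⊆ Icc (-(π / 2)) (π / 2) :=
      Icc_subset_Icc (by linarith [hσ.1]) le_rfl
    obtain ⟨u, hu, rfl⟩ := intermediate_value_Icc' (by linarith [hσ.2]) (hc.mono hsub)
      (show x ∈ Icc (turnX p l N (π / 2)) (turnX p l N σ) from ⟨by simpa [turnX], hx⟩)
    exact ⟨u, hsub hu, mul_nonneg (by linarith) (by linarith [hu.1]), rfl⟩
  · have hsub : Icc (-(π / 2)) σ ⊆ Icc (-(π / 2)) (π / 2) :=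
      Icc_subset_Icc le_rfl (by linarith [hσ.2])
    obtain ⟨u, hu, rfl⟩ := intermediate_value_Icc (by linarith [hσ.1]) (hc.mono hsub)
      (show x ∈ Icc (turnX p l N (-(π / 2))) (turnX p l N σ) from ⟨by simpa [turnX], hx⟩)
    exact ⟨u, hsub hu, mul_nonneg_of_nonpos_of_nonpos (by linarith) (by linarith [hu.2]), rfl⟩

/-- Away from the tip of a turn one may move horizontally to a prescribed abscissa at a
controlled cost. -/
lemma exists_shift (hp : 0 < p) (hpq : p + 1 ≤ q) (hK : 1 ≤ K) {g : ℝ} (hg : 0 < g) :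
    ∃ C > 0, ∀ B : ℝ, ∃ N₁ ≥ 2 * π, ∀ l N σ s x : ℝ, 0 ≤ l → l ≤ 1 → N₁ ≤ N →
      IsTip p K l N σ → s ∈ Icc (-(π / 2)) (π / 2) →
      g * (N ^ (-p) / N) ≤ turnX p l N σ - turnX p l N s → 0 ≤ x →
      g * (N ^ (-p) / N) ≤ turnX p l N σ - x →
      ∃ u ∈ Icc (-(π / 2)) (π / 2), turnX p l N u = x ∧
        |turnY q l N s - turnY q l N u| ≤ C * |turnX p l N s - x| ∧
        1 / 4 * (N ^ (-q) * |u - σ|) ≤ |turnY q l N u| ∧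
        |turnY q l N u| ≤ C * (N ^ (-q) * |u - σ|) ∧
        0 < turnY q l N u * (s - σ) ∧ B / N ≤ |u - σ| := by
  have hq : 0 < q := by linarith
  obtain ⟨C, hC, hup⟩ := turn_coordinate_lipschitz hq (f := sin) abs_sin_le_one abs_sin_sub_le
  refine ⟨C * K + 4 ^ q * 2, by positivity, ?_⟩
  intro B
  refine ⟨max (2 * π) ((|B| + 2 * K) ^ 2 * K / g), le_max_left _ _, ?_⟩
  intro l N σ s x hl0 hl1 hN htip hs hsg hx0 hxg
  have hπ := pi_gt_three
  have hN2 : 2 * π ≤ N := (le_max_left _ _).trans hN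
  have hNB : (|B| + 2 * K) ^ 2 * K / g ≤ N := (le_max_right _ _).trans hN
  have hN0 : 0 < N := by linarith
  have hNp : 0 < N ^ (-p) := rpow_pos_of_pos hN0 _
  have hNq : 0 < N ^ (-q) := rpow_pos_of_pos hN0 _
  have hσ := abs_le.1 htip.abs_le_quarter
  have hσI : σ ∈ Icc (-(π / 2)) (π / 2) := ⟨by linarith [hσ.1], by linarith [hσ.2]⟩
  have hη : 0 < g * (N ^ (-p) / N) := by positivity
  obtain ⟨u, hu, hside, hux⟩ := exists_turnX_eq hl1 hN2 htip s hx0 (by linarith)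
  have hfar : ∀ v ∈ Icc (-(π / 2)) (π / 2),
      g * (N ^ (-p) / N) ≤ turnX p l N σ - turnX p l N v → (|B| + 2 * K) / N ≤ |v - σ| := by
    intro v hv hvg
    have h1 := htip.abs_sub_le_mul σ hσI v hv (by simp)
    rw [sub_self, zero_pow two_ne_zero, zero_sub, abs_neg, abs_of_nonneg (sq_nonneg (v - σ)),
      abs_of_nonneg (by linarith)] at h1
    have h2 : g / N ≤ K * (v - σ) ^ 2 := by
      refine le_of_mul_le_mul_left ?_ hNp
      calc N ^ (-p) * (g / N) = g * (N ^ (-p) / N) := by ring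
        _ ≤ _ := hvg.trans h1
        _ = _ := by ring
    refine (pow_le_pow_iff_left₀ (by positivity) (by positivity) two_ne_zero).1 ?_
    rw [sq_abs, div_pow]
    rw [div_le_iff₀ hg] at hNB
    rw [div_le_iff₀ hN0] at h2
    rw [div_le_iff₀ (by positivity)]
    refine le_of_mul_le_mul_right ?_ (by linarith : 0 < K)
    calc (|B| + 2 * K) ^ 2 * K ≤ N * g := hNB
      _ ≤ N * (K * (v - σ) ^ 2 * N) := by gcongr
      _ = _ := by ring
  have hs1 := hfar s hs hsg
  have hu1 := hfar u hu (by rw [hux]; exact hxg)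
  have hBN : B / N ≤ (|B| + 2 * K) / N := by
    gcongr
    linarith [le_abs_self B]
  have hKN : 2 * (K / N) ≤ (|B| + 2 * K) / N := by
    rw [← mul_div_assoc]
    gcongr
    linarith [abs_nonneg B]
  have hKN0 : 1 / N ≤ K / N := by gcongr
  have hN10 : 0 < 1 / N := by positivity
  have hσu : 2 * |σ| ≤ |u - σ| := by linarith [htip.abs_le_div]
  have hσ1 := abs_le.1 (le_refl |σ|)
  have huabs : |u - σ| / 2 ≤ |u| := by
    have := abs_sub u σ
    linarith
  have huabs' : |u| ≤ 2 * |u - σ| := by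
    have := abs_add_le (u - σ) σ
    rw [sub_add_cancel] at this
    linarith [abs_nonneg (u - σ)]
  have hru := one_le_turnRadius hl1 hN2 hu
  have hrlow : N ^ (-q) ≤ turnRadius l N u ^ (-q) :=
    rpow_le_turnRadius_rpow hq.le hl0 hl1 hN2 hu
  have hrpos := hNq.trans_le hrlow
  refine ⟨u, hu, hux, ?_, ?_, ?_, ?_, by linarith⟩
  · have h1 := hup l N s u hl0 hl1 hN2 hs hu
    have h2 := htip.le_mul_abs_sub s hs u hu hside
    rw [hux] at h2
    have h3 : |(s - σ) ^ 2 - (u - σ) ^ 2| = |s - u| * (|s - σ| + |u - σ|) := by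
      have : |s - σ| + |u - σ| = |(s - σ) + (u - σ)| := by
        rw [eq_comm, abs_add_eq_add_abs_iff]
        exact mul_nonneg_iff.1 hside
      rw [this, ← abs_mul]
      ring_nf
    have h4 : |s - u| * (1 / N) ≤ |(s - σ) ^ 2 - (u - σ) ^ 2| := by
      rw [h3]
      have : 1 / N ≤ |s - σ| + |u - σ| := by linarith [abs_nonneg (s - σ)]
      gcongr
    have h5 : N ^ (-q) ≤ N ^ (-p) * (1 / N) := by
      rw [mul_one_div, ← rpow_sub_one hN0.ne']
      exact rpow_le_rpow_of_exponent_le (by linarith) (by linarith)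
    have h6 : N ^ (-q) * |s - u| ≤ K * |turnX p l N s - x| := by
      calc N ^ (-q) * |s - u| ≤ N ^ (-p) * (1 / N) * |s - u| := by gcongr
        _ = N ^ (-p) * (|s - u| * (1 / N)) := by ring
        _ ≤ N ^ (-p) * |(s - σ) ^ 2 - (u - σ) ^ 2| := by gcongr
        _ ≤ _ := h2
    calc |turnY q l N s - turnY q l N u| ≤ C * (N ^ (-q) * |s - u|) := h1
      _ ≤ C * (K * |turnX p l N s - x|) := by gcongr
      _ = C * K * |turnX p l N s - x| := by ring
      _ ≤ _ := by
        gcongr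
        have : (0 : ℝ) < 4 ^ q := by positivity
        linarith
  · have h1 := mul_abs_le_abs_sin (abs_le.2 ⟨hu.1, hu.2⟩)
    have h2 : 1 / 2 * |u| ≤ 2 / π * |u| := by
      refine mul_le_mul_of_nonneg_right ?_ (abs_nonneg u)
      rw [div_le_div_iff₀ two_pos pi_pos]
      linarith [pi_le_four]
    rw [turnY, abs_mul, abs_of_pos hrpos]
    calc 1 / 4 * (N ^ (-q) * |u - σ|) = N ^ (-q) * (|u - σ| / 4) := by ring
      _ ≤ _ := mul_le_mul hrlow (by linarith) (by positivity) hrpos.le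
  · have h1 := abs_turnY_le hq.le hl1 hN2 hu
    calc |turnY q l N u| ≤ 4 ^ q * N ^ (-q) * |sin u| := h1
      _ ≤ 4 ^ q * N ^ (-q) * (2 * |u - σ|) := by
        gcongr
        exact abs_sin_le_abs.trans huabs'
      _ = 4 ^ q * 2 * (N ^ (-q) * |u - σ|) := by ring
      _ ≤ _ := by
        gcongr
        have : 0 < C * K := by positivity
        linarith
  · have hne : s - σ ≠ 0 := by
      intro h0
      rw [h0, abs_zero] at hs1
      linarith
    rw [turnY, mul_assoc]
    refine mul_pos hrpos ?_
    rcases lt_or_gt_of_ne hne with h0 | h0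
    · have h1 : u - σ ≤ 0 := by
        by_contra hc
        have := mul_neg_of_neg_of_pos h0 (not_le.1 hc)
        linarith
      rw [abs_of_nonpos h1] at hσu hu1
      have h2 : u < 0 := by linarith
      have := sin_neg_of_neg_of_neg_pi_lt h2 (by linarith [hu.1])
      exact mul_pos_of_neg_of_neg this h0
    · have h1 : 0 ≤ u - σ := nonneg_of_mul_nonneg_right hside h0
      rw [abs_of_nonneg h1] at hσu hu1
      have h2 : 0 < u := by linarith
      exact mul_pos (sin_pos_of_pos_of_lt_pi h2 (by linarith [hu.2])) h0

lemma abs_sub_le_of_sq_sub_sq {m a b a' b' : ℝ} (hm : 0 < m) (ha' : 0 < |a'|)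
    (h₁ : |a| ≤ m * |a'|) (h₂ : |a'| ≤ m * |a|) (h₀ : 0 ≤ a' ^ 2 - b' ^ 2)
    (h : a' ^ 2 - b' ^ 2 ≤ m * (a ^ 2 - b ^ 2))
    (hc : 0 ≤ a' * b' ∨ a * b ≤ 0 ∨ |b| ≤ |a| / 2) :
    |a' - b'| ≤ (2 * m ^ 2 + 4 * m) * |a - b| := by
  have hb' : |b'| ≤ |a'| := sq_le_sq.1 (by linarith)
  have hb : |b| ≤ |a| := by
    have : 0 ≤ a ^ 2 - b ^ 2 := nonneg_of_mul_nonneg_right (h₀.trans h) hm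
    exact sq_le_sq.1 (by linarith)
  have far : |a| / 2 ≤ |a - b| → |a' - b'| ≤ (2 * m ^ 2 + 4 * m) * |a - b| := by
    intro hfar
    calc |a' - b'| ≤ |a'| + |b'| := abs_sub _ _
      _ ≤ 4 * m * (|a| / 2) := by linarith
      _ ≤ 4 * m * |a - b| := by gcongr
      _ ≤ _ := by
        gcongr
        linarith [sq_nonneg m]
  rcases hc with hc | hc | hc
  · have e1 : a' ^ 2 - b' ^ 2 = |a' - b'| * (|a'| + |b'|) := by
      have : |a'| + |b'| = |a' + b'| := by
        rw [eq_comm, abs_add_eq_add_abs_iff]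
        exact mul_nonneg_iff.1 hc
      rw [this, ← abs_mul, ← abs_of_nonneg h₀]
      ring_nf
    have e2 : a ^ 2 - b ^ 2 ≤ |a - b| * (2 * |a|) := by
      calc a ^ 2 - b ^ 2 = (a - b) * (a + b) := by ring
        _ ≤ |a - b| * |a + b| := by
          rw [← abs_mul]
          exact le_abs_self _
        _ ≤ _ := by
          gcongr
          linarith [abs_add_le a b]
    have h5 : |a' - b'| ≤ 2 * m ^ 2 * |a - b| := by
      refine le_of_mul_le_mul_right ?_ ha'
      calc |a' - b'| * |a'| ≤ |a' - b'| * (|a'| + |b'|) := by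
            gcongr
            linarith [abs_nonneg b']
        _ ≤ m * (|a - b| * (2 * |a|)) := by
            rw [← e1]
            exact h.trans (by gcongr)
        _ ≤ m * (|a - b| * (2 * (m * |a'|))) := by gcongr
        _ = _ := by ring
    refine h5.trans ?_
    gcongr
    linarith
  · refine far ?_
    have : |a| + |b| = |a - b| := by
      have := (abs_add_eq_add_abs_iff a (-b)).2 (by
        rcases mul_nonpos_iff.1 hc with h | h
        · exact Or.inl ⟨h.1, by linarith [h.2]⟩
        · exact Or.inr ⟨h.1, by linarith [h.2]⟩)
      rwa [abs_neg, ← sub_eq_add_neg, eq_comm] at this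
    linarith [abs_nonneg b, abs_nonneg a]
  · refine far ?_
    have := abs_sub_abs_le_abs_sub a b
    linarith

lemma abs_le_of_mul_neg {k e t t' τ τ' : ℝ} (hk : 0 ≤ k) (htt : t * t' < 0)
    (hside : 0 ≤ (t - τ) * (t' - τ')) (hτ : |τ| ≤ e) (hτ' : |τ'| ≤ e)
    (h : |t - τ| ≤ k * |t' - τ'|) : |t| ≤ (k + 1) * e := by
  have a := abs_le.1 hτ
  have a' := abs_le.1 hτ'
  have he : 0 ≤ e := (abs_nonneg τ).trans hτ
  have hke : 0 ≤ k * e := mul_nonneg hk he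
  have key : |t' - τ'| ≤ e ∨ |t| ≤ e := by
    rcases mul_neg_iff.1 htt with ⟨h1, h2⟩ | ⟨h1, h2⟩ <;>
      rcases mul_nonneg_iff.1 hside with ⟨h3, h4⟩ | ⟨h3, h4⟩
    · exact Or.inl (abs_le.2 ⟨by linarith, by linarith⟩)
    · exact Or.inr (abs_le.2 ⟨by linarith, by linarith⟩)
    · exact Or.inr (abs_le.2 ⟨by linarith, by linarith⟩)
    · exact Or.inl (abs_le.2 ⟨by linarith, by linarith⟩)
  have hadd := abs_add_le (t - τ) τ
  rw [sub_add_cancel] at hadd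
  rcases key with h1 | h1
  · have := mul_le_mul_of_nonneg_left h1 hk
    linarith
  · linarith

end DifferentTurns

lemma abs_tip_sub_le {p K l l' N τ τ' v v' : ℝ} (hK : 1 ≤ K) (hN : 0 < N) (h : IsTip p K l N τ)
    (h' : IsTip p K l' N τ') (hv : v ∈ Icc (-(π / 2)) (π / 2))
    (hv' : v' ∈ Icc (-(π / 2)) (π / 2))
    (hvv : |turnX p l N τ - turnX p l N v| ≤ K * |turnX p l' N τ' - turnX p l' N v'|) :
    |v - τ| ≤ K ^ 3 * |v' - τ'| := by
  have hπ := pi_gt_three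
  have hNp : 0 < N ^ (-p) := rpow_pos_of_pos hN _
  have hτ := abs_le.1 h.abs_le_quarter
  have hτ' := abs_le.1 h'.abs_le_quarter
  have b1 := h.le_mul_abs_sub τ ⟨by linarith, by linarith⟩ v hv (by simp)
  have b2 := h'.abs_sub_le_mul τ' ⟨by linarith, by linarith⟩ v' hv' (by simp)
  rw [sub_self, zero_pow two_ne_zero, zero_sub, abs_neg, abs_of_nonneg (sq_nonneg (v - τ))] at b1
  rw [sub_self, zero_pow two_ne_zero, zero_sub, abs_neg,
    abs_of_nonneg (sq_nonneg (v' - τ'))] at b2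
  have b3 : (v - τ) ^ 2 ≤ K ^ 3 * (v' - τ') ^ 2 := by
    refine le_of_mul_le_mul_left ?_ hNp
    calc N ^ (-p) * (v - τ) ^ 2 ≤ K * (K * (K * (N ^ (-p) * (v' - τ') ^ 2))) := by
          refine b1.trans ?_
          gcongr
          refine hvv.trans ?_
          gcongr
      _ = _ := by ring
  have hK3 : 1 ≤ K ^ 3 := one_le_pow₀ hK
  refine (pow_le_pow_iff_left₀ (by positivity) (by positivity) two_ne_zero).1 ?_
  rw [mul_pow, sq_abs, sq_abs]
  refine b3.trans ?_
  gcongr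
  exact le_self_pow₀ hK3 two_ne_zero

namespace TurnMatch

variable {p q K l l' N₀ : ℝ} {σ σ' : ℝ → ℝ} {R : ℝ → ℝ → ℝ → Prop}

set_option maxHeartbeats 1000000 in
lemma turnDist_le_of_lt (hp : 0 < p) (hpq : p + 1 ≤ q) (h : TurnMatch p K l l' N₀ σ σ' R) :
    ∃ N₁ ≥ N₀, ∃ L > 0, ∀ N M s s' t t', N₁ ≤ N → N + 2 * π ≤ M → R N s s' → R M t t' →
      turnDist p q l' N s' M t' ≤ L * turnDist p q l N s M t := by
  have hK := h.one_le
  have hK0 : 0 < K := by linarith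
  have hq : 0 < q := by linarith
  set g := min 1 p with hg
  have hg0 : 0 < g := lt_min one_pos hp
  obtain ⟨C, hC, hshift⟩ := exists_shift hp hpq hK (g := g / (2 * K)) (by positivity)
  have h4q : (0 : ℝ) < 4 ^ q := by positivity
  set B := 4 ^ q * ((K ^ 3 + 1) * K) * 8 with hB
  have hB0 : 0 < B := by positivity
  obtain ⟨N₁, hN₁, hshift⟩ := hshift B
  set E₁ := min 1 (2 * p) / 2 with hE₁
  have hE₁0 : 0 < E₁ := half_pos (lt_min one_pos (by linarith))
  set E₂ := (1 + 2 * q) * 8 * (4 ^ q) ^ 2 with hE₂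
  have hE₂0 : 0 < E₂ := by positivity
  set m := C * K ^ 3 * 4 + E₂ / E₁ with hm
  have hm0 : 0 < m := by positivity
  set V := 2 * m ^ 2 + 4 * m with hV
  have hV0 : 0 < V := by positivity
  refine ⟨max N₀ N₁, le_max_left _ _,
    max (K + 2 * 4 ^ q * (2 / g)) (K + C * K + V * (1 + C)),
    lt_max_of_lt_left (by positivity), ?_⟩
  intro N M s s' t t' hN hNM hRs hRt
  have hπ := pi_gt_three
  have hN0 : N₀ ≤ N := (le_max_left _ _).trans hN
  have hN1 : N₁ ≤ N := (le_max_right _ _).trans hN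
  have hM0 : N₀ ≤ M := by linarith
  have hN2 : 2 * π ≤ N := h.two_pi_le.trans hN0
  have hM2 : 2 * π ≤ M := by linarith
  have hNpos : 0 < N := by linarith
  have hs := h.mem N s s' hN0 hRs
  have hs' := h.mem' N s s' hN0 hRs
  have ht := h.mem M t t' hM0 hRt
  have ht' := h.mem' M t t' hM0 hRt
  have hNp : 0 < N ^ (-p) := rpow_pos_of_pos hNpos _
  have hNq : 0 < N ^ (-q) := rpow_pos_of_pos hNpos _
  have hMq : 0 < M ^ (-q) := rpow_pos_of_pos (by linarith) _
  have hMNq : M ^ (-q) ≤ N ^ (-q) :=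
    rpow_le_rpow_of_nonpos hNpos (by linarith) (by linarith)
  have htip := h.tip N hN0
  have htip' := h.tip' N hN0
  have hx := h.turnX_le' N M s s' t t' hN0 hM0 hRs hRt
  set D := |turnX p l N s - turnX p l M t| with hD
  have hD0 : 0 ≤ D := abs_nonneg _
  have hT : turnDist p q l N s M t = D + |turnY q l N s - turnY q l M t| := rfl
  have hT0 := abs_nonneg (turnY q l N s - turnY q l M t)
  rcases le_or_gt (g / 2 * (N ^ (-p) / N)) D with hfar | hnear
  · have hY : ∀ {P u}, 2 * π ≤ P → P ^ (-q) ≤ N ^ (-q) → u ∈ Icc (-(π / 2)) (π / 2) →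
        |turnY q l' P u| ≤ 4 ^ q * N ^ (-q) := by
      intro P u hP hPN hu
      refine (abs_turnY_le hq.le h.le_one' hP hu).trans ?_
      have hP0 : 0 ≤ P ^ (-q) := rpow_nonneg (by linarith) _
      refine (mul_le_of_le_one_right (by positivity) (abs_sin_le_one u)).trans ?_
      gcongr
    have h1 := hY hN2 le_rfl hs'
    have h2 := hY hM2 hMNq ht'
    have h3 := abs_sub (turnY q l' N s') (turnY q l' M t')
    have h4 : N ^ (-q) ≤ N ^ (-p) / N := by
      rw [← rpow_sub_one hNpos.ne']
      exact rpow_le_rpow_of_exponent_le (by linarith) (by linarith)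
    have h5 : N ^ (-q) ≤ 2 / g * D := by
      refine h4.trans ?_
      rw [div_mul_eq_mul_div, le_div_iff₀ hg0]
      linarith
    have h6 : 4 ^ q * N ^ (-q) ≤ 4 ^ q * (2 / g * D) := by gcongr
    calc turnDist p q l' N s' M t' ≤ K * D + 2 * (4 ^ q * (2 / g * D)) :=
          add_le_add hx (by linarith)
      _ = (K + 2 * 4 ^ q * (2 / g)) * D := by ring
      _ ≤ _ := by
        gcongr
        · exact le_max_left _ _
        · linarith
  · have hgap := tip_gap hp h.nonneg h.le_one hN2 hNM htip (h.tip M hM0)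
    rw [← hg] at hgap
    have hDabs := abs_le.1 (le_refl D)
    have hη : 0 < N ^ (-p) / N := by positivity
    have htM := (h.tip M hM0).turnX_le t ht
    have hsD := le_abs_self (turnX p l N s - turnX p l M t)
    have hgη : 0 < g * (N ^ (-p) / N) := by positivity
    have gt1 : g * (N ^ (-p) / N) ≤ turnX p l N (σ N) - turnX p l M t := by linarith
    have gs1 : g / 2 * (N ^ (-p) / N) ≤ turnX p l N (σ N) - turnX p l N s := by linarith
    have hgK : ∀ {y : ℝ}, g / 2 * (N ^ (-p) / N) ≤ K * y → g / (2 * K) * (N ^ (-p) / N) ≤ y := by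
      intro y hy
      rw [← div_div, div_mul_eq_mul_div, div_le_iff₀ hK0]
      linarith
    have hKself : ∀ {y : ℝ}, g / 2 * (N ^ (-p) / N) ≤ y → g / 2 * (N ^ (-p) / N) ≤ K * y := by
      intro y hy
      have : 0 ≤ y := le_trans (by positivity) hy
      nlinarith
    have gs := hgK (hKself gs1)
    have gt := hgK (hKself (by linarith : g / 2 * (N ^ (-p) / N) ≤
      turnX p l N (σ N) - turnX p l M t))
    have xs := h.turnX_le N N (σ N) (σ' N) s s' hN0 hN0 (h.rel_tip N hN0) hRs
    have xt := h.turnX_le N M (σ N) (σ' N) t t' hN0 hM0 (h.rel_tip N hN0) hRt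
    have hgap' := tip_gap hp h.nonneg' h.le_one' hN2 hNM htip' (h.tip' M hM0)
    rw [← hg] at hgap'
    have htM' := (h.tip' M hM0).turnX_le t' ht'
    have hsN' := htip'.turnX_le s' hs'
    have at' : |turnX p l' N (σ' N) - turnX p l' M t'| =
      turnX p l' N (σ' N) - turnX p l' M t' := abs_of_nonneg (by linarith)
    rw [abs_of_nonneg (by linarith), abs_of_nonneg (by linarith)] at xs
    rw [abs_of_nonneg (by linarith), at'] at xt
    have gs' := hgK (gs1.trans xs)
    have gt' := hgK ((by linarith : g / 2 * (N ^ (-p) / N) ≤ _).trans xt)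
    obtain ⟨u, hu, hux, huC, hul, huu, husgn, huB⟩ := hshift l N (σ N) s (turnX p l M t) h.nonneg
      h.le_one hN1 htip hs gs (turnX_nonneg h.le_one hM2 ht) gt
    obtain ⟨u', hu', hux', huC', hul', huu', husgn', huB'⟩ := hshift l' N (σ' N) s'
      (turnX p l' M t') h.nonneg' h.le_one' hN1 htip' hs' gs' (turnX_nonneg h.le_one' hM2 ht') gt'
    have k1 : |u - σ N| ≤ K ^ 3 * |u' - σ' N| := abs_tip_sub_le hK hNpos htip htip' hu hu' (by
      rw [hux, hux']
      exact h.turnX_le N M (σ N) (σ' N) t t' hN0 hM0 (h.rel_tip N hN0) hRt)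
    have k2 : |u' - σ' N| ≤ K ^ 3 * |u - σ N| := abs_tip_sub_le hK hNpos htip' htip hu' hu (by
      rw [hux, hux']
      exact h.turnX_le' N M (σ N) (σ' N) t t' hN0 hM0 (h.rel_tip N hN0) hRt)
    have hmC : C * K ^ 3 * 4 ≤ m := by
      have : 0 < E₂ / E₁ := by positivity
      linarith
    have hcmp : ∀ {y y' κ κ' : ℝ}, |y| ≤ C * (N ^ (-q) * κ) → κ ≤ K ^ 3 * κ' →
        1 / 4 * (N ^ (-q) * κ') ≤ |y'| → |y| ≤ m * |y'| := by
      intro y y' κ κ' h1 h2 h3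
      calc |y| ≤ C * (N ^ (-q) * (K ^ 3 * κ')) := h1.trans (by gcongr)
        _ = C * K ^ 3 * 4 * (1 / 4 * (N ^ (-q) * κ')) := by ring
        _ ≤ C * K ^ 3 * 4 * |y'| := by gcongr
        _ ≤ _ := by gcongr
    have hv := turnY_sq_sub_bounds hp (by linarith : p ≤ q) h.nonneg h.le_one hN2 hNM hu ht hux
    have hv' := turnY_sq_sub_bounds hp (by linarith : p ≤ q) h.nonneg' h.le_one' hN2 hNM hu'
      ht' hux'
    set w := (N ^ (-q)) ^ 2 * ((M - N) / M) with hw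
    have hw0 : 0 ≤ w := mul_nonneg (by positivity) (div_nonneg (by linarith) (by linarith))
    rw [← hE₁, ← hE₂] at hv hv'
    have hvert : |turnY q l' N u' - turnY q l' M t'| ≤ V * |turnY q l N u - turnY q l M t| := by
      refine abs_sub_le_of_sq_sub_sq hm0 ?_ (hcmp huu k1 hul') (hcmp huu' k2 hul)
        (le_trans (by positivity) hv'.1) ?_ ?_
      · refine lt_of_lt_of_le ?_ hul'
        have : 0 < |u' - σ' N| := lt_of_lt_of_le (by positivity) huB'
        positivity
      · have h1 : E₂ * w = E₂ / E₁ * (E₁ * w) := by field_simp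
        have h2 : E₂ / E₁ ≤ m := le_add_of_nonneg_left (by positivity)
        refine hv'.2.trans ?_
        rw [h1]
        refine (mul_le_mul_of_nonneg_left hv.1 (by positivity)).trans ?_
        exact mul_le_mul_of_nonneg_right h2 (le_trans (by positivity) hv.1)
      · by_contra! hc
        obtain ⟨c1, c2, c3⟩ := hc
        refine absurd c3 (not_lt.2 ?_)
        have hss := h.side N s s' hN0 hRs
        have hyy : 0 < turnY q l N u * turnY q l' N u' := by
          have := mul_pos husgn husgn'
          have e : turnY q l N u * (s - σ N) * (turnY q l' N u' * (s' - σ' N)) =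
            turnY q l N u * turnY q l' N u' * ((s - σ N) * (s' - σ' N)) := by ring
          rw [e] at this
          exact pos_of_mul_pos_left this hss
        have hyt : turnY q l M t * turnY q l' M t' < 0 := by
          have := mul_neg_of_pos_of_neg c2 c1
          have e : turnY q l N u * turnY q l M t * (turnY q l' N u' * turnY q l' M t') =
            turnY q l M t * turnY q l' M t' * (turnY q l N u * turnY q l' N u') := by ring
          rw [e] at this
          exact neg_of_mul_neg_left this hyy.le
        have hsgn : ∀ {l v : ℝ}, l ≤ 1 → v ∈ Icc (-(π / 2)) (π / 2) →
            0 ≤ turnY q l M v * v := by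
          intro l v hl hv
          rw [turnY, mul_assoc]
          refine mul_nonneg (rpow_nonneg (zero_le_one.trans (one_le_turnRadius hl hM2 hv)) _) ?_
          rcases le_total 0 v with h0 | h0
          · exact mul_nonneg (sin_nonneg_of_nonneg_of_le_pi h0 (by linarith [hv.2])) h0
          · exact mul_nonneg_of_nonpos_of_nonpos
              (sin_nonpos_of_nonpos_of_neg_pi_le h0 (by linarith [hv.1])) h0
        have htt : t * t' < 0 := by
          have n1 : t ≠ 0 := by
            rintro rfl
            simp [turnY] at hyt
          have n2 : t' ≠ 0 := by
            rintro rfl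
            simp [turnY] at hyt
          refine lt_of_le_of_ne ?_ (mul_ne_zero n1 n2)
          by_contra hc
          have h1 := mul_nonneg (hsgn h.le_one ht) (hsgn h.le_one' ht')
          have e : turnY q l M t * t * (turnY q l' M t' * t') =
            turnY q l M t * turnY q l' M t' * (t * t') := by ring
          rw [e] at h1
          have := mul_neg_of_neg_of_pos hyt (not_le.1 hc)
          linarith
        have hKM : K / M ≤ K / N := by
          gcongr
          linarith
        have hκt : |t - σ M| ≤ K ^ 3 * |t' - σ' M| := by
          have h1 := h.symm.sq_le hM0 hRt
          have hK3 : 1 ≤ K ^ 3 := one_le_pow₀ hK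
          refine (pow_le_pow_iff_left₀ (by positivity) (by positivity) two_ne_zero).1 ?_
          rw [mul_pow, sq_abs, sq_abs]
          refine h1.trans ?_
          gcongr
          exact le_self_pow₀ hK3 two_ne_zero
        have h1 : |t| ≤ (K ^ 3 + 1) * (K / N) :=
          abs_le_of_mul_neg (by positivity) htt (h.side M t t' hM0 hRt)
            ((h.tip M hM0).abs_le_div.trans hKM) ((h.tip' M hM0).abs_le_div.trans hKM) hκt
        calc |turnY q l M t| ≤ 4 ^ q * M ^ (-q) * |sin t| := abs_turnY_le hq.le h.le_one hM2 ht
          _ ≤ 4 ^ q * N ^ (-q) * ((K ^ 3 + 1) * (K / N)) := by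
            gcongr
            exact abs_sin_le_abs.trans h1
          _ = 1 / 4 * (N ^ (-q) * (B / N)) / 2 := by
            rw [hB]
            ring
          _ ≤ 1 / 4 * (N ^ (-q) * |u - σ N|) / 2 := by gcongr
          _ ≤ _ := by gcongr
    have c1 : |turnY q l' N s' - turnY q l' M t'| ≤ C * (K * D) + V *
        (C * D + |turnY q l N s - turnY q l M t|) := by
      have a1 := _root_.abs_sub_le (turnY q l' N s') (turnY q l' N u') (turnY q l' M t')
      have a2 := _root_.abs_sub_le (turnY q l N u) (turnY q l N s) (turnY q l M t)
      rw [abs_sub_comm (turnY q l N u) (turnY q l N s)] at a2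
      have a3 : |turnY q l' N s' - turnY q l' N u'| ≤ C * (K * D) := huC'.trans (by gcongr)
      have a4 : V * |turnY q l N u - turnY q l M t| ≤
          V * (C * D + |turnY q l N s - turnY q l M t|) := by
        gcongr
        linarith
      linarith
    calc turnDist p q l' N s' M t' ≤ K * D + (C * (K * D) + V *
          (C * D + |turnY q l N s - turnY q l M t|)) := add_le_add hx c1
      _ ≤ (K + C * K + V * (1 + C)) * turnDist p q l N s M t := by
        rw [hT]
        have : 0 ≤ (K + C * K + V * C) * |turnY q l N s - turnY q l M t| := by positivity
        have : 0 ≤ V * D := by positivity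
        linarith
      _ ≤ _ := by
        refine mul_le_mul_of_nonneg_right (le_max_right _ _) ?_
        rw [hT]
        positivity

end TurnMatch

section Abscissa

lemma exists_radius_envelope {p : ℝ} (hp : 0 < p) :
    ∃ U : ℝ → ℝ, ∃ c > 0, (∀ u, 1 ≤ u → u ≤ U u ∧ U u ≤ 6 * u) ∧
      (∀ u u', u' ≤ u → c * (u - u') ≤ U u - U u' ∧ U u - U u' ≤ u - u') ∧
      ∀ N σ, 2 * π ≤ N → |σ| ≤ 1 / 4 →
        (∀ s ∈ Icc (-(π / 2)) (π / 2), turnX p 1 N s ≤ turnX p 1 N σ) →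
        U (turnX p 1 N σ ^ (-(1 / p))) = N := by
  have hπ := pi_gt_three
  have hπ4 : π < 3.15 := pi_lt_d2
  set F : ℝ → ℝ → ℝ := fun u s => u * cos s ^ (1 / p) + π - s with hF
  have hcos : ∀ s ∈ Icc (-(1 / 4) : ℝ) (1 / 4), 1 / 2 ≤ cos s := by
    intro s hs
    have := one_sub_sq_div_two_le_cos (x := s)
    nlinarith [hs.1, hs.2]
  have hJ : Icc (-(1 / 4) : ℝ) (1 / 4) ⊆ Icc (-(π / 2)) (π / 2) :=
    Icc_subset_Icc (by linarith) (by linarith)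
  have hp0 : 0 ≤ 1 / p := by positivity
  have hmax : ∀ u, ∃ s ∈ Icc (-(1 / 4) : ℝ) (1 / 4), IsMaxOn (F u) (Icc (-(1 / 4)) (1 / 4)) s := by
    intro u
    refine isCompact_Icc.exists_isMaxOn ⟨0, by norm_num, by norm_num⟩ ?_
    refine ((continuousOn_const.mul (continuous_cos.continuousOn.rpow_const fun s _ =>
      Or.inr hp0)).add continuousOn_const).sub continuousOn_id
  choose S hSJ hS using hmax
  have hle : ∀ u, ∀ s ∈ Icc (-(1 / 4) : ℝ) (1 / 4), F u s ≤ F u (S u) := fun u s hs => hS u hs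
  have hpow : ∀ s ∈ Icc (-(1 / 4) : ℝ) (1 / 4),
      (1 / 2 : ℝ) ^ (1 / p) ≤ cos s ^ (1 / p) ∧ cos s ^ (1 / p) ≤ 1 := fun s hs =>
    ⟨rpow_le_rpow (by norm_num) (hcos s hs) hp0,
      rpow_le_one (by linarith [hcos s hs]) (cos_le_one s) hp0⟩
  refine ⟨fun u => F u (S u), (1 / 2) ^ (1 / p), by positivity, ?_, ?_, ?_⟩
  · intro u hu
    have h0 := hle u 0 ⟨by norm_num, by norm_num⟩
    have h1 := mul_le_of_le_one_right (by linarith : 0 ≤ u) (hpow _ (hSJ u)).2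
    have h2 := hSJ u
    simp only [hF, cos_zero, one_rpow, mul_one, sub_zero] at h0 ⊢
    constructor
    · linarith
    · linarith [h2.1]
  · intro u u' huu
    have h1 := hle u _ (hSJ u')
    have h2 := hle u' _ (hSJ u)
    have h3 := mul_le_mul_of_nonneg_left (hpow _ (hSJ u')).1 (sub_nonneg.2 huu)
    have h4 := mul_le_mul_of_nonneg_left (hpow _ (hSJ u)).2 (sub_nonneg.2 huu)
    simp only [hF] at h1 h2 ⊢
    constructor <;> linarith
  · intro N σ hN hσ hmaxσ
    have hσJ : σ ∈ Icc (-(1 / 4) : ℝ) (1 / 4) := abs_le.1 hσ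
    have hr : ∀ s ∈ Icc (-(1 / 4) : ℝ) (1 / 4), 0 < turnRadius 1 N s := fun s hs =>
      zero_lt_one.trans_le (one_le_turnRadius le_rfl hN (hJ hs))
    have hrσ := hr σ hσJ
    have hc : 0 < cos σ := by linarith [hcos σ hσJ]
    have hx : 0 < turnX p 1 N σ := mul_pos (rpow_pos_of_pos hrσ _) hc
    set u := turnX p 1 N σ ^ (-(1 / p)) with hu
    have hu0 : 0 < u := rpow_pos_of_pos hx _
    have hup : u ^ (-p) = turnX p 1 N σ := by
      rw [hu, ← rpow_mul hx.le, show -(1 / p) * -p = 1 by field_simp, rpow_one]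
    have hFle : ∀ s ∈ Icc (-(1 / 4) : ℝ) (1 / 4), F u s ≤ N := by
      intro s hs
      have h1 := hmaxσ s (hJ hs)
      have h2 := hr s hs
      have h3 : 0 < cos s := by linarith [hcos s hs]
      rw [← hup, turnX, rpow_neg h2.le, rpow_neg hu0.le, ← div_eq_inv_mul,
        div_le_iff₀ (rpow_pos_of_pos h2 _), inv_mul_eq_div,
        le_div_iff₀ (rpow_pos_of_pos hu0 _)] at h1
      have h4 := rpow_le_rpow (by positivity) h1 hp0
      rw [mul_rpow h3.le (by positivity), ← rpow_mul hu0.le, ← rpow_mul h2.le,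
        mul_one_div_cancel hp.ne', rpow_one, rpow_one, turnRadius] at h4
      simp only [hF]
      linarith
    have hFσ : F u σ = N := by
      have h1 : u * cos σ ^ (1 / p) = turnRadius 1 N σ := by
        rw [hu, turnX, mul_rpow (rpow_pos_of_pos hrσ _).le hc.le, ← rpow_mul hrσ.le,
          show -p * -(1 / p) = 1 by field_simp, rpow_one, mul_assoc, ← rpow_add hc,
          neg_add_cancel, rpow_zero, mul_one]
      simp only [hF, h1, turnRadius]
      ring
    exact le_antisymm (hFle _ (hSJ u)) (hFσ.ge.trans (hle u σ hσJ))

lemma exists_abscissa_change {p : ℝ} (hp : 0 < p) :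
    ∃ φ : ℝ → ℝ, ∃ k ≥ 1, (∀ x, 0 < x → x ≤ 1 → 0 < φ x ∧ φ x ≤ x) ∧
      (∀ x x', 0 < x → x ≤ x' → x' ≤ 1 →
        φ x' - φ x ≤ k * (x' - x) ∧ x' - x ≤ k * (φ x' - φ x)) ∧
      ∀ N σ, 2 * π ≤ N → |σ| ≤ 1 / 4 →
        (∀ s ∈ Icc (-(π / 2)) (π / 2), turnX p 1 N s ≤ turnX p 1 N σ) →
        φ (turnX p 1 N σ) = N ^ (-p) := by
  obtain ⟨U, c, hc, hUu, hU, htip⟩ := exists_radius_envelope hp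
  set m := min 1 p with hm
  have hm0 : 0 < m := lt_min one_pos hp
  set k₁ := (1 + p) / m with hk₁
  set k₂ := (1 + p) * (6 ^ p * 6) / (m * c) with hk₂
  have hk₁1 : 1 ≤ k₁ := by
    rw [hk₁, le_div_iff₀ hm0]
    linarith [min_le_left 1 p]
  have hk₂0 : 0 < k₂ := by positivity
  have hroot : ∀ {x : ℝ}, 0 < x → (x ^ (-(1 / p))) ^ (-p) = x := by
    intro x hx
    rw [← rpow_mul hx.le, show -(1 / p) * -p = 1 by field_simp, rpow_one]
  have hone : ∀ {x : ℝ}, 0 < x → x ≤ 1 → 1 ≤ x ^ (-(1 / p)) := fun hx hx1 =>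
    one_le_rpow_of_pos_of_le_one_of_nonpos hx hx1 (by simp only [Left.neg_nonpos_iff]; positivity)
  refine ⟨fun x => U (x ^ (-(1 / p))) ^ (-p), k₁ + k₂, by linarith, ?_, ?_, ?_⟩
  · intro x hx hx1
    have h1 := hone hx hx1
    have h2 := (hUu _ h1).1
    refine ⟨rpow_pos_of_pos (by linarith) _, ?_⟩
    conv_rhs => rw [← hroot hx]
    exact rpow_le_rpow_of_nonpos (by linarith) h2 (by linarith)
  · intro x x' hx hxx hx'
    have h1 := hone hx (hxx.trans hx')
    have h1' := hone (hx.trans_le hxx) hx'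
    have huu : x' ^ (-(1 / p)) ≤ x ^ (-(1 / p)) :=
      rpow_le_rpow_of_nonpos hx hxx (by simp only [Left.neg_nonpos_iff]; positivity)
    have e := hroot hx
    have e' := hroot (hx.trans_le hxx)
    simp only
    set u := x ^ (-(1 / p)) with hu
    set u' := x' ^ (-(1 / p)) with hu'
    obtain ⟨hU1, hU6⟩ := hUu u h1
    obtain ⟨hU1', hU6'⟩ := hUu u' h1'
    obtain ⟨hUl, hUr⟩ := hU u u' huu
    have hu0 : 0 < u := by linarith
    have hu0' : 0 < u' := by linarith
    have hUU : U u' ≤ U u := by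
      have := mul_nonneg hc.le (sub_nonneg.2 huu)
      linarith
    have a1 := rpow_neg_sub_le hp (by linarith : 0 < U u') hUU
    have a2 := le_rpow_neg_sub hp (by linarith : 0 < U u') hUU
    have b1 := rpow_neg_sub_le hp hu0' huu
    have b2 := le_rpow_neg_sub hp hu0' huu
    rw [← hm] at a2 b2
    set w := u' ^ (-p) * ((u - u') / u) with hw
    set W := U u' ^ (-p) * ((U u - U u') / U u) with hW
    rw [e, e'] at b1 b2
    have hw0 : 0 ≤ w := mul_nonneg (rpow_nonneg hu0'.le _) (div_nonneg (by linarith) hu0.le)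
    have hWw : W ≤ w := by
      have : U u' ^ (-p) ≤ u' ^ (-p) := rpow_le_rpow_of_nonpos hu0' hU1' (by linarith)
      have h0 : 0 ≤ u - u' := by linarith
      have h3 : 0 ≤ (U u - U u') / U u := div_nonneg (by linarith) (by linarith)
      rw [hW, hw]
      gcongr
    have hwW : w ≤ 6 ^ p * 6 / c * W := by
      have h3 : u' ^ (-p) ≤ 6 ^ p * U u' ^ (-p) := by
        have h4 : (6 * u') ^ (-p) ≤ U u' ^ (-p) :=
          rpow_le_rpow_of_nonpos (by linarith) hU6' (by linarith)
        rw [mul_rpow (by norm_num) hu0'.le, rpow_neg (by norm_num : (0 : ℝ) ≤ 6),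
          inv_mul_le_iff₀ (by positivity)] at h4
        exact h4
      have h5 : (u - u') / u ≤ 6 / c * ((U u - U u') / U u) := by
        rw [div_mul_div_comm, div_le_div_iff₀ hu0 (by nlinarith)]
        have := mul_le_mul hUl hU6 (by linarith) (le_trans (by nlinarith) hUl)
        nlinarith
      have h6 : 0 ≤ (u - u') / u := div_nonneg (by linarith) hu0.le
      have h7 : 0 ≤ 6 ^ p * U u' ^ (-p) := (rpow_nonneg hu0'.le _).trans h3
      calc w ≤ 6 ^ p * U u' ^ (-p) * (6 / c * ((U u - U u') / U u)) := mul_le_mul h3 h5 h6 h7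
        _ = _ := by rw [hW]; ring
    have hd0 : 0 ≤ x' - x := by linarith
    have hW0 : 0 ≤ W := by
      by_contra hneg
      have := mul_neg_of_pos_of_neg (by positivity : 0 < 6 ^ p * 6 / c) (not_le.1 hneg)
      linarith
    have hD0 : 0 ≤ U u' ^ (-p) - U u ^ (-p) := (mul_nonneg hm0.le hW0).trans a2
    constructor
    · calc U u' ^ (-p) - U u ^ (-p) ≤ (1 + p) * w := a1.trans (by gcongr)
        _ = k₁ * (m * w) := by rw [hk₁]; field_simp
        _ ≤ k₁ * (x' - x) := mul_le_mul_of_nonneg_left b2 (by linarith)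
        _ ≤ _ := by gcongr; linarith
    · calc x' - x ≤ (1 + p) * (6 ^ p * 6 / c * W) := b1.trans (by gcongr)
        _ = k₂ * (m * W) := by rw [hk₂]; field_simp
        _ ≤ k₂ * (U u' ^ (-p) - U u ^ (-p)) := by gcongr
        _ ≤ _ := by gcongr; linarith
  · intro N σ hN hσ hmax
    simp only [htip N σ hN hσ hmax]

end Abscissa

section MatchExistence

variable {p K K' l N σ s : ℝ}

lemma IsTip.mono (h : IsTip p K l N σ) (hN : 0 < N) (hK : K ≤ K') : IsTip p K' l N σ where
  abs_le_quarter := h.abs_le_quarter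
  abs_le_div := h.abs_le_div.trans (by gcongr)
  turnX_le := h.turnX_le
  le_mul_abs_sub s hs t ht hst := (h.le_mul_abs_sub s hs t ht hst).trans (by gcongr)
  abs_sub_le_mul s hs t ht hst := (h.abs_sub_le_mul s hs t ht hst).trans (by gcongr)

lemma IsTip.eq_zero (h : IsTip p K 0 N σ) (hN : 0 < N) : σ = 0 := by
  have hπ := pi_gt_three
  have h0 := h.turnX_le 0 ⟨by linarith, by linarith⟩
  have hσ := abs_le.1 h.abs_le_quarter
  simp only [turnX, turnRadius, zero_mul, add_zero, cos_zero] at h0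
  have h1 := le_of_mul_le_mul_left h0 (rpow_pos_of_pos hN _)
  exact (cos_eq_one_iff_of_lt_of_lt (by linarith) (by linarith)).1 (le_antisymm (cos_le_one σ) h1)

lemma turnX_pos (hl1 : l ≤ 1) (hN : 2 * π ≤ N) (hs : s ∈ Ioo (-(π / 2)) (π / 2)) :
    0 < turnX p l N s :=
  mul_pos (rpow_pos_of_pos (zero_lt_one.trans_le
    (one_le_turnRadius hl1 hN (Ioo_subset_Icc_self hs))) _) (cos_pos_of_mem_Ioo hs)

lemma turnX_le_one (hp : 0 < p) (hl1 : l ≤ 1) (hN : 2 * π ≤ N)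
    (hs : s ∈ Icc (-(π / 2)) (π / 2)) : turnX p l N s ≤ 1 := by
  have hr := one_le_turnRadius hl1 hN hs
  exact mul_le_one₀ (rpow_le_one_of_one_le_of_nonpos hr (by linarith))
    (cos_nonneg_of_mem_Icc hs) (cos_le_one s)

lemma mem_Ioo_of_turnX_pos (hs : s ∈ Icc (-(π / 2)) (π / 2)) (h : 0 < turnX p l N s) :
    s ∈ Ioo (-(π / 2)) (π / 2) := by
  refine ⟨lt_of_le_of_ne hs.1 ?_, lt_of_le_of_ne hs.2 ?_⟩
  · rintro rfl
    simp [turnX] at h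
  · rintro rfl
    simp [turnX] at h

lemma exists_turnMatch (hp : 0 < p) :
    ∃ K N₀ : ℝ, ∃ σ : ℝ → ℝ, ∃ R : ℝ → ℝ → ℝ → Prop,
      TurnMatch p K 1 0 N₀ σ (fun _ => 0) R ∧
      (∀ N s s', R N s s' → s ∈ Ioo (-(π / 2)) (π / 2) ∧ s' ∈ Ioo (-(π / 2)) (π / 2)) ∧
      ∀ N, N₀ ≤ N → (∀ s ∈ Ioo (-(π / 2)) (π / 2), ∃ s', R N s s') ∧
        ∀ s' ∈ Ioo (-(π / 2)) (π / 2), ∃ s, R N s s' := by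
  obtain ⟨K, hK, N₀, hN₀, htip⟩ := exists_isTip hp
  obtain ⟨φ, k, hk, hφ, hφk, hφtip⟩ := exists_abscissa_change hp
  have hπ := pi_gt_three
  have hσ : ∀ N, ∃ σ, N₀ ≤ N → IsTip p (max K k) 1 N σ := by
    intro N
    by_cases hN : N₀ ≤ N
    · obtain ⟨σ, h⟩ := htip 1 N zero_le_one le_rfl hN
      exact ⟨σ, fun _ => h.mono (by linarith) (le_max_left _ _)⟩
    · exact ⟨0, fun h => absurd h hN⟩
  choose σ hσ using hσ
  have hzero : ∀ N, N₀ ≤ N → IsTip p (max K k) 0 N 0 := by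
    intro N hN
    obtain ⟨τ, h⟩ := htip 0 N le_rfl zero_le_one hN
    have hN0 : 0 < N := by linarith
    rw [h.eq_zero hN0] at h
    exact h.mono hN0 (le_max_left _ _)
  have hσI : ∀ N, N₀ ≤ N → σ N ∈ Ioo (-(π / 2)) (π / 2) := by
    intro N hN
    have := abs_le.1 (hσ N hN).abs_le_quarter
    exact ⟨by linarith, by linarith⟩
  have hφσ : ∀ N, N₀ ≤ N → φ (turnX p 1 N (σ N)) = N ^ (-p) := fun N hN =>
    hφtip N (σ N) (hN₀.le.trans hN) (hσ N hN).abs_le_quarter (hσ N hN).turnX_le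
  have h0 : ∀ N s, turnX p 0 N s = N ^ (-p) * cos s := by
    intro N s
    simp [turnX, turnRadius]
  have hφabs : ∀ x x', 0 < x → x ≤ 1 → 0 < x' → x' ≤ 1 →
      |φ x - φ x'| ≤ k * |x - x'| ∧ |x - x'| ≤ k * |φ x - φ x'| := by
    intro x x' hx hx1 hx' hx1'
    wlog hxx : x ≤ x' generalizing x x'
    · rw [abs_sub_comm (φ x), abs_sub_comm x]
      exact this x' x hx' hx1' hx hx1 (le_of_not_ge hxx)
    obtain ⟨a, b⟩ := hφk x x' hx hxx hx1'
    have hD : 0 ≤ φ x' - φ x :=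
      nonneg_of_mul_nonneg_right ((sub_nonneg.2 hxx).trans b) (by linarith)
    rw [abs_sub_comm (φ x), abs_sub_comm x, abs_of_nonneg hD, abs_of_nonneg (sub_nonneg.2 hxx)]
    exact ⟨a, b⟩
  refine ⟨max K k, N₀, σ, fun N s s' => s ∈ Ioo (-(π / 2)) (π / 2) ∧
    s' ∈ Ioo (-(π / 2)) (π / 2) ∧ 0 ≤ (s - σ N) * s' ∧ turnX p 0 N s' = φ (turnX p 1 N s),
    ?_, fun N s s' h => ⟨h.1, h.2.1⟩, ?_⟩
  · have hkK : k ≤ max K k := le_max_right _ _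
    exact
    { one_le := hk.trans hkK
      two_pi_le := hN₀
      nonneg := zero_le_one
      le_one := le_rfl
      nonneg' := le_rfl
      le_one' := zero_le_one
      tip := hσ
      tip' := hzero
      rel_tip := fun N hN => ⟨hσI N hN, ⟨by linarith, by linarith⟩, by simp, by
        rw [hφσ N hN, h0, cos_zero, mul_one]⟩
      mem := fun N s s' _ h => Ioo_subset_Icc_self h.1
      mem' := fun N s s' _ h => Ioo_subset_Icc_self h.2.1
      side := fun N s s' _ h => by simpa using h.2.2.1
      turnX_le := by
        rintro N M s s' t t' hN hM ⟨hs, -, -, es⟩ ⟨ht, -, -, et⟩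
        have hN2 := hN₀.le.trans hN
        have hM2 := hN₀.le.trans hM
        rw [es, et]
        refine (hφabs _ _ (turnX_pos le_rfl hN2 hs)
          (turnX_le_one hp le_rfl hN2 (Ioo_subset_Icc_self hs)) (turnX_pos le_rfl hM2 ht)
          (turnX_le_one hp le_rfl hM2 (Ioo_subset_Icc_self ht))).2.trans ?_
        gcongr
      turnX_le' := by
        rintro N M s s' t t' hN hM ⟨hs, -, -, es⟩ ⟨ht, -, -, et⟩
        have hN2 := hN₀.le.trans hN
        have hM2 := hN₀.le.trans hM
        rw [es, et]
        refine (hφabs _ _ (turnX_pos le_rfl hN2 hs)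
          (turnX_le_one hp le_rfl hN2 (Ioo_subset_Icc_self hs)) (turnX_pos le_rfl hM2 ht)
          (turnX_le_one hp le_rfl hM2 (Ioo_subset_Icc_self ht))).1.trans ?_
        gcongr }
  · intro N hN
    have hN2 := hN₀.le.trans hN
    have hXσ := turnX_pos (p := p) le_rfl hN2 (hσI N hN)
    have hXσ1 := turnX_le_one hp le_rfl hN2 (Ioo_subset_Icc_self (hσI N hN))
    have h00 : turnX p 0 N 0 = N ^ (-p) := by rw [h0, cos_zero, mul_one]
    constructor
    · intro s hs
      have hXs := turnX_pos (p := p) le_rfl hN2 hs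
      have hXle := (hσ N hN).turnX_le s (Ioo_subset_Icc_self hs)
      have hpos := (hφ _ hXs (hXle.trans hXσ1)).1
      have hle : φ (turnX p 1 N s) ≤ turnX p 0 N 0 := by
        have := (hφk _ _ hXs hXle hXσ1).2
        have := nonneg_of_mul_nonneg_right ((sub_nonneg.2 hXle).trans this) (by linarith)
        rw [h00, ← hφσ N hN]
        linarith
      obtain ⟨u, hu, hsu, hux⟩ := exists_turnX_eq zero_le_one hN2 (hzero N hN) (s - σ N)
        hpos.le hle
      exact ⟨u, hs, mem_Ioo_of_turnX_pos hu (hux ▸ hpos), by simpa using hsu, hux⟩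
    · intro s' hs'
      have hy := turnX_pos (p := p) zero_le_one hN2 hs'
      have hyle := (hzero N hN).turnX_le s' (Ioo_subset_Icc_self hs')
      rw [h00] at hyle
      set y := turnX p 0 N s' with hydef
      set a := min y (turnX p 1 N (σ N)) with ha
      have ha0 : 0 < a := lt_min hy hXσ
      have haσ : a ≤ turnX p 1 N (σ N) := min_le_right _ _
      have hcont : ContinuousOn φ (Icc a (turnX p 1 N (σ N))) := by
        refine LipschitzOnWith.continuousOn (K := k.toNNReal) ?_
        refine LipschitzOnWith.of_dist_le_mul fun x hx x' hx' => ?_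
        rw [coe_toNNReal _ (by linarith), dist_eq, dist_eq]
        exact (hφabs x x' (ha0.trans_le hx.1) (hx.2.trans hXσ1) (ha0.trans_le hx'.1)
          (hx'.2.trans hXσ1)).1
      obtain ⟨x, hx, hxy⟩ := intermediate_value_Icc haσ hcont (show y ∈ Icc _ _ from
        ⟨(hφ a ha0 (haσ.trans hXσ1)).2.trans (min_le_left _ _), hyle.trans (hφσ N hN).ge⟩)
      have hx0 := ha0.trans_le hx.1
      obtain ⟨u, hu, hsu, hux⟩ := exists_turnX_eq le_rfl hN2 (hσ N hN) (σ N + s') hx0.le hx.2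
      refine ⟨u, mem_Ioo_of_turnX_pos hu (hux ▸ hx0), hs', ?_, ?_⟩
      · rw [add_sub_cancel_left] at hsu
        rwa [mul_comm]
      · rw [hux, hxy]

end MatchExistence

lemma turnDist_le_four {p q l N M s t : ℝ} (hp : 0 ≤ p) (hq : 0 ≤ q) (hl1 : l ≤ 1)
    (hN : 2 * π ≤ N) (hM : 2 * π ≤ M) (hs : s ∈ Icc (-(π / 2)) (π / 2))
    (ht : t ∈ Icc (-(π / 2)) (π / 2)) : turnDist p q l N s M t ≤ 4 := by
  have key : ∀ {e N s : ℝ} {f : ℝ → ℝ}, 0 ≤ e → (∀ x, |f x| ≤ 1) → 2 * π ≤ N →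
      s ∈ Icc (-(π / 2)) (π / 2) → |turnRadius l N s ^ (-e) * f s| ≤ 1 := by
    intro e N s f he hf hN hs
    have h1 := one_le_turnRadius hl1 hN hs
    rw [abs_mul, abs_of_pos (rpow_pos_of_pos (by linarith) _)]
    exact mul_le_one₀ (rpow_le_one_of_one_le_of_nonpos h1 (by linarith)) (abs_nonneg _) (hf s)
  have h1 := abs_sub (turnX p l N s) (turnX p l M t)
  have h2 := abs_sub (turnY q l N s) (turnY q l M t)
  have x1 : |turnX p l N s| ≤ 1 := key hp abs_cos_le_one hN hs
  have x2 : |turnX p l M t| ≤ 1 := key hp abs_cos_le_one hM ht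
  have y1 : |turnY q l N s| ≤ 1 := key hq abs_sin_le_one hN hs
  have y2 : |turnY q l M t| ≤ 1 := key hq abs_sin_le_one hM ht
  unfold turnDist
  linarith

/-- On finitely many turns, keeping the angle is bi-Lipschitz along each turn. -/
lemma turnDist_le_on_bounded_turn {p q : ℝ} (hp : 0 < p) (hpq : p ≤ q) {B : ℝ} (hB : 0 < B) :
    ∃ L > 0, ∀ l l' N s t : ℝ, 0 ≤ l → l ≤ 1 → 0 ≤ l' → l' ≤ 1 → 2 * π ≤ N → N ≤ B →
      s ∈ Icc (-(π / 2)) (π / 2) → t ∈ Icc (-(π / 2)) (π / 2) →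
      turnDist p q l' N s N t ≤ L * turnDist p q l N s N t := by
  have hq := hp.trans_le hpq
  obtain ⟨c, hc, H⟩ := turnDist_lower_bound hp hpq
  obtain ⟨C₁, hC₁, H₁⟩ := turn_coordinate_lipschitz hp abs_cos_le_one abs_cos_sub_le
  obtain ⟨C₂, hC₂, H₂⟩ := turn_coordinate_lipschitz hq abs_sin_le_one abs_sin_sub_le
  refine ⟨(C₁ * B ^ (q - p) + C₂) / c, by positivity, ?_⟩
  intro l l' N s t hl0 hl1 hl0' hl1' hN hNB hs ht
  have hN0 : 0 < N := by linarith [pi_pos]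
  have h := H l N N s t hl0 hl1 hN le_rfl hs ht
  have h1 := H₁ l' N s t hl0' hl1' hN hs ht
  have h2 := H₂ l' N s t hl0' hl1' hN hs ht
  rw [sub_self, zero_div, zero_add] at h
  have hpow : N ^ (-p) ≤ B ^ (q - p) * N ^ (-q) := by
    have : N ^ (-p) = N ^ (q - p) * N ^ (-q) := by
      rw [← rpow_add hN0]; congr 1; ring
    rw [this]
    gcongr
  calc turnDist p q l' N s N t ≤ C₁ * (N ^ (-p) * |s - t|) + C₂ * (N ^ (-q) * |s - t|) :=
        add_le_add h1 h2
    _ ≤ C₁ * ((B ^ (q - p) * N ^ (-q)) * |s - t|) + C₂ * (N ^ (-q) * |s - t|) := by gcongr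
    _ = (C₁ * B ^ (q - p) + C₂) / c * (c * (N ^ (-q) * |s - t|)) := by field_simp
    _ ≤ _ := by gcongr

/-- Any two distances between a bounded turn and another turn are comparable. -/
lemma turnDist_le_from_bounded_turn {p q : ℝ} (hp : 0 < p) (hpq : p ≤ q) {B : ℝ} (hB : 0 < B) :
    ∃ L > 0, ∀ l l' N M s s' t t' : ℝ, 0 ≤ l → l ≤ 1 → l' ≤ 1 → 2 * π ≤ N → N ≤ B →
      N + 2 * π ≤ M → s ∈ Icc (-(π / 2)) (π / 2) → s' ∈ Icc (-(π / 2)) (π / 2) →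
      t ∈ Icc (-(π / 2)) (π / 2) → t' ∈ Icc (-(π / 2)) (π / 2) →
      turnDist p q l' N s' M t' ≤ L * turnDist p q l N s M t := by
  have hq := hp.trans_le hpq
  obtain ⟨c, hc, H⟩ := turnDist_lower_bound hp hpq
  have hπ := pi_pos
  refine ⟨4 / (c * (B ^ (-q) * (2 * π / (B + 2 * π)))), by positivity, ?_⟩
  intro l l' N M s s' t t' hl0 hl1 hl1' hN hNB hNM hs hs' ht ht'
  have hN0 : 0 < N := by linarith
  have hM0 : 0 < M := by linarith
  have h := H l N M s t hl0 hl1 hN (by linarith) hs ht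
  have h4 := turnDist_le_four hp.le hq.le hl1' hN (by linarith : 2 * π ≤ M) hs' ht'
  have hfrac : 2 * π / (B + 2 * π) ≤ (M - N) / M + |s - t| := by
    have : 2 * π / (B + 2 * π) ≤ (M - N) / M := by
      rw [div_le_div_iff₀ (by positivity) hM0]
      nlinarith [mul_le_mul (by linarith : 2 * π ≤ M - N) hNB hN0.le (by linarith)]
    linarith [abs_nonneg (s - t)]
  have hpow : B ^ (-q) ≤ N ^ (-q) := rpow_le_rpow_of_nonpos hN0 hNB (by linarith)
  have hlow : c * (B ^ (-q) * (2 * π / (B + 2 * π))) ≤ turnDist p q l N s M t :=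
    le_trans (by gcongr) h
  refine h4.trans ?_
  rw [div_mul_eq_mul_div, le_div_iff₀ (by positivity)]
  linarith

/-- The relation `R` on turns of parameter at least `B`, equality of angles on earlier turns. -/
def extendRel (B : ℝ) (R : ℝ → ℝ → ℝ → Prop) (N s s' : ℝ) : Prop :=
  (N < B ∧ s = s' ∧ s ∈ Ioo (-(π / 2)) (π / 2)) ∨ (B ≤ N ∧ R N s s')

lemma extendRel_symm {B : ℝ} {R : ℝ → ℝ → ℝ → Prop} {N s s' : ℝ} (h : extendRel B R N s s') :
    extendRel B (fun N s' s => R N s s') N s' s := by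
  rcases h with ⟨hN, rfl, hs⟩ | h
  · exact Or.inl ⟨hN, rfl, hs⟩
  · exact Or.inr h

namespace TurnMatch

variable {p K l l' N₀ : ℝ} {σ σ' : ℝ → ℝ} {R : ℝ → ℝ → ℝ → Prop}

lemma extendRel_mem (h : TurnMatch p K l l' N₀ σ σ' R) {B N s s' : ℝ} (hB : N₀ ≤ B)
    (hr : extendRel B R N s s') :
    s ∈ Icc (-(π / 2)) (π / 2) ∧ s' ∈ Icc (-(π / 2)) (π / 2) := by
  rcases hr with ⟨-, rfl, hs⟩ | ⟨hN, hr⟩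
  · exact ⟨Ioo_subset_Icc_self hs, Ioo_subset_Icc_self hs⟩
  · exact ⟨h.mem _ _ _ (hB.trans hN) hr, h.mem' _ _ _ (hB.trans hN) hr⟩

lemma turnDist_le_extendRel {q : ℝ} (hp : 0 < p) (hpq : p + 1 ≤ q)
    (h : TurnMatch p K l l' N₀ σ σ' R) :
    ∃ N₁ ≥ N₀, ∀ B, N₁ ≤ B → ∃ L > 0, ∀ N M s s' t t', 2 * π ≤ N → (N = M ∨ N + 2 * π ≤ M) →
      extendRel B R N s s' → extendRel B R M t t' →
      turnDist p q l' N s' M t' ≤ L * turnDist p q l N s M t := by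
  have hpq' : p ≤ q := by linarith
  obtain ⟨L₁, hL₁, H₁⟩ := h.turnDist_le_same hp hpq'
  obtain ⟨N₁, hN₁, L₂, hL₂, H₂⟩ := h.turnDist_le_of_lt hp hpq
  refine ⟨N₁, hN₁, fun B hB => ?_⟩
  have hB0 : 0 < B := by linarith [pi_pos, h.two_pi_le]
  obtain ⟨L₃, hL₃, H₃⟩ := turnDist_le_on_bounded_turn hp hpq' hB0
  obtain ⟨L₄, hL₄, H₄⟩ := turnDist_le_from_bounded_turn hp hpq' hB0
  refine ⟨L₁ + L₂ + L₃ + L₄, by positivity, ?_⟩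
  intro N M s s' t t' hN hNM hs ht
  have hd : 0 ≤ turnDist p q l N s M t := add_nonneg (abs_nonneg _) (abs_nonneg _)
  have hms := h.extendRel_mem (hN₁.le.trans hB) hs
  have hmt := h.extendRel_mem (hN₁.le.trans hB) ht
  have lift : ∀ L, L ≤ L₁ + L₂ + L₃ + L₄ →
      turnDist p q l' N s' M t' ≤ L * turnDist p q l N s M t →
      turnDist p q l' N s' M t' ≤ (L₁ + L₂ + L₃ + L₄) * turnDist p q l N s M t :=
    fun L hL hle => hle.trans (mul_le_mul_of_nonneg_right hL hd)
  rcases hNM with rfl | hNM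
  · rcases hs with ⟨hNB, rfl, -⟩ | ⟨hNB, hs⟩
    · rcases ht with ⟨-, rfl, -⟩ | ⟨hNB', -⟩
      · exact lift L₃ (by linarith)
          (H₃ l l' N s t h.nonneg h.le_one h.nonneg' h.le_one' hN hNB.le hms.1 hmt.1)
      · exact absurd hNB' hNB.not_ge
    · rcases ht with ⟨hNB', -⟩ | ⟨-, ht⟩
      · exact absurd hNB hNB'.not_ge
      · exact lift L₁ (by linarith) (H₁ N s s' t t' (hN₁.le.trans (hB.trans hNB)) hs ht)
  · rcases lt_or_ge N B with hNB | hNB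
    · exact lift L₄ (by linarith) (H₄ l l' N M s s' t t' h.nonneg h.le_one h.le_one' hN hNB.le hNM
        hms.1 hms.2 hmt.1 hmt.2)
    · have hMB : B ≤ M := by linarith [pi_pos]
      have hs' := (hs.resolve_left fun hlt => hNB.not_gt hlt.1).2
      have ht' := (ht.resolve_left fun hlt => hMB.not_gt hlt.1).2
      exact lift L₂ (by linarith) (H₂ N M s s' t t' (hB.trans hNB) hNM hs' ht')

end TurnMatch

/-- A correspondence of angles turn by turn which distorts distances by a bounded factor. -/
lemma exists_bilipschitz_relation {p q : ℝ} (hp : 0 < p) (hpq : p ≤ q) :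
    ∃ (R : ℝ → ℝ → ℝ → Prop) (L : ℝ), 0 < L ∧
      (∀ N s s', R N s s' → s ∈ Ioo (-(π / 2)) (π / 2) ∧ s' ∈ Ioo (-(π / 2)) (π / 2)) ∧
      (∀ N, ∀ s ∈ Ioo (-(π / 2)) (π / 2), ∃ s', R N s s') ∧
      (∀ N, ∀ s' ∈ Ioo (-(π / 2)) (π / 2), ∃ s, R N s s') ∧
      ∀ N M s s' t t', 2 * π ≤ N → (N = M ∨ N + 2 * π ≤ M) → R N s s' → R M t t' →
        turnDist p q 0 N s' M t' ≤ L * turnDist p q 1 N s M t ∧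
        turnDist p q 1 N s M t ≤ L * turnDist p q 0 N s' M t' := by
  rcases le_total q (p + 1) with hq | hq
  · obtain ⟨L, hL, H⟩ := turnDist_bilipschitz_of_le_add_one hp hpq hq
    refine ⟨fun _ s s' => s = s' ∧ s ∈ Ioo (-(π / 2)) (π / 2), L, hL, ?_, ?_, ?_, ?_⟩
    · rintro N s _ ⟨rfl, hs⟩
      exact ⟨hs, hs⟩
    · exact fun N s hs => ⟨s, rfl, hs⟩
    · exact fun N s hs => ⟨s, rfl, hs⟩
    · rintro N M s _ t _ hN hNM ⟨rfl, hs⟩ ⟨rfl, ht⟩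
      exact H N M s t hN (hNM.elim le_of_eq fun h => by linarith [pi_pos])
        (Ioo_subset_Icc_self hs) (Ioo_subset_Icc_self ht)
  · obtain ⟨K, N₀, σ, R, h, hmem, hsurj⟩ := exists_turnMatch hp
    obtain ⟨N₁, hN₁, H₁⟩ := h.turnDist_le_extendRel hp hq
    obtain ⟨N₂, -, H₂⟩ := h.symm.turnDist_le_extendRel hp hq
    obtain ⟨L₁, hL₁, H₁⟩ := H₁ (max N₁ N₂) (le_max_left _ _)
    obtain ⟨L₂, hL₂, H₂⟩ := H₂ (max N₁ N₂) (le_max_right _ _)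
    have hB : N₀ ≤ max N₁ N₂ := hN₁.le.trans (le_max_left _ _)
    refine ⟨extendRel (max N₁ N₂) R, max L₁ L₂, lt_max_of_lt_left hL₁, ?_, ?_, ?_, ?_⟩
    · rintro N s s' (⟨-, rfl, hs⟩ | ⟨-, hr⟩)
      · exact ⟨hs, hs⟩
      · exact hmem N s s' hr
    · intro N s hs
      rcases lt_or_ge N (max N₁ N₂) with hN | hN
      · exact ⟨s, Or.inl ⟨hN, rfl, hs⟩⟩
      · obtain ⟨s', hr⟩ := (hsurj N (hB.trans hN)).1 s hs
        exact ⟨s', Or.inr ⟨hN, hr⟩⟩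
    · intro N s' hs'
      rcases lt_or_ge N (max N₁ N₂) with hN | hN
      · exact ⟨s', Or.inl ⟨hN, rfl, hs'⟩⟩
      · obtain ⟨s, hr⟩ := (hsurj N (hB.trans hN)).2 s' hs'
        exact ⟨s, Or.inr ⟨hN, hr⟩⟩
    · intro N M s s' t t' hN hNM hs ht
      refine ⟨(H₁ N M s s' t t' hN hNM hs ht).trans ?_,
        (H₂ N M s' s t' t hN hNM (extendRel_symm hs) (extendRel_symm ht)).trans ?_⟩
      · exact mul_le_mul_of_nonneg_right (le_max_left _ _)
          (add_nonneg (abs_nonneg _) (abs_nonneg _))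
      · exact mul_le_mul_of_nonneg_right (le_max_right _ _)
          (add_nonneg (abs_nonneg _) (abs_nonneg _))

lemma exists_bilipschitz_bijOn_of_relation {α β : Type*} [MetricSpace α] [MetricSpace β]
    [Nonempty β] {A : Set α} {B : Set β} {ρ : α → β → Prop} {L : ℝ} (hL : 1 ≤ L)
    (hB : ∀ x y, ρ x y → y ∈ B) (hA : ∀ x y, ρ x y → x ∈ A)
    (htot : ∀ x ∈ A, ∃ y, ρ x y) (hsurj : ∀ y ∈ B, ∃ x, ρ x y)
    (hle : ∀ x y x' y', ρ x x' → ρ y y' → dist x' y' ≤ L * dist x y)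
    (hle' : ∀ x y x' y', ρ x x' → ρ y y' → dist x y ≤ L * dist x' y') :
    ∃ g : α → β, BijOn g A B ∧ ∀ x ∈ A, ∀ y ∈ A,
      (1 / L) * dist x y ≤ dist (g x) (g y) ∧ dist (g x) (g y) ≤ L * dist x y := by
  classical
  choose! g hg using htot
  refine ⟨g, ⟨fun x hx => hB _ _ (hg x hx), ?_, ?_⟩, fun x hx y hy => ⟨?_, ?_⟩⟩
  · intro x hx y hy hxy
    have := hle' _ _ _ _ (hg x hx) (hg y hy)
    rw [hxy, dist_self, mul_zero] at this
    exact dist_le_zero.1 this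
  · intro y hy
    obtain ⟨x, hxy⟩ := hsurj y hy
    have hx := hA _ _ hxy
    refine ⟨x, hx, ?_⟩
    have := hle _ _ _ _ (hg x hx) hxy
    rw [dist_self, mul_zero] at this
    exact dist_le_zero.1 this
  · have := hle' _ _ _ _ (hg x hx) (hg y hy)
    rw [one_div, inv_mul_le_iff₀ (by linarith)]
    exact this
  · exact hle _ _ _ _ (hg x hx) (hg y hy)

lemma turnPoint_re_neg_iff {p q l N s : ℝ} (hr : 0 < turnRadius l N s) :
    (turnPoint p q l N s).re < 0 ↔ 0 < cos s := by
  simp [turnPoint, turnX, rpow_pos_of_pos hr, Complex.cos_ofReal_re]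

/-- Every angle with negative cosine is an angle of one of the turns. -/
lemma exists_turn_of_cos_neg {t : ℝ} (ht : 0 < t) (hcos : cos t < 0) :
    ∃ n : ℕ, 1 ≤ n ∧ t - 2 * π * n + π ∈ Ioo (-(π / 2)) (π / 2) := by
  have hπ := pi_pos
  have h0 : 0 ≤ t / (2 * π) := by positivity
  have h1 := Nat.floor_le h0
  have h2 := Nat.lt_floor_add_one (t / (2 * π))
  set m := ⌊t / (2 * π)⌋₊
  rw [le_div_iff₀ (by positivity)] at h1
  rw [div_lt_iff₀ (by positivity)] at h2
  have hc : cos (t - m * (2 * π)) < 0 := by rwa [cos_sub_nat_mul_two_pi]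
  refine ⟨m + 1, by omega, ?_, ?_⟩
  · by_contra! h
    push_cast at h
    exact hc.not_ge (cos_nonneg_of_mem_Icc ⟨by linarith, by linarith⟩)
  · by_contra! h
    push_cast at h
    have : cos (t - m * (2 * π) - 2 * π) < 0 := by rwa [cos_sub_two_pi]
    exact this.not_ge (cos_nonneg_of_mem_Icc ⟨by linarith, by linarith⟩)

lemma mem_spiral_re_neg_iff {p q : ℝ} {z : ℂ} :
    z ∈ spiral p q ∩ {z : ℂ | z.re < 0} ↔
      ∃ n : ℕ, 1 ≤ n ∧ ∃ s ∈ Ioo (-(π / 2)) (π / 2), z = turnPoint p q 1 (2 * π * n) s := by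
  have hπ := pi_gt_three
  have key : ∀ (n : ℕ) (s : ℝ), turnPoint p q 1 (2 * π * n) s =
      ((s - π + n * (2 * π)) ^ (-p) * cos (s - π + n * (2 * π)) : ℝ) +
        ((s - π + n * (2 * π)) ^ (-q) * sin (s - π + n * (2 * π)) : ℝ) * Complex.I := by
    intro n s
    have hr : turnRadius 1 (2 * π * n) s = s - π + n * (2 * π) := by
      unfold turnRadius; ring
    rw [cos_add_nat_mul_two_pi, sin_add_nat_mul_two_pi, cos_sub_pi, sin_sub_pi]
    simp only [turnPoint, turnX, turnY, hr, mul_neg]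
  constructor
  · rintro ⟨⟨t, ht, rfl⟩, hre⟩
    have hcos : cos t < 0 := by
      have h0 : 0 < t ^ (-p) := rpow_pos_of_pos (by linarith) _
      have h1 : t ^ (-p) * cos t < 0 := by
        simpa [Complex.cos_ofReal_re] using hre
      by_contra! h
      exact h1.not_ge (mul_nonneg h0.le h)
    obtain ⟨n, hn, hs⟩ := exists_turn_of_cos_neg (by linarith) hcos
    refine ⟨n, hn, _, hs, ?_⟩
    rw [key]
    have : t - 2 * π * n + π - π + n * (2 * π) = t := by ring
    rw [this]
  · rintro ⟨n, hn, s, hs, rfl⟩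
    have hn' : (1 : ℝ) ≤ n := by exact_mod_cast hn
    have hN : 2 * π ≤ 2 * π * n := le_mul_of_one_le_right (by linarith) hn'
    refine ⟨⟨s - π + n * (2 * π), by linarith [hs.1], key n s⟩, ?_⟩
    have := one_le_turnRadius le_rfl hN (Ioo_subset_Icc_self hs)
    exact (turnPoint_re_neg_iff (by linarith)).2 (cos_pos_of_mem_Ioo hs)

lemma mem_ellipses_re_neg_iff {p q : ℝ} {z : ℂ} :
    z ∈ ellipses p q ∩ {z : ℂ | z.re < 0} ↔
      ∃ n : ℕ, 1 ≤ n ∧ ∃ s ∈ Ioo (-(π / 2)) (π / 2), z = turnPoint p q 0 (2 * π * n) s := by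
  have hπ := pi_pos
  have key : ∀ (n : ℕ) (s : ℝ), turnPoint p q 0 (2 * π * n) s =
      ((2 * π * n) ^ (-p) * cos (s + π) : ℝ) +
        ((2 * π * n) ^ (-q) * sin (s + π) : ℝ) * Complex.I := by
    intro n s
    rw [cos_add_pi, sin_add_pi]
    simp only [turnPoint, turnX, turnY, turnRadius, zero_mul, add_zero, mul_neg]
  constructor
  · rintro ⟨⟨n, hn, t, ht0, ht1, rfl⟩, hre⟩
    have hn' : (1 : ℝ) ≤ n := by exact_mod_cast hn
    have hcos : cos t < 0 := by
      have h0 : 0 < (2 * π * n) ^ (-p) := rpow_pos_of_pos (by positivity) _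
      have h1 : (2 * π * n) ^ (-p) * cos t < 0 := by
        simpa [Complex.cos_ofReal_re] using hre
      by_contra! h
      exact h1.not_ge (mul_nonneg h0.le h)
    refine ⟨n, hn, t - π, ⟨?_, ?_⟩, ?_⟩
    · by_contra! h
      exact hcos.not_ge (cos_nonneg_of_mem_Icc ⟨by linarith, by linarith⟩)
    · by_contra! h
      rw [← cos_sub_two_pi] at hcos
      exact hcos.not_ge (cos_nonneg_of_mem_Icc ⟨by linarith, by linarith⟩)
    · rw [key, sub_add_cancel]
  · rintro ⟨n, hn, s, hs, rfl⟩
    have hn' : (1 : ℝ) ≤ n := by exact_mod_cast hn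
    have hN : 2 * π ≤ 2 * π * n := le_mul_of_one_le_right (by linarith) hn'
    refine ⟨⟨n, hn, s + π, by linarith [hs.1], by linarith [hs.2], key n s⟩, ?_⟩
    have := one_le_turnRadius zero_le_one hN (Ioo_subset_Icc_self hs)
    exact (turnPoint_re_neg_iff (by linarith)).2 (cos_pos_of_mem_Ioo hs)

end SpiralTurns

theorem spiral_biLipschitz_ellipses (p q : ℝ) (hp : 0 < p) (hpq : p ≤ q) :
    ∃ (g : ℂ → ℂ) (L : ℝ), 1 ≤ L ∧
      Set.BijOn g (spiral p q ∩ {z : ℂ | z.re < 0}) (ellipses p q ∩ {z : ℂ | z.re < 0}) ∧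
      ∀ x ∈ spiral p q ∩ {z : ℂ | z.re < 0}, ∀ y ∈ spiral p q ∩ {z : ℂ | z.re < 0},
        (1 / L) * dist x y ≤ dist (g x) (g y) ∧ dist (g x) (g y) ≤ L * dist x y := by
  obtain ⟨R, L, hL, hmem, htot, hsurj, H⟩ := exists_bilipschitz_relation hp hpq
  have hπ := Real.pi_pos
  let ρ : ℂ → ℂ → Prop := fun z w => ∃ n : ℕ, 1 ≤ n ∧ ∃ s s', R (2 * Real.pi * n) s s' ∧
    z = turnPoint p q 1 (2 * Real.pi * n) s ∧ w = turnPoint p q 0 (2 * Real.pi * n) s'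
  have hdist : ∀ x y x' y', ρ x x' → ρ y y' →
      dist x' y' ≤ (1 + 2 * L) * dist x y ∧ dist x y ≤ (1 + 2 * L) * dist x' y' := by
    rintro _ _ _ _ ⟨n, hn, s, s', hs, rfl, rfl⟩ ⟨m, hm, t, t', ht, rfl, rfl⟩
    have hturn : turnDist p q 0 (2 * Real.pi * n) s' (2 * Real.pi * m) t' ≤
          L * turnDist p q 1 (2 * Real.pi * n) s (2 * Real.pi * m) t ∧
        turnDist p q 1 (2 * Real.pi * n) s (2 * Real.pi * m) t ≤
          L * turnDist p q 0 (2 * Real.pi * n) s' (2 * Real.pi * m) t' := by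
      have hone : ∀ k : ℕ, 1 ≤ k → 2 * Real.pi ≤ 2 * Real.pi * k := fun k hk =>
        le_mul_of_one_le_right (by linarith) (by exact_mod_cast hk)
      have hgap : ∀ i j : ℕ, i < j → 2 * Real.pi * i + 2 * Real.pi ≤ 2 * Real.pi * j := by
        intro i j hij
        have : (i : ℝ) + 1 ≤ j := by exact_mod_cast hij
        nlinarith
      rcases lt_trichotomy n m with h | rfl | h
      · exact H _ _ s s' t t' (hone n hn) (Or.inr (hgap n m h)) hs ht
      · exact H _ _ s s' t t' (hone n hn) (Or.inl rfl) hs ht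
      · have := H _ _ t t' s s' (hone m hm) (Or.inr (hgap m n h)) ht hs
        rwa [turnDist_comm p q 0, turnDist_comm p q 1] at this
    constructor
    · calc _ ≤ _ := dist_turnPoint_le p q 0 _ _ _ _
        _ ≤ _ := hturn.1
        _ ≤ L * (2 * _) := mul_le_mul_of_nonneg_left (turnDist_le p q 1 _ _ _ _) hL.le
        _ ≤ _ := (mul_assoc L 2 _).symm.trans_le
            (mul_le_mul_of_nonneg_right (by linarith) dist_nonneg)
    · calc _ ≤ _ := dist_turnPoint_le p q 1 _ _ _ _
        _ ≤ _ := hturn.2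
        _ ≤ L * (2 * _) := mul_le_mul_of_nonneg_left (turnDist_le p q 0 _ _ _ _) hL.le
        _ ≤ _ := (mul_assoc L 2 _).symm.trans_le
            (mul_le_mul_of_nonneg_right (by linarith) dist_nonneg)
  suffices h : ∃ g : ℂ → ℂ,
      BijOn g (spiral p q ∩ {z : ℂ | z.re < 0}) (ellipses p q ∩ {z : ℂ | z.re < 0}) ∧
      ∀ x ∈ spiral p q ∩ {z : ℂ | z.re < 0}, ∀ y ∈ spiral p q ∩ {z : ℂ | z.re < 0},
        (1 / (1 + 2 * L)) * dist x y ≤ dist (g x) (g y) ∧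
          dist (g x) (g y) ≤ (1 + 2 * L) * dist x y by
    obtain ⟨g, hg⟩ := h
    exact ⟨g, 1 + 2 * L, by linarith, hg⟩
  refine exists_bilipschitz_bijOn_of_relation (ρ := ρ) (by linarith) ?_ ?_ ?_ ?_
    (fun x y x' y' hx hy => (hdist x y x' y' hx hy).1)
    (fun x y x' y' hx hy => (hdist x y x' y' hx hy).2)
  · rintro x y ⟨n, hn, s, s', hr, rfl, rfl⟩
    exact mem_ellipses_re_neg_iff.2 ⟨n, hn, s', (hmem _ _ _ hr).2, rfl⟩
  · rintro x y ⟨n, hn, s, s', hr, rfl, rfl⟩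
    exact mem_spiral_re_neg_iff.2 ⟨n, hn, s, (hmem _ _ _ hr).1, rfl⟩
  · intro x hx
    obtain ⟨n, hn, s, hs, rfl⟩ := mem_spiral_re_neg_iff.1 hx
    obtain ⟨s', hr⟩ := htot (2 * Real.pi * n) s hs
    exact ⟨_, n, hn, s, s', hr, rfl, rfl⟩
  · intro y hy
    obtain ⟨n, hn, s', hs', rfl⟩ := mem_ellipses_re_neg_iff.1 hy
    obtain ⟨s, hr⟩ := hsurj (2 * Real.pi * n) s' hs'
    exact ⟨_, n, hn, s, s', hr, rfl, rfl⟩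
end

section
/- Let 0 < p ≤ q with p ≤ 1 and 0 < r ≤ s with r ≤ 1. If f : S_{p,q} → S_{r,s} is a surjective α-Hölder map, then α ≤ (2+q−p)(1+s) / ((2+s−r)(1+q)). -/
open Set Metric MeasureTheory

/-- `f` is `α`-Hölder on the set `A`. -/
def HolderOnSet (f : ℂ → ℂ) (α : ℝ) (A : Set ℂ) : Prop :=
  ∃ c : ℝ, 0 < c ∧ ∀ x ∈ A, ∀ y ∈ A, dist (f x) (f y) ≤ c * dist x y ^ α

theorem exists_finset_net {ι κ X : Type*} [PseudoMetricSpace X] {B : Set ι} {g : ι → X}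
    {l : ι → κ} {S : Finset κ} {δ : ℝ} (hS : ∀ i ∈ B, l i ∈ S)
    (h : ∀ i ∈ B, ∀ j ∈ B, l i = l j → dist (g i) (g j) ≤ δ) :
    ∃ F : Finset ι, (∀ i ∈ F, i ∈ B) ∧ F.card ≤ S.card ∧
      ∀ i ∈ B, ∃ j ∈ F, dist (g i) (g j) ≤ δ := by
  obtain ⟨B', hB', hbij⟩ := Set.exists_subset_bijOn B l
  have hmaps : MapsTo l B' S := fun i hi => hS i (hB' hi)
  have hfin : B'.Finite := Finite.of_injOn hmaps hbij.injOn S.finite_toSet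
  refine ⟨hfin.toFinset, fun i hi => hB' (hfin.mem_toFinset.1 hi),
    Finset.card_le_card_of_injOn l (by simpa using hmaps) (by simpa using hbij.injOn), ?_⟩
  intro i hi
  obtain ⟨j, hj, hji⟩ := hbij.surjOn (mem_image_of_mem l hi)
  exact ⟨j, hfin.mem_toFinset.2 hj, h i hi j (hB' hj) hji.symm⟩

theorem abs_rpow_mul_comp_rpow_sub_le {a g : ℝ} (ha : 0 ≤ a) (hg : 0 ≤ g) (hag : g - 1 ≤ a)
    {φ φ' : ℝ → ℝ} (hφ : ∀ x, HasDerivAt φ (φ' x) x) (hb : ∀ x, |φ x| ≤ 1)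
    (hb' : ∀ x, |φ' x| ≤ 1) {σ τ : ℝ} (hσ : 1 ≤ σ) (hτ : 1 ≤ τ) :
    |τ ^ (-a) * φ (τ ^ g) - σ ^ (-a) * φ (σ ^ g)| ≤ (a + g) * |τ - σ| := by
  have key := (convex_Ici (1 : ℝ)).norm_image_sub_le_of_norm_hasDerivWithin_le
    (f := fun t : ℝ => t ^ (-a) * φ (t ^ g))
    (f' := fun t => (-a * t ^ (-a - 1)) * φ (t ^ g) + t ^ (-a) * (φ' (t ^ g) * (g * t ^ (g - 1))))
    (C := a + g) (fun t ht => ?_) (fun t ht => ?_) hσ hτ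
  · simpa only [Real.norm_eq_abs] using key
  · have h0 : t ≠ 0 := by have : (1 : ℝ) ≤ t := ht; positivity
    exact ((Real.hasDerivAt_rpow_const (Or.inl h0)).mul
      ((hφ _).comp t (Real.hasDerivAt_rpow_const (Or.inl h0)))).hasDerivWithinAt
  · have ht : (1 : ℝ) ≤ t := ht
    have h0 : 0 < t := by linarith
    rw [Real.norm_eq_abs]
    refine (abs_add_le _ _).trans (add_le_add ?_ ?_)
    · rw [abs_mul, abs_mul, abs_neg, abs_of_nonneg ha, abs_of_nonneg (Real.rpow_nonneg h0.le _)]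
      have h1 : t ^ (-a - 1) ≤ 1 := Real.rpow_le_one_of_one_le_of_nonpos ht (by linarith)
      calc a * t ^ (-a - 1) * |φ (t ^ g)| ≤ a * 1 * 1 := by
            gcongr
            exact hb _
        _ = a := by ring
    · have h1 : t ^ (-a) * t ^ (g - 1) ≤ 1 := by
        rw [← Real.rpow_add h0]
        exact Real.rpow_le_one_of_one_le_of_nonpos ht (by linarith)
      rw [abs_mul, abs_mul, abs_mul, abs_of_nonneg hg, abs_of_nonneg (Real.rpow_nonneg h0.le _),
        abs_of_nonneg (Real.rpow_nonneg h0.le _)]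
      calc t ^ (-a) * (|φ' (t ^ g)| * (g * t ^ (g - 1)))
          = (t ^ (-a) * t ^ (g - 1)) * g * |φ' (t ^ g)| := by ring
        _ ≤ 1 * g * 1 := by
            gcongr
            exact hb' _
        _ = g := by ring

theorem abs_rpow_sub_rpow_le {e M u v : ℝ} (he : e ≤ 0) (hM : 0 < M) (hu : M ≤ u) (hv : M ≤ v) :
    |u ^ e - v ^ e| ≤ -e * M ^ (e - 1) * |u - v| := by
  have key := (convex_Ici M).norm_image_sub_le_of_norm_hasDerivWithin_le
    (f := fun t : ℝ => t ^ e) (f' := fun t => e * t ^ (e - 1))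
    (C := -e * M ^ (e - 1)) (fun t ht => ?_) (fun t ht => ?_) hv hu
  · simpa only [Real.norm_eq_abs] using key
  · have h0 : t ≠ 0 := (hM.trans_le ht).ne'
    exact (Real.hasDerivAt_rpow_const (Or.inl h0)).hasDerivWithinAt
  · have h0 : 0 < t := hM.trans_le ht
    rw [Real.norm_eq_abs, abs_mul, abs_of_nonpos he, abs_of_nonneg (Real.rpow_nonneg h0.le _)]
    exact mul_le_mul_of_nonneg_left
      (Real.rpow_le_rpow_of_nonpos hM ht (by linarith)) (by linarith)

theorem exists_spiral_param_near {r s b c T x y : ℝ} (hr : 0 < r) (hrs : r ≤ s)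
    (hcr : c ≤ 2 ^ (-r)) (hbc : b ^ 2 + c ^ 2 ≤ 1) (hT : 10 ≤ T)
    (hx0 : 0 ≤ x) (hx : x ≤ c * T ^ (-r)) (hy0 : (2 * T) ^ (-s) ≤ y) (hy : y ≤ b * T ^ (-s)) :
    ∃ t, 1 < t ∧ t ^ (-r) * Real.cos t = x ∧ |y - t ^ (-s) * Real.sin t| ≤
      2 ^ s * (28 * s * 4 ^ (1 + 2 * s)) * T ^ (-1 - s) := by
  have hT0 : 0 < T := by linarith
  have hs : 0 < s := hr.trans_le hrs
  have hy00 : 0 < y := (by positivity : 0 < (2 * T) ^ (-s)).trans_le hy0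
  set G : ℝ → ℝ := fun u => u ^ (-2 * s) - x ^ 2 * u ^ (2 * r - 2 * s) with hG
  have sq_rpow : ∀ (w a : ℝ), 0 < w → (w ^ a) ^ 2 = w ^ (2 * a) := fun w a hw => by
    rw [← Real.rpow_natCast, ← Real.rpow_mul hw.le]; congr 1; push_cast; ring
  have hx2 : x ^ 2 ≤ c ^ 2 * T ^ (-2 * r) := by
    calc x ^ 2 ≤ (c * T ^ (-r)) ^ 2 := by gcongr
      _ = c ^ 2 * T ^ (-2 * r) := by rw [mul_pow, sq_rpow _ _ hT0]; ring_nf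
  have hcont : ContinuousOn G (Icc T (2 * T)) := by
    have hne : ∀ u ∈ Icc T (2 * T), u ≠ 0 := fun u hu => (hT0.trans_le hu.1).ne'
    exact (continuousOn_id.rpow_const fun u hu => Or.inl (hne u hu)).sub
      (continuousOn_const.mul (continuousOn_id.rpow_const fun u hu => Or.inl (hne u hu)))
  obtain ⟨u, hu, hGu⟩ : ∃ u ∈ Icc T (2 * T), G u = y ^ 2 := by
    refine intermediate_value_Icc' (by linarith) hcont ⟨?_, ?_⟩
    · calc G (2 * T) ≤ (2 * T) ^ (-2 * s) := by
            simp only [hG]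
            have : 0 ≤ x ^ 2 * (2 * T) ^ (2 * r - 2 * s) := by positivity
            linarith
        _ = ((2 * T) ^ (-s)) ^ 2 := by rw [sq_rpow _ _ (by positivity)]; ring_nf
        _ ≤ y ^ 2 := by gcongr
    · have h1 : y ^ 2 ≤ b ^ 2 * T ^ (-2 * s) := by
        calc y ^ 2 ≤ (b * T ^ (-s)) ^ 2 := by gcongr
          _ = b ^ 2 * T ^ (-2 * s) := by rw [mul_pow, sq_rpow _ _ hT0]; ring_nf
      have h2 : x ^ 2 * T ^ (2 * r - 2 * s) ≤ c ^ 2 * T ^ (-2 * s) := by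
        calc x ^ 2 * T ^ (2 * r - 2 * s) ≤ c ^ 2 * T ^ (-2 * r) * T ^ (2 * r - 2 * s) := by gcongr
          _ = c ^ 2 * T ^ (-2 * s) := by rw [mul_assoc, ← Real.rpow_add hT0]; ring_nf
      have h3 : (b ^ 2 + c ^ 2) * T ^ (-2 * s) ≤ 1 * T ^ (-2 * s) := by gcongr
      simp only [hG]
      linarith
  have hπ := Real.pi_pos
  have hπ' := Real.pi_lt_d2
  set k : ℕ := ⌊u / (2 * Real.pi)⌋₊
  have hk1 : (k : ℝ) * (2 * Real.pi) ≤ u :=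
    (le_div_iff₀ (by positivity)).1 (Nat.floor_le (div_nonneg (by linarith [hu.1]) (by positivity)))
  have hk2 : u < (k + 1 : ℝ) * (2 * Real.pi) :=
    (div_lt_iff₀ (by positivity)).1 (Nat.lt_floor_add_one _)
  set v : ℝ := k * (2 * Real.pi) with hv
  have hvu : u < v + 2 * Real.pi := by linarith
  have hvT : T / 4 ≤ v := by linarith [hu.1]
  have hv0 : 0 < v := by linarith
  have hcosv : Real.cos v = 1 := Real.cos_nat_mul_two_pi k
  obtain ⟨t, ht, htx⟩ : ∃ t ∈ Icc v (v + Real.pi), t ^ (-r) * Real.cos t = x := by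
    refine intermediate_value_Icc' (by linarith) ?_ ⟨?_, ?_⟩
    · exact (continuousOn_id.rpow_const fun t ht => Or.inl (hv0.trans_le ht.1).ne').mul
        Real.continuous_cos.continuousOn
    · rw [Real.cos_add_pi, hcosv]
      have : 0 ≤ (v + Real.pi) ^ (-r) := by positivity
      linarith
    · rw [hcosv, mul_one]
      calc x ≤ c * T ^ (-r) := hx
        _ ≤ 2 ^ (-r) * T ^ (-r) := by gcongr
        _ = (2 * T) ^ (-r) := (Real.mul_rpow (by norm_num) hT0.le).symm
        _ ≤ v ^ (-r) := Real.rpow_le_rpow_of_nonpos hv0 (hk1.trans hu.2) (by linarith)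
  have ht0 : 0 < t := hv0.trans_le ht.1
  have htT : T / 4 ≤ t := hvT.trans ht.1
  have huT : T / 4 ≤ u := by linarith [hu.1]
  have hsin : 0 ≤ Real.sin t := by
    have h := Real.sin_nonneg_of_nonneg_of_le_pi (x := t - v) (by linarith [ht.1])
      (by linarith [ht.2])
    rwa [hv, Real.sin_sub_nat_mul_two_pi] at h
  set Y : ℝ := t ^ (-s) * Real.sin t
  have hY0 : 0 ≤ Y := by positivity
  have hGt : G t = Y ^ 2 := by
    simp only [hG, Y, ← htx]
    rw [mul_pow, mul_pow, sq_rpow _ _ ht0, sq_rpow _ _ ht0, Real.sin_sq, mul_right_comm,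
      ← Real.rpow_add ht0]
    ring_nf
  have hut : |u - t| ≤ 7 := abs_le.2 ⟨by linarith [ht.2], by linarith [ht.1]⟩
  have pow4 : ∀ a : ℝ, (T / 4) ^ (-a) = 4 ^ a * T ^ (-a) := fun a => by
    rw [Real.div_rpow hT0.le (by norm_num), Real.rpow_neg (by norm_num : (0 : ℝ) ≤ 4), div_inv_eq_mul,
      mul_comm]
  have hd1 : |u ^ (-2 * s) - t ^ (-2 * s)| ≤ 14 * s * 4 ^ (1 + 2 * s) * T ^ (-1 - 2 * s) := by
    calc _ ≤ -(-2 * s) * (T / 4) ^ (-2 * s - 1) * |u - t| :=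
          abs_rpow_sub_rpow_le (by linarith) (by positivity) huT htT
      _ ≤ -(-2 * s) * (T / 4) ^ (-2 * s - 1) * 7 := by
          have : 0 ≤ -(-2 * s) := by linarith
          gcongr
      _ = _ := by
          rw [show -2 * s - 1 = -(1 + 2 * s) by ring, pow4,
            show -1 - 2 * s = -(1 + 2 * s) by ring]
          ring
  have hd2 : x ^ 2 * |u ^ (2 * r - 2 * s) - t ^ (2 * r - 2 * s)| ≤
      14 * s * 4 ^ (1 + 2 * s) * T ^ (-1 - 2 * s) := by
    have hc1 : c ^ 2 ≤ 1 := by nlinarith [sq_nonneg b]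
    calc _ ≤ x ^ 2 * (-(2 * r - 2 * s) * (T / 4) ^ (2 * r - 2 * s - 1) * |u - t|) := by
          gcongr
          exact abs_rpow_sub_rpow_le (by linarith) (by positivity) huT htT
      _ ≤ (1 * T ^ (-2 * r)) * ((2 * s) * (T / 4) ^ (2 * r - 2 * s - 1) * 7) := by
          have : 0 ≤ -(2 * r - 2 * s) := by linarith
          gcongr
          · exact hx2.trans (by gcongr)
          · linarith
      _ = 14 * s * 4 ^ (1 + 2 * s - 2 * r) * (T ^ (-2 * r) * T ^ (2 * r - 2 * s - 1)) := by
          rw [show 2 * r - 2 * s - 1 = -(1 + 2 * s - 2 * r) by ring, pow4]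
          ring
      _ = 14 * s * 4 ^ (1 + 2 * s - 2 * r) * T ^ (-1 - 2 * s) := by
          rw [← Real.rpow_add hT0]; ring_nf
      _ ≤ _ := by
          gcongr
          · norm_num
          · linarith
  have hd : |y ^ 2 - Y ^ 2| ≤ 28 * s * 4 ^ (1 + 2 * s) * T ^ (-1 - 2 * s) := by
    rw [← hGu, ← hGt]
    calc |G u - G t| = |(u ^ (-2 * s) - t ^ (-2 * s)) -
          x ^ 2 * (u ^ (2 * r - 2 * s) - t ^ (2 * r - 2 * s))| := by simp only [hG]; ring_nf
      _ ≤ |u ^ (-2 * s) - t ^ (-2 * s)| +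
          |x ^ 2 * (u ^ (2 * r - 2 * s) - t ^ (2 * r - 2 * s))| := abs_sub _ _
      _ ≤ _ := by rw [abs_mul, abs_of_nonneg (sq_nonneg x)]; linarith
  refine ⟨t, by linarith, htx, ?_⟩
  have hfac : |y - Y| * (2 * T) ^ (-s) ≤ |y ^ 2 - Y ^ 2| := by
    rw [sq_sub_sq, abs_mul, mul_comm]
    gcongr
    rw [abs_of_nonneg (by linarith)]
    linarith
  have h2T : (2 * T) ^ (-s) * (2 ^ s * T ^ s) = 1 := by
    rw [← Real.mul_rpow (by norm_num) hT0.le, ← Real.rpow_add (by positivity)]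
    simp
  calc |y - Y| = |y - Y| * (2 * T) ^ (-s) * (2 ^ s * T ^ s) := by rw [mul_assoc, h2T, mul_one]
    _ ≤ (28 * s * 4 ^ (1 + 2 * s) * T ^ (-1 - 2 * s)) * (2 ^ s * T ^ s) :=
        mul_le_mul_of_nonneg_right (hfac.trans hd) (by positivity)
    _ = 2 ^ s * (28 * s * 4 ^ (1 + 2 * s)) * (T ^ (-1 - 2 * s) * T ^ s) := by ring
    _ = _ := by rw [← Real.rpow_add hT0]; ring_nf

theorem dist_re_add_im_le (a b c d : ℝ) :
    dist ((a : ℂ) + (b : ℂ) * Complex.I) ((c : ℂ) + (d : ℂ) * Complex.I) ≤ |a - c| + |b - d| := by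
  rw [dist_eq_norm]
  simpa using Complex.norm_le_abs_re_add_abs_im
    (((a : ℂ) + (b : ℂ) * Complex.I) - ((c : ℂ) + (d : ℂ) * Complex.I))

theorem exists_volume_le_near_spiral {r s : ℝ} (hr : 0 < r) (hrs : r ≤ s) :
    ∃ κ C : ℝ, 0 < κ ∧ 0 < C ∧ ∀ T : ℝ, 10 ≤ T → ∃ E : Set ℂ,
      ENNReal.ofReal (κ * T ^ (-r - s)) ≤ volume E ∧
        ∀ z ∈ E, ∃ w ∈ spiral r s, dist z w ≤ C * T ^ (-1 - s) := by
  have hs : 0 < s := hr.trans_le hrs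
  have h2s : (2 : ℝ) ^ (-s) < 1 := Real.rpow_lt_one_of_one_lt_of_neg (by norm_num) (by linarith)
  have h2s0 : (0 : ℝ) < 2 ^ (-s) := by positivity
  obtain ⟨b, hb0, hb1⟩ := exists_between h2s
  have hb2 : 0 < 1 - b ^ 2 := by nlinarith
  obtain ⟨c, hc0, hcr, hbc⟩ : ∃ c : ℝ, 0 < c ∧ c ≤ 2 ^ (-r) ∧ b ^ 2 + c ^ 2 ≤ 1 := by
    refine ⟨min (2 ^ (-r)) √(1 - b ^ 2), lt_min (by positivity) (Real.sqrt_pos.2 hb2),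
      min_le_left _ _, ?_⟩
    have : min (2 ^ (-r)) √(1 - b ^ 2) ^ 2 ≤ √(1 - b ^ 2) ^ 2 := by
      gcongr
      exact min_le_right _ _
    rw [Real.sq_sqrt hb2.le] at this
    linarith
  refine ⟨c * (b - 2 ^ (-s)), 2 ^ s * (28 * s * 4 ^ (1 + 2 * s)), mul_pos hc0 (by linarith),
    by positivity, fun T hT => ?_⟩
  have hT0 : 0 < T := by linarith
  refine ⟨Complex.measurableEquivRealProd ⁻¹'
    (Icc 0 (c * T ^ (-r)) ×ˢ Icc ((2 * T) ^ (-s)) (b * T ^ (-s))), ?_, ?_⟩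
  · rw [Complex.volume_preserving_equiv_real_prod.measure_preimage
      (measurableSet_Icc.prod measurableSet_Icc).nullMeasurableSet, Measure.volume_eq_prod,
      Measure.prod_prod, Real.volume_Icc, Real.volume_Icc, ← ENNReal.ofReal_mul (by rw [sub_zero]; positivity),
      Real.mul_rpow (by norm_num) hT0.le, sub_eq_add_neg (-r) s, Real.rpow_add hT0]
    exact (congrArg ENNReal.ofReal (by ring)).le
  · rintro z ⟨⟨hx0, hx⟩, hy0, hy⟩
    obtain ⟨t, ht, htx, hty⟩ := exists_spiral_param_near hr hrs hcr hbc hT hx0 hx hy0 hy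
    refine ⟨_, ⟨t, ht, rfl⟩, ?_⟩
    rw [htx]
    conv_lhs => rw [← Complex.re_add_im z]
    refine (dist_re_add_im_le _ _ _ _).trans ?_
    simpa using hty

theorem exists_spiral_net {p q ε : ℝ} (hp : 0 < p) (hpq : p ≤ q) (hp1 : p ≤ 1) (hε : 0 < ε) :
    ∃ L : ℝ, 0 < L ∧ ∀ X : ℝ, 1 ≤ X → ∃ F : Finset ℂ, (∀ z ∈ F, z ∈ spiral p q) ∧
      (F.card : ℝ) ≤ 27 * X ^ (2 + q - p + ε) ∧
        ∀ z ∈ spiral p q, ∃ w ∈ F, dist z w ≤ L * X ^ (-(1 + q)) := by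
  set β := 1 - p + ε with hβ
  have hβ0 : 0 < β := by linarith
  have hq : 0 < q := hp.trans_le hpq
  refine ⟨(p / β + 1 / β) + (q / β + 1 / β) + 2, by positivity, fun X hX => ?_⟩
  have hX0 : 0 < X := by linarith
  set P : ℝ → ℂ := fun t =>
    (t ^ (-p) * Real.cos t : ℝ) + (t ^ (-q) * Real.sin t : ℝ) * Complex.I with hP
  set D := X ^ (1 + q) with hD
  have hD0 : 0 < D := by positivity
  have hDinv : X ^ (-(1 + q)) = D⁻¹ := Real.rpow_neg hX0.le _
  set l : ℝ → ℕ ⊕ (ℤ × ℤ) := fun t => if t ≤ X then Sum.inl ⌊t ^ β * D⌋₊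
    else Sum.inr (⌊t ^ (-p) * Real.cos t * D⌋, ⌊t ^ (-q) * Real.sin t * D⌋) with hl
  set A : ℝ → ℤ := fun a => ⌈X ^ (1 + q - a)⌉ with hA
  set S : Finset (ℕ ⊕ (ℤ × ℤ)) := (Finset.range (⌊X ^ β * D⌋₊ + 1)).disjSum
    (Finset.Icc (-A p) (A p) ×ˢ Finset.Icc (-A q) (A q)) with hS
  have hfloor : ∀ a t u : ℝ, 0 < a → X ≤ t → |u| ≤ 1 →
      ⌊t ^ (-a) * u * D⌋ ∈ Finset.Icc (-A a) (A a) := by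
    intro a t u ha ht hu
    have h1 : |t ^ (-a) * u * D| ≤ X ^ (1 + q - a) := by
      rw [abs_mul, abs_mul, abs_of_pos hD0, abs_of_nonneg (Real.rpow_nonneg (hX0.le.trans ht) _)]
      have h : t ^ (-a) ≤ X ^ (-a) := Real.rpow_le_rpow_of_nonpos hX0 ht (by linarith)
      calc t ^ (-a) * |u| * D ≤ X ^ (-a) * 1 * D := by gcongr
        _ = X ^ (1 + q - a) := by
            rw [mul_one, hD, ← Real.rpow_add hX0]; ring_nf
    have h2 := abs_le.1 (h1.trans (Int.le_ceil _))
    rw [Finset.mem_Icc]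
    constructor
    · rw [Int.le_floor]
      push_cast
      exact h2.1
    · exact_mod_cast (Int.floor_le _).trans h2.2
  have hlS : ∀ t ∈ Ioi (1 : ℝ), l t ∈ S := by
    intro t ht
    have ht : 1 < t := ht
    by_cases htX : t ≤ X
    · simp only [hl, if_pos htX, hS, Finset.inl_mem_disjSum, Finset.mem_range]
      exact Nat.lt_succ_of_le (Nat.floor_le_floor (by gcongr))
    · simp only [hl, if_neg htX, hS, Finset.inr_mem_disjSum, Finset.mem_product]
      exact ⟨hfloor p t _ hp (le_of_not_ge htX) (Real.abs_cos_le_one t),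
        hfloor q t _ hq (le_of_not_ge htX) (Real.abs_sin_le_one t)⟩
  have hlip : ∀ a t u : ℝ, p ≤ a → 1 < t → 1 < u → ∀ φ φ' : ℝ → ℝ,
      (∀ x, HasDerivAt φ (φ' x) x) → (∀ x, |φ x| ≤ 1) → (∀ x, |φ' x| ≤ 1) →
      |t ^ (-a) * φ t - u ^ (-a) * φ u| ≤ (a / β + 1 / β) * |t ^ β - u ^ β| := by
    intro a t u ha ht hu φ φ' h1 h2 h3
    have key := abs_rpow_mul_comp_rpow_sub_le (a := a / β) (g := 1 / β)
      (div_nonneg (by linarith) hβ0.le) (by positivity)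
      (by rw [div_sub_one hβ0.ne']; gcongr; linarith) h1 h2 h3
      (Real.one_le_rpow hu.le hβ0.le) (Real.one_le_rpow ht.le hβ0.le)
    have e1 : ∀ w : ℝ, 1 < w → (w ^ β) ^ (-(a / β)) = w ^ (-a) := fun w hw => by
      rw [← Real.rpow_mul (by linarith)]; congr 1; field_simp
    have e2 : ∀ w : ℝ, 1 < w → (w ^ β) ^ (1 / β) = w := fun w hw => by
      rw [← Real.rpow_mul (by linarith), mul_one_div_cancel hβ0.ne', Real.rpow_one]
    rwa [e1 t ht, e1 u hu, e2 t ht, e2 u hu] at key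
  have hdist : ∀ t ∈ Ioi (1 : ℝ), ∀ u ∈ Ioi (1 : ℝ), l t = l u →
      dist (P t) (P u) ≤ ((p / β + 1 / β) + (q / β + 1 / β) + 2) * X ^ (-(1 + q)) := by
    intro t ht u hu htu
    have ht : 1 < t := ht
    have hu : 1 < u := hu
    have hsc : ∀ a b : ℝ, |a * D - b * D| ≤ 1 → |a - b| ≤ D⁻¹ := fun a b h => by
      rw [← sub_mul, abs_mul, abs_of_pos hD0] at h
      rwa [← one_div, le_div_iff₀ hD0]
    refine (dist_re_add_im_le _ _ _ _).trans ?_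
    rw [hDinv]
    have hk0 : 0 ≤ p / β + 1 / β := by positivity
    have hk1 : 0 ≤ q / β + 1 / β := by positivity
    have hDi : 0 < D⁻¹ := by positivity
    by_cases htX : t ≤ X <;> by_cases huX : u ≤ X
    · simp only [hl, if_pos htX, if_pos huX, Sum.inl.injEq] at htu
      have h : |t ^ β - u ^ β| ≤ D⁻¹ := by
        refine hsc _ _ (abs_le.2 ?_)
        have h1 := Nat.floor_le (a := t ^ β * D) (by positivity)
        have h2 := Nat.floor_le (a := u ^ β * D) (by positivity)
        have h3 := Nat.lt_floor_add_one (t ^ β * D)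
        have h4 := Nat.lt_floor_add_one (u ^ β * D)
        rw [htu] at h1 h3
        constructor <;> linarith
      have h1 := hlip p t u le_rfl ht hu Real.cos (fun x => -Real.sin x) Real.hasDerivAt_cos
        Real.abs_cos_le_one (fun x => by rw [abs_neg]; exact Real.abs_sin_le_one x)
      have h2 := hlip q t u hpq ht hu Real.sin Real.cos Real.hasDerivAt_sin
        Real.abs_sin_le_one Real.abs_cos_le_one
      have h3 := mul_le_mul_of_nonneg_left h hk0
      have h4 := mul_le_mul_of_nonneg_left h hk1
      linarith
    · simp [hl, if_pos htX, if_neg huX] at htu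
    · simp [hl, if_neg htX, if_pos huX] at htu
    · simp only [hl, if_neg htX, if_neg huX, Sum.inr.injEq, Prod.mk.injEq] at htu
      have h1 := hsc _ _ (Int.abs_sub_lt_one_of_floor_eq_floor htu.1).le
      have h2 := hsc _ _ (Int.abs_sub_lt_one_of_floor_eq_floor htu.2).le
      have h3 := mul_nonneg (add_nonneg hk0 hk1) hDi.le
      linarith
  have hcard : (S.card : ℝ) ≤ 27 * X ^ (2 + q - p + ε) := by
    have hA1 : ∀ a, a ≤ 1 + q → ((Finset.Icc (-A a) (A a)).card : ℝ) ≤ 5 * X ^ (1 + q - a) := by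
      intro a ha
      have h1 : 1 ≤ X ^ (1 + q - a) := Real.one_le_rpow hX (by linarith)
      have h2 : (A a : ℝ) < X ^ (1 + q - a) + 1 := Int.ceil_lt_add_one _
      have h3 : 0 ≤ A a := Int.ceil_nonneg (by positivity)
      have h4 : ((Finset.Icc (-A a) (A a)).card : ℤ) = 2 * A a + 1 := by
        rw [Int.card_Icc, Int.toNat_of_nonneg (by linarith)]; ring
      have h5 : ((Finset.Icc (-A a) (A a)).card : ℝ) = 2 * A a + 1 := by exact_mod_cast h4
      rw [h5]
      linarith
    have hB : (⌊X ^ β * D⌋₊ : ℝ) + 1 ≤ 2 * X ^ (2 + q - p + ε) := by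
      have h1 : (⌊X ^ β * D⌋₊ : ℝ) ≤ X ^ β * D := Nat.floor_le (by positivity)
      have h2 : X ^ β * D = X ^ (2 + q - p + ε) := by
        rw [hD, ← Real.rpow_add hX0, hβ]; ring_nf
      have h3 : 1 ≤ X ^ (2 + q - p + ε) := Real.one_le_rpow hX (by linarith)
      linarith
    have hC : ((Finset.Icc (-A p) (A p)).card : ℝ) * (Finset.Icc (-A q) (A q)).card ≤
        25 * X ^ (2 + q - p + ε) := by
      calc _ ≤ (5 * X ^ (1 + q - p)) * (5 * X ^ (1 + q - q)) := by
            gcongr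
            · exact hA1 p (by linarith)
            · exact hA1 q (by linarith)
        _ = 25 * X ^ (2 + q - p) := by
            rw [mul_mul_mul_comm, ← Real.rpow_add hX0]; ring_nf
        _ ≤ _ := by
            gcongr
            linarith
    rw [hS, Finset.card_disjSum, Finset.card_product, Finset.card_range]
    push_cast
    linarith
  obtain ⟨F, hFB, hFc, hF⟩ := exists_finset_net hlS hdist
  classical
  refine ⟨F.image P, ?_, ?_, ?_⟩
  · intro z hz
    obtain ⟨t, ht, rfl⟩ := Finset.mem_image.1 hz
    exact ⟨t, hFB t ht, rfl⟩
  · exact le_trans (by exact_mod_cast Finset.card_image_le.trans hFc) hcard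
  · rintro z ⟨t, ht, rfl⟩
    obtain ⟨u, hu, h⟩ := hF t ht
    exact ⟨P u, Finset.mem_image_of_mem P hu, h⟩

theorem le_card_mul_of_subset_closedBalls {F : Finset ℂ} {E : Set ℂ} {V ρ : ℝ} (g : ℂ → ℂ)
    (hρ : 0 ≤ ρ) (hV : ENNReal.ofReal V ≤ volume E) (hE : ∀ z ∈ E, ∃ w ∈ F, dist z (g w) ≤ ρ) :
    V ≤ F.card * (ρ ^ 2 * Real.pi) := by
  have h1 : E ⊆ ⋃ w ∈ F, closedBall (g w) ρ := fun z hz => by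
    obtain ⟨w, hw, h⟩ := hE z hz
    exact mem_biUnion hw h
  have h2 : volume E ≤ ENNReal.ofReal (F.card * (ρ ^ 2 * Real.pi)) := by
    refine (measure_mono h1).trans ((measure_biUnion_finset_le F _).trans ?_)
    simp only [Complex.volume_closedBall, Finset.sum_const, nsmul_eq_mul]
    rw [ENNReal.ofReal_mul (by positivity), ENNReal.ofReal_mul (by positivity),
      ENNReal.ofReal_pow hρ, ENNReal.ofReal_natCast, ← NNReal.coe_real_pi, ENNReal.ofReal_coe_nnreal]
  exact (ENNReal.ofReal_le_ofReal_iff (by positivity)).1 (hV.trans h2)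

theorem nonpos_of_rpow_bounded {a C : ℝ}
    (h : ∀ᶠ X : ℝ in Filter.atTop, X ^ a ≤ C) : a ≤ 0 := by
  by_contra! ha
  obtain ⟨X, h1, h2⟩ := (h.and ((tendsto_rpow_atTop ha).eventually_gt_atTop C)).exists
  linarith

theorem holder_exponent_bound_box (p q r s α : ℝ) (f : ℂ → ℂ)
    (hp : 0 < p) (hpq : p ≤ q) (hp1 : p ≤ 1)
    (hr : 0 < r) (hrs : r ≤ s) (hr1 : r ≤ 1)
    (hα0 : 0 < α) (hα1 : α ≤ 1)
    (hsurj : f '' spiral p q = spiral r s)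
    (hf : HolderOnSet f α (spiral p q)) :
    α ≤ (2 + q - p) * (1 + s) / ((2 + s - r) * (1 + q)) := by
  have hs : 0 < s := hr.trans_le hrs
  have hq : 0 < q := hp.trans_le hpq
  suffices h : ∀ ε > 0, α * (1 + q) * (2 + s - r) / (1 + s) ≤ 2 + q - p + ε by
    have h := le_of_forall_pos_le_add h
    rw [div_le_iff₀ (by positivity)] at h
    rw [le_div_iff₀ (mul_pos (by linarith) (by linarith))]
    linarith
  intro ε hε
  obtain ⟨c, hc, hf⟩ := hf
  obtain ⟨κ, C, hκ, hC, hlow⟩ := exists_volume_le_near_spiral hr hrs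
  obtain ⟨L, hL, hup⟩ := exists_spiral_net hp hpq hp1 hε
  set θ := α * (1 + q) / (1 + s) with hθ
  have hθ0 : 0 < θ := by positivity
  set K := C + c * L ^ α with hK
  have hK0 : 0 < K := by positivity
  suffices h : α * (1 + q) * (2 + s - r) / (1 + s) - (2 + q - p + ε) ≤ 0 by linarith
  refine nonpos_of_rpow_bounded (C := 27 * K ^ 2 * Real.pi / κ) ?_
  filter_upwards [Filter.eventually_ge_atTop 1,
    (tendsto_rpow_atTop hθ0).eventually_ge_atTop 10] with X hX hT
  have hX0 : 0 < X := by linarith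
  obtain ⟨E, hE, hEs⟩ := hlow _ hT
  obtain ⟨F, hFs, hFc, hF⟩ := hup X hX
  have hTX : (X ^ θ) ^ (-1 - s) = X ^ (-(α * (1 + q))) := by
    rw [← Real.rpow_mul hX0.le]
    congr 1
    rw [hθ]
    field_simp
    ring
  have hδ : (L * X ^ (-(1 + q))) ^ α = L ^ α * X ^ (-(α * (1 + q))) := by
    rw [Real.mul_rpow hL.le (by positivity), ← Real.rpow_mul hX0.le]
    ring_nf
  have hvol := le_card_mul_of_subset_closedBalls (ρ := K * X ^ (-(α * (1 + q)))) (F := F) f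
    (by positivity) hE fun z hz => by
      obtain ⟨w, hw, hzw⟩ := hEs z hz
      obtain ⟨v, hv, rfl⟩ : w ∈ f '' spiral p q := hsurj ▸ hw
      obtain ⟨u, hu, hvu⟩ := hF v hv
      refine ⟨u, hu, (dist_triangle _ (f v) _).trans ?_⟩
      calc dist z (f v) + dist (f v) (f u)
          ≤ C * (X ^ θ) ^ (-1 - s) + c * (L * X ^ (-(1 + q))) ^ α := by
            refine add_le_add hzw ((hf v hv u (hFs u hu)).trans ?_)
            gcongr
        _ = K * X ^ (-(α * (1 + q))) := by rw [hTX, hδ, hK]; ring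
  have hbound : κ * (X ^ θ) ^ (-r - s) ≤
      27 * X ^ (2 + q - p + ε) * ((K * X ^ (-(α * (1 + q)))) ^ 2 * Real.pi) :=
    hvol.trans (by gcongr)
  rw [le_div_iff₀ hκ]
  set B := X ^ (2 + q - p + ε) * (X ^ (-(α * (1 + q)))) ^ 2 with hB
  have hB0 : 0 < B := by positivity
  have hexp : X ^ (α * (1 + q) * (2 + s - r) / (1 + s) - (2 + q - p + ε)) * B =
      (X ^ θ) ^ (-r - s) := by
    rw [hB, ← Real.rpow_natCast, ← Real.rpow_mul hX0.le, ← Real.rpow_mul hX0.le,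
      ← Real.rpow_add hX0, ← Real.rpow_add hX0]
    congr 1
    rw [hθ]
    push_cast
    field_simp
    ring
  refine le_of_mul_le_mul_right ?_ hB0
  rw [← hexp] at hbound
  calc _ = κ * (X ^ (α * (1 + q) * (2 + s - r) / (1 + s) - (2 + q - p + ε)) * B) := by ring
    _ ≤ _ := hbound
    _ = _ := by rw [hB]; ring
end
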